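/- arXiv:1607.08875 — 4 statements merged into one kernel-verified Lean document; each statement's English description precedes it below -/
import Mathlib

section
/- Suppose E ∈ C³(ℝ^N) satisfies λ1(x) < 0 < λ2(x) for all x ∈ ℝ^N and ‖∇E(x)‖ → ∞ as ‖x‖ → ∞. Then for every r > 0 there exist ε_r, δ_r > 0 such that the ε-GAD with any 0 < ε ≤ ε_r and initial conditions ‖x(0)‖ ≤ r, v(0) on the unit sphere with ‖v(0) − v1(x(0))‖ ≤ δ_r (for a suitable sign of v1(x(0))) has a unique global solution (x(t), v(t)) and x(t) converges to an index-1 saddle of E as t → ∞. -/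
open Real Filter Set
open scoped Topology RealInnerProductSpace

noncomputable section
abbrev Vec (N : ℕ) := EuclideanSpace ℝ (Fin N)

noncomputable def hessCLM {N : ℕ} (E : Vec N → ℝ) (x : Vec N) : Vec N →L[ℝ] Vec N :=
  fderiv ℝ (gradient E) x

noncomputable def hessOp {N : ℕ} (E : Vec N → ℝ) (x : Vec N) : Module.End ℝ (Vec N) :=
  (hessCLM E x).toLinearMap

def IsMinEigen {N : ℕ} (T : Module.End ℝ (Vec N)) (lam : ℝ) : Prop :=
  T.HasEigenvalue lam ∧ ∀ μ : ℝ, T.HasEigenvalue μ → lam ≤ μ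

def IsMinEigvec {N : ℕ} (T : Module.End ℝ (Vec N)) (w : Vec N) : Prop :=
  ‖w‖ = 1 ∧ ∃ lam : ℝ, IsMinEigen T lam ∧ T w = lam • w

def TwoSmallestEigen {N : ℕ} (T : Module.End ℝ (Vec N)) (lam1 lam2 : ℝ) : Prop :=
  T.HasEigenvalue lam1 ∧ T.HasEigenvalue lam2 ∧ lam1 ≤ lam2 ∧
    (∀ μ : ℝ, T.HasEigenvalue μ → lam1 ≤ μ) ∧
    (∀ μ : ℝ, T.HasEigenvalue μ → μ = lam1 ∨ lam2 ≤ μ) ∧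
    (lam1 < lam2 → Module.finrank ℝ (T.eigenspace lam1) = 1)

/-- the reflection `(I - 2 w ⊗ w) u`. -/
def reflect {N : ℕ} (w u : Vec N) : Vec N := u - (2 * ⟪w, u⟫) • w

/-- ISD vector field with eigendirection `w`. -/
noncomputable def isdField {N : ℕ} (E : Vec N → ℝ) (x w : Vec N) : Vec N :=
  -(reflect w (gradient E x))

def IsISDSolOn {N : ℕ} (E : Vec N → ℝ) (x : ℝ → Vec N) (s : Set ℝ) : Prop :=
  ∀ t ∈ s, ∃ w : Vec N, IsMinEigvec (hessOp E (x t)) w ∧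
    HasDerivAt x (isdField E (x t) w) t

noncomputable def gadVField {N : ℕ} (E : Vec N → ℝ) (x v : Vec N) : Vec N :=
  -(hessCLM E x v) + ⟪v, hessCLM E x v⟫ • v

def IsGADSolOn {N : ℕ} (E : Vec N → ℝ) (ε : ℝ) (x v : ℝ → Vec N) (s : Set ℝ) : Prop :=
  ∀ t ∈ s, ‖v t‖ = 1 ∧ HasDerivAt x (-(reflect (v t) (gradient E (x t)))) t ∧
    HasDerivAt v ((ε ^ 2)⁻¹ • gadVField E (x t) (v t)) t

def IsIndexOneSaddle {N : ℕ} (E : Vec N → ℝ) (x : Vec N) : Prop :=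
  gradient E x = 0 ∧ ∃ lam1 lam2 : ℝ,
    TwoSmallestEigen (hessOp E x) lam1 lam2 ∧ lam1 < 0 ∧ 0 < lam2

end

theorem gad_ode_global_bdd {Z : Type*} [NormedAddCommGroup Z] [NormedSpace ℝ Z] [CompleteSpace Z]
    (F : Z → Z) (K : NNReal) (hK : LipschitzWith K F) (L : NNReal) (hL : ∀ z, ‖F z‖ ≤ L) (z0 : Z) :
    ∃ z : ℝ → Z, z 0 = z0 ∧ ∀ t, HasDerivAt z (F (z t)) t := by
  have h1 : ∀ T : ℝ, ∃ z : ℝ → Z, z 0 = z0 ∧ ∀ t ∈ Ioo (-T) T, HasDerivAt z (F (z t)) t := by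
    intro T
    by_cases hT : 0 < T
    · have h0 : (0:ℝ) ∈ Icc (-T) T := ⟨by linarith, by linarith⟩
      have hp : IsPicardLindelof (fun _ => F) (⟨0, h0⟩ : Icc (-T) T) z0 (L * ⟨T, hT.le⟩) 0 L K := by
        constructor
        · intro t _
          exact hK.lipschitzOnWith
        · intro x _
          exact continuousOn_const
        · intro t _ x _
          exact hL x
        · simp
          exact le_rfl
      obtain ⟨α, h0, h⟩ := hp.exists_eq_forall_mem_Icc_hasDerivWithinAt₀
      exact ⟨α, h0, fun t ht => (h t (Ioo_subset_Icc_self ht)).hasDerivAt (Icc_mem_nhds ht.1 ht.2)⟩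
    · refine ⟨fun _ => z0, rfl, fun t ht => ?_⟩
      exfalso
      linarith [ht.1, ht.2]
  choose γ h0 hγ using h1
  have key : ∀ a b : ℝ, a ≤ b → ∀ t ∈ Ioo (-a) a, γ a t = γ b t := by
    intro a b hab t ht
    have ha : 0 < a := by linarith [ht.1, ht.2]
    refine ODE_solution_unique_of_mem_Ioo (v := fun _ => F) (s := fun _ => univ) (K := K)
      (t₀ := 0) (a := -a) (b := a)
      (fun t _ => hK.lipschitzOnWith) ⟨by linarith, ha⟩ (fun t ht => ⟨hγ a t ht, mem_univ _⟩)
      (fun t ht => ⟨hγ b t ⟨by linarith [ht.1], by linarith [ht.2]⟩, mem_univ _⟩)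
      ((h0 a).trans (h0 b).symm) ht
  refine ⟨fun t => γ (|t| + 1) t, by simp [h0], fun t => ?_⟩
  have hev : (fun t => γ (|t| + 1) t) =ᶠ[𝓝 t] γ (|t| + 2) := by
    have : ∀ᶠ s in 𝓝 t, |s| < |t| + 1 :=
      (continuous_abs.tendsto t).eventually (eventually_lt_nhds (by linarith))
    filter_upwards [this] with s hs
    refine key _ _ (by linarith) s ?_
    have := abs_lt.1 (show |s| < |s| + 1 by linarith)
    exact this
  have := (hγ (|t| + 2) t (abs_lt.1 (by linarith))).congr_of_eventuallyEq hev
  have he : γ (|t| + 1) t = γ (|t| + 2) t := hev.eq_of_nhds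
  change HasDerivAt _ (F (γ (|t| + 1) t)) t
  rw [he]
  exact this

theorem gad_bootstrap (U : ℝ → Prop) (h0 : U 0)
    (hopen : ∀ t, 0 ≤ t → U t → ∀ᶠ s in 𝓝 t, U s)
    (hcl : ∀ t, 0 < t → (∀ s ∈ Ico 0 t, U s) → U t) : ∀ t, 0 ≤ t → U t := by
  intro T hT
  by_contra hn
  set S := {t : ℝ | 0 ≤ t ∧ ¬ U t} with hS
  have hne : S.Nonempty := ⟨T, hT, hn⟩
  have hbd : BddBelow S := ⟨0, fun t ht => ht.1⟩
  set τ := sInf S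
  have hτ0 : 0 ≤ τ := le_csInf hne fun t ht => ht.1
  have hbelow : ∀ s ∈ Ico 0 τ, U s := by
    intro s hs
    by_contra h
    exact absurd (csInf_le hbd (show s ∈ S from ⟨hs.1, h⟩)) (not_le.2 hs.2)
  have hU : U τ := by
    rcases hτ0.eq_or_lt with h | h
    · rw [← h]; exact h0
    · exact hcl τ h hbelow
  have := hopen τ hτ0 hU
  obtain ⟨d, hd, hd'⟩ := Metric.eventually_nhds_iff.1 this
  obtain ⟨s, hs, hs'⟩ := exists_lt_of_csInf_lt hne (show sInf S < τ + d by change τ < _; linarith)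
  have hge : τ ≤ s := csInf_le hbd hs
  exact hs.2 (hd' (by rw [Real.dist_eq, abs_lt]; constructor <;> linarith))

theorem gad_global_of_invariant {Z : Type*} [NormedAddCommGroup Z] [NormedSpace ℝ Z]
    [FiniteDimensional ℝ Z]
    (F : Z → Z) (hF : ContDiff ℝ 1 F) (U : Set Z) (hU : IsOpen U) (ρ : ℝ) (hρ : 0 < ρ)
    (hUb : ∀ z ∈ U, ‖z‖ ≤ ρ) (z0 : Z) (hz0 : z0 ∈ U)
    (hinv : ∀ (z : ℝ → Z) (T : ℝ), 0 < T → z 0 = z0 → Continuous z →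
      (∀ t ∈ Ico 0 T, HasDerivAt z (F (z t)) t) → (∀ t ∈ Ico 0 T, z t ∈ U) → z T ∈ U) :
    ∃ z : ℝ → Z, z 0 = z0 ∧ Continuous z ∧ ∀ t, 0 ≤ t → HasDerivAt z (F (z t)) t ∧ z t ∈ U := by
  have : CompleteSpace Z := FiniteDimensional.complete ℝ Z
  let χ : ContDiffBump (0 : Z) := ⟨ρ, ρ + 1, hρ, by linarith⟩
  let Fc : Z → Z := fun z => χ z • F z
  have hFc : ContDiff ℝ 1 Fc := χ.contDiff.smul hF
  have hcs : HasCompactSupport Fc := χ.hasCompactSupport.smul_right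
  obtain ⟨K, hK⟩ := ContDiff.lipschitzWith_of_hasCompactSupport hcs hFc (by simp)
  obtain ⟨C, hC⟩ := hcs.exists_bound_of_continuous hFc.continuous
  obtain ⟨z, h0, hz⟩ := gad_ode_global_bdd Fc K hK (Real.toNNReal C)
    (fun z => (hC z).trans (Real.le_coe_toNNReal C)) z0
  have hcont : Continuous z := continuous_iff_continuousAt.2 fun t => (hz t).continuousAt
  have heq : ∀ w ∈ U, Fc w = F w := by
    intro w hw
    have : χ w = 1 := χ.one_of_mem_closedBall (by simpa [χ] using hUb w hw)
    simp [Fc, this]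
  have hall : ∀ t, 0 ≤ t → z t ∈ U := by
    refine gad_bootstrap (fun t => z t ∈ U) (by simpa [h0] using hz0) ?_ ?_
    · intro t _ ht
      exact hcont.continuousAt.eventually (hU.mem_nhds ht)
    · intro t ht h
      refine hinv z t ht h0 hcont (fun s hs => ?_) h
      rw [← heq _ (h s hs)]
      exact hz s
  exact ⟨z, h0, hcont, fun t ht => ⟨by rw [← heq _ (hall t ht)]; exact hz t, hall t ht⟩⟩

theorem gad_decay (w w' : ℝ → ℝ) (k T : ℝ) (hc : ContinuousOn w (Icc 0 T))
    (hw : ∀ t ∈ Ico 0 T, HasDerivAt w (w' t) t) (hb : ∀ t ∈ Ico 0 T, w' t ≤ -k * w t) :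
    ∀ t ∈ Icc 0 T, w t ≤ w 0 * Real.exp (-k * t) := by
  intro t ht
  have hanti : AntitoneOn (fun t => w t * Real.exp (k * t)) (Icc 0 T) := by
    have hd : ∀ t ∈ Ico 0 T, HasDerivAt (fun t => w t * Real.exp (k * t))
        (w' t * Real.exp (k * t) + w t * (Real.exp (k * t) * k)) t := by
      intro t ht
      have h1 : HasDerivAt (fun t : ℝ => k * t) k t := by
        simpa using (hasDerivAt_id t).const_mul k
      exact (hw t ht).mul h1.exp
    refine antitoneOn_of_deriv_nonpos (convex_Icc 0 T) ?_ ?_ ?_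
    · exact hc.mul (by fun_prop)
    · intro s hs
      rw [interior_Icc] at hs
      exact (hd s (Ioo_subset_Ico_self hs)).differentiableAt.differentiableWithinAt
    · intro s hs
      rw [interior_Icc] at hs
      have hs' := Ioo_subset_Ico_self hs
      rw [(hd s hs').deriv]
      have := mul_le_mul_of_nonneg_right (hb s hs') (Real.exp_pos (k * s)).le
      linarith
  have h := hanti (left_mem_Icc.2 (ht.1.trans ht.2)) ht ht.1
  simp only [mul_zero, Real.exp_zero, mul_one] at h
  have h2 := mul_le_mul_of_nonneg_right h (Real.exp_pos (-k * t)).le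
  have h3 : Real.exp (k * t) * Real.exp (-k * t) = 1 := by
    rw [← Real.exp_add]; simp
  rw [mul_assoc, h3, mul_one] at h2
  exact h2

theorem gad_ode_unique {Z : Type*} [NormedAddCommGroup Z] [NormedSpace ℝ Z]
    [FiniteDimensional ℝ Z]
    (F : Z → Z) (hF : ContDiff ℝ 1 F) (f g : ℝ → Z) (h0 : f 0 = g 0)
    (hf : ∀ t, 0 ≤ t → HasDerivAt f (F (f t)) t) (hg : ∀ t, 0 ≤ t → HasDerivAt g (F (g t)) t) :
    ∀ t, 0 ≤ t → f t = g t := by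
  intro T hT
  have hcf : ContinuousOn f (Icc 0 T) := fun t ht => (hf t ht.1).continuousAt.continuousWithinAt
  have hcg : ContinuousOn g (Icc 0 T) := fun t ht => (hg t ht.1).continuousAt.continuousWithinAt
  obtain ⟨A, hA⟩ := isCompact_Icc.exists_bound_of_continuousOn hcf
  obtain ⟨B, hB⟩ := isCompact_Icc.exists_bound_of_continuousOn hcg
  have : ProperSpace Z := FiniteDimensional.proper ℝ Z
  obtain ⟨C, hC⟩ := (isCompact_closedBall (0:Z) (max A B)).exists_bound_of_continuousOn
    (hF.continuous_fderiv (by simp)).continuousOn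
  have hlip : LipschitzOnWith (Real.toNNReal C) F (Metric.closedBall 0 (max A B)) := by
    refine (convex_closedBall (0:Z) (max A B)).lipschitzOnWith_of_nnnorm_fderiv_le
      (𝕜 := ℝ) (fun x _ => (hF.differentiable (by simp)) x) (fun x hx => ?_)
    rw [← NNReal.coe_le_coe]
    exact (hC x hx).trans (Real.le_coe_toNNReal C)
  exact ODE_solution_unique_of_mem_Icc_right (v := fun _ => F)
    (s := fun _ => Metric.closedBall 0 (max A B)) (fun t _ => hlip)
    hcf (fun t ht => (hf t ht.1).hasDerivWithinAt)
    (fun t ht => by simpa using Or.inl (hA t (Ico_subset_Icc_self ht)))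
    hcg (fun t ht => (hg t ht.1).hasDerivWithinAt)
    (fun t ht => by simpa using Or.inr (hB t (Ico_subset_Icc_self ht))) h0 ⟨hT, le_rfl⟩

theorem gad_symm {N : ℕ} (E : Vec N → ℝ) (hE : ContDiff ℝ 3 E) (x u w : Vec N) :
    ⟪hessCLM E x u, w⟫ = ⟪u, hessCLM E x w⟫ := by
  have hd : DifferentiableAt ℝ (fderiv ℝ E) x :=
    (hE.fderiv_right (m := 2) (by norm_num)).differentiable (by simp) x
  have hfd : ∀ u, hessCLM E x u = (InnerProductSpace.toDual ℝ (Vec N)).symm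
      (fderiv ℝ (fderiv ℝ E) x u) := by
    intro u
    have h2 := ((InnerProductSpace.toDual ℝ
      (Vec N)).symm.toContinuousLinearEquiv.toContinuousLinearMap.hasFDerivAt).comp x hd.hasFDerivAt
    have h3 : hessCLM E x = _ := h2.fderiv
    rw [h3]
    rfl
  have hs : IsSymmSndFDerivAt ℝ E x := hE.contDiffAt.isSymmSndFDerivAt (by simp; norm_num)
  rw [← real_inner_comm u, hfd, hfd]
  rw [InnerProductSpace.toDual_symm_apply, InnerProductSpace.toDual_symm_apply]
  exact hs u w

theorem gad_grad_contDiff {N : ℕ} (E : Vec N → ℝ) (hE : ContDiff ℝ 3 E) :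
    ContDiff ℝ 2 (gradient E) := by
  have h1 : ContDiff ℝ 2 (fderiv ℝ E) := hE.fderiv_right (by norm_num)
  exact (InnerProductSpace.toDual ℝ
      (Vec N)).symm.toContinuousLinearEquiv.toContinuousLinearMap.contDiff.comp h1

theorem gad_hess_contDiff {N : ℕ} (E : Vec N → ℝ) (hE : ContDiff ℝ 3 E) :
    ContDiff ℝ 1 (hessCLM E) :=
  (gad_grad_contDiff E hE).fderiv_right (by norm_num)

/-- quadratic form on the complement of the lowest eigenvector. -/
theorem gad_quad {N : ℕ} (T : Vec N →L[ℝ] Vec N) (hT : ∀ u w, ⟪T u, w⟫ = ⟪u, T w⟫)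
    (l1 l2 : ℝ) (h : TwoSmallestEigen (T.toLinearMap) l1 l2) (hlt : l1 < l2)
    (e : Vec N) (he : T e = l1 • e) (hne : e ≠ 0) (z : Vec N) (hz : ⟪e, z⟫ = 0) :
    l2 * ‖z‖ ^ 2 ≤ ⟪z, T z⟫ := by
  obtain ⟨h1, h2, h3, h4, h5, h6⟩ := h
  have hS : T.toLinearMap.IsSymmetric := fun u w => hT u w
  have hn : Module.finrank ℝ (Vec N) = N := by simp
  let b := hS.eigenvectorBasis hn
  have hb : ∀ i, T (b i) = hS.eigenvalues hn i • b i := by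
    intro i
    exact hS.apply_eigenvectorBasis hn i
  have e1 : ‖z‖ ^ 2 = ∑ i, ⟪b i, z⟫ ^ 2 := by
    rw [← b.sum_sq_norm_inner_right z]
    simp
  have e2 : ⟪z, T z⟫ = ∑ i, hS.eigenvalues hn i * ⟪b i, z⟫ ^ 2 := by
    rw [← b.sum_inner_mul_inner z (T z)]
    refine Finset.sum_congr rfl fun i _ => ?_
    rw [← hT, hb, inner_smul_left, real_inner_comm z]
    simp
    ring
  rw [e1, e2, Finset.mul_sum]
  refine Finset.sum_le_sum fun i _ => ?_
  rcases h5 _ (hS.hasEigenvalue_eigenvalues hn i) with hi | hi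
  · have hbi : b i ∈ Module.End.eigenspace T.toLinearMap l1 := by
      rw [Module.End.mem_eigenspace_iff]
      have := hb i
      rw [show hS.eigenvalues hn i = l1 from hi] at this
      exact this
    have hei : e ∈ Module.End.eigenspace T.toLinearMap l1 := by
      rw [Module.End.mem_eigenspace_iff]; exact he
    obtain ⟨a, ha⟩ := (finrank_eq_one_iff_of_nonzero' (⟨e, hei⟩ : Module.End.eigenspace
      T.toLinearMap l1) (by simpa using hne)).1 (h6 hlt) ⟨b i, hbi⟩
    have ha' : a • e = b i := congrArg Subtype.val ha
    rw [← ha', inner_smul_left, hz]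
    simp
  · exact mul_le_mul_of_nonneg_right hi (sq_nonneg _)

theorem gad_coer {N : ℕ} (T : Vec N →L[ℝ] Vec N) (hT : ∀ u w, ⟪T u, w⟫ = ⟪u, T w⟫)
    (l1 l2 : ℝ) (h : TwoSmallestEigen (T.toLinearMap) l1 l2) (hneg : l1 < 0) (hpos : 0 < l2)
    (c : ℝ) (hc : 0 < c) (hcT : ∀ z, c * ‖z‖ ≤ ‖T z‖) (v : Vec N) (hv : ‖v‖ = 1)
    (hR : ⟪v, T v⟫ < 0) (hp : ‖-(T v) + ⟪v, T v⟫ • v‖ ≤ c / 2) (q : Vec N) (hq : ⟪v, q⟫ = 0) :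
    c / 2 * ‖q‖ ^ 2 ≤ ⟪q, T q⟫ := by
  obtain ⟨e, he⟩ := h.1.exists_hasEigenvector
  have he1 : T e = l1 • e := he.apply_eq_smul
  have hl2 : c ≤ l2 := by
    obtain ⟨e2, he2⟩ := h.2.1.exists_hasEigenvector
    have h1 := hcT e2
    rw [show T e2 = l2 • e2 from he2.apply_eq_smul, norm_smul, Real.norm_eq_abs,
      abs_of_pos hpos] at h1
    exact le_of_mul_le_mul_right h1 (norm_pos_iff.2 he2.2)
  have Q := gad_quad T hT l1 l2 h (hneg.trans hpos) e he1 he.2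
  set α := ⟪e, q⟫ with hα
  set β := ⟪e, v⟫ with hβ
  have hβ0 : β ≠ 0 := by
    intro h0
    have := Q v h0
    rw [hv] at this
    linarith
  have hz : ⟪e, α • v - β • q⟫ = 0 := by
    rw [inner_sub_right, inner_smul_right, inner_smul_right]
    ring
  have h1 := Q _ hz
  have hbq : |⟪v, T q⟫| ≤ c / 2 * ‖q‖ := by
    have e1 : ⟪-(T v) + ⟪v, T v⟫ • v, q⟫ = - ⟪v, T q⟫ := by
      rw [inner_add_left, inner_neg_left, inner_smul_left, hq, hT]
      simp
    rw [← abs_neg, ← e1]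
    exact (abs_real_inner_le_norm _ _).trans (by gcongr)
  have e2 : ‖α • v - β • q‖ ^ 2 = α ^ 2 + β ^ 2 * ‖q‖ ^ 2 := by
    rw [← real_inner_self_eq_norm_sq, ← real_inner_self_eq_norm_sq]
    have hq' : ⟪q, v⟫ = 0 := by rw [real_inner_comm]; exact hq
    have hvv : ⟪v, v⟫ = 1 := by rw [real_inner_self_eq_norm_sq, hv]; norm_num
    simp only [inner_sub_left, inner_sub_right, inner_smul_left, inner_smul_right, hq, hq', hvv]
    simp
    ring
  have e3 : ⟪α • v - β • q, T (α • v - β • q)⟫ =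
      α ^ 2 * ⟪v, T v⟫ - 2 * α * β * ⟪v, T q⟫ + β ^ 2 * ⟪q, T q⟫ := by
    have hs : ⟪q, T v⟫ = ⟪v, T q⟫ := by rw [← hT, real_inner_comm]
    simp only [map_sub, map_smul, inner_sub_left, inner_sub_right, inner_smul_left,
      inner_smul_right, hs]
    simp
    ring
  rw [e2, e3] at h1
  have h2 : c * (α ^ 2 + β ^ 2 * ‖q‖ ^ 2) ≤ l2 * (α ^ 2 + β ^ 2 * ‖q‖ ^ 2) := by gcongr
  have h3 : -(2 * α * β * ⟪v, T q⟫) ≤ c / 2 * (α ^ 2 + β ^ 2 * ‖q‖ ^ 2) := by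
    have a1 : -(2 * α * β * ⟪v, T q⟫) ≤ 2 * |α| * |β| * |⟪v, T q⟫| := by
      refine (neg_le_abs _).trans (le_of_eq ?_)
      simp [abs_mul]
    have a2 : 2 * |α| * |β| * |⟪v, T q⟫| ≤ 2 * |α| * |β| * (c / 2 * ‖q‖) := by gcongr
    have a3 := mul_nonneg hc.le (sq_nonneg (|α| - |β| * ‖q‖))
    have a4 : c * (|α| - |β| * ‖q‖) ^ 2 =
        c * (α ^ 2 + β ^ 2 * ‖q‖ ^ 2) - 2 * (c * |α| * |β| * ‖q‖) := by
      rw [← sq_abs α, ← sq_abs β]; ring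
    linarith
  have h4 : α ^ 2 * ⟪v, T v⟫ ≤ 0 := mul_nonpos_of_nonneg_of_nonpos (sq_nonneg _) hR.le
  have h5 : β ^ 2 * (c / 2 * ‖q‖ ^ 2) ≤ β ^ 2 * ⟪q, T q⟫ := by
    have : 0 ≤ c / 2 * α ^ 2 := by positivity
    nlinarith
  exact le_of_mul_le_mul_left h5 (by positivity)

theorem gad_resid_sq {N : ℕ} (T : Vec N →L[ℝ] Vec N) (v : Vec N) (hv : ‖v‖ = 1) :
    ‖-(T v) + ⟪v, T v⟫ • v‖ ^ 2 = ‖T v‖ ^ 2 - ⟪v, T v⟫ ^ 2 := by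
  rw [← real_inner_self_eq_norm_sq, ← real_inner_self_eq_norm_sq]
  have hvv : ⟪v, v⟫ = 1 := by rw [real_inner_self_eq_norm_sq, hv]; norm_num
  simp only [inner_add_left, inner_add_right, inner_neg_left, inner_neg_right, inner_smul_left,
    inner_smul_right, hvv, real_inner_comm v (T v)]
  simp
  ring

theorem gad_R_sq {N : ℕ} (T : Vec N →L[ℝ] Vec N) (c : ℝ) (hc : 0 < c)
    (hcT : ∀ z, c * ‖z‖ ≤ ‖T z‖) (v : Vec N) (hv : ‖v‖ = 1)
    (hp : ‖-(T v) + ⟪v, T v⟫ • v‖ ≤ c / 2) : (c / 2) ^ 2 < ⟪v, T v⟫ ^ 2 := by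
  have h1 := gad_resid_sq T v hv
  have h2 := hcT v
  rw [hv, mul_one] at h2
  have h3 : c ^ 2 ≤ ‖T v‖ ^ 2 := by gcongr
  have h4 : ‖-(T v) + ⟪v, T v⟫ • v‖ ^ 2 ≤ (c / 2) ^ 2 := by gcongr
  nlinarith

theorem gad_refl {N : ℕ} (T : Vec N →L[ℝ] Vec N) (hT : ∀ u w, ⟪T u, w⟫ = ⟪u, T w⟫)
    (c : ℝ) (v : Vec N) (hv : ‖v‖ = 1) (hR : ⟪v, T v⟫ ≤ -(c / 2))
    (hq : ∀ q : Vec N, ⟪v, q⟫ = 0 → c / 2 * ‖q‖ ^ 2 ≤ ⟪q, T q⟫) (g : Vec N) :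
    c / 2 * ‖g‖ ^ 2 ≤ ⟪g, T (reflect v g)⟫ := by
  have hvv : ⟪v, v⟫ = 1 := by rw [real_inner_self_eq_norm_sq, hv]; norm_num
  set a := ⟪v, g⟫ with ha
  set q := g - a • v with hqd
  have hvq : ⟪v, q⟫ = 0 := by
    rw [hqd, inner_sub_right, inner_smul_right, hvv]; simp [ha]
  have hqv : ⟪q, v⟫ = 0 := by rw [real_inner_comm]; exact hvq
  have hg : g = a • v + q := by rw [hqd]; abel
  have hr : reflect v g = q - a • v := by
    unfold reflect
    rw [← ha, hqd, two_mul, add_smul]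
    abel
  have hs : ⟪q, T v⟫ = ⟪v, T q⟫ := by rw [← hT, real_inner_comm]
  have e1 : ⟪g, T (reflect v g)⟫ = ⟪q, T q⟫ - a ^ 2 * ⟪v, T v⟫ := by
    rw [hr]
    nth_rw 1 [hg]
    simp only [map_sub, map_smul, inner_sub_right, inner_add_left, inner_smul_left,
      inner_smul_right, hs]
    simp
    ring
  have e2 : ‖g‖ ^ 2 = a ^ 2 + ‖q‖ ^ 2 := by
    rw [← real_inner_self_eq_norm_sq, ← real_inner_self_eq_norm_sq]
    nth_rw 1 2 [hg]
    simp only [inner_add_right, inner_add_left, inner_smul_left,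
      inner_smul_right, hvq, hqv, hvv]
    simp
    ring
  rw [e1, e2]
  have := hq q hvq
  nlinarith [sq_nonneg a]

theorem gad_refl_norm {N : ℕ} (v g : Vec N) (hv : ‖v‖ = 1) : ‖reflect v g‖ = ‖g‖ := by
  have hvv : ⟪v, v⟫ = 1 := by rw [real_inner_self_eq_norm_sq, hv]; norm_num
  have : ‖reflect v g‖ ^ 2 = ‖g‖ ^ 2 := by
    rw [← real_inner_self_eq_norm_sq, ← real_inner_self_eq_norm_sq]
    unfold reflect
    simp only [inner_sub_right, inner_sub_left, inner_smul_left, inner_smul_right, hvv,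
      real_inner_comm v g]
    simp
    ring
  exact (sq_eq_sq₀ (norm_nonneg _) (norm_nonneg _)).1 this

def gadRegion {N : ℕ} (E : Vec N → ℝ) (G c : ℝ) : Set (Vec N × Vec N) :=
  {z | ‖gradient E z.1‖ < G ∧ ‖z.2‖ < 2 ∧ ‖gadVField E z.1 z.2‖ < c / 2 ∧
    ⟪z.2, hessCLM E z.1 z.2⟫ < 0}

theorem gad_inv {N : ℕ} (E : Vec N → ℝ) (hE : ContDiff ℝ 3 E)
    (lam1 lam2 : Vec N → ℝ)
    (heig : ∀ x : Vec N, TwoSmallestEigen (hessOp E x) (lam1 x) (lam2 x) ∧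
      lam1 x < 0 ∧ 0 < lam2 x)
    (Rad c L G κ : ℝ) (hc : 0 < c) (hLp : 0 ≤ L) (hκ : 0 < κ)
    (hcT : ∀ x : Vec N, ‖x‖ ≤ Rad → ∀ z, c * ‖z‖ ≤ ‖hessCLM E x z‖)
    (hL : ∀ x : Vec N, ‖x‖ ≤ Rad → ‖fderiv ℝ (hessCLM E) x‖ ≤ L)
    (hG : ∀ x : Vec N, ‖gradient E x‖ < G → ‖x‖ ≤ Rad)
    (hκL : 8 * (L * G) ≤ κ * c ^ 2)
    (x v : ℝ → Vec N) (T : ℝ) (hT : 0 < T) (hxc : Continuous x) (hvc : Continuous v)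
    (hx : ∀ t ∈ Ico 0 T, HasDerivAt x (-(reflect (v t) (gradient E (x t)))) t)
    (hv : ∀ t ∈ Ico 0 T, HasDerivAt v (κ • gadVField E (x t) (v t)) t)
    (hU : ∀ t ∈ Ico 0 T, (x t, v t) ∈ gadRegion E G c)
    (hv0 : ‖v 0‖ = 1) (hp0 : ‖gadVField E (x 0) (v 0)‖ ≤ c / 4) :
    ‖v T‖ = 1 ∧ ‖gradient E (x T)‖ ^ 2 ≤ ‖gradient E (x 0)‖ ^ 2 * Real.exp (-c * T) ∧
      (x T, v T) ∈ gadRegion E G c := by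
  have hgC := gad_grad_contDiff E hE
  have hHC := gad_hess_contDiff E hE
  have hgc : Continuous fun t => gradient E (x t) := hgC.continuous.comp hxc
  have hHc : Continuous fun t => hessCLM E (x t) := hHC.continuous.comp hxc
  have hHvc : Continuous fun t => hessCLM E (x t) (v t) := hHc.clm_apply hvc
  have hRc : Continuous fun t => ⟪v t, hessCLM E (x t) (v t)⟫ := hvc.inner hHvc
  have hPc : Continuous fun t => gadVField E (x t) (v t) := hHvc.neg.add (hRc.smul hvc)
  -- the norm of `v`
  have hvnorm : ∀ t ∈ Icc 0 T, ‖v t‖ = 1 := by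
    intro t ht
    have h1 := gad_decay (fun t => (‖v t‖ ^ 2 - 1) ^ 2)
      (fun t => 2 * (‖v t‖ ^ 2 - 1) * (2 * ⟪v t, κ • gadVField E (x t) (v t)⟫)) 0 T
      (by fun_prop) (fun s hs => by
        have := (((hv s hs).norm_sq).sub_const 1).pow 2
        refine (this.congr_deriv ?_)
        simp) (fun s hs => by
        have hR := (hU s hs).2.2.2
        simp only at hR
        have e : ⟪v s, κ • gadVField E (x s) (v s)⟫ =
            κ * (⟪v s, hessCLM E (x s) (v s)⟫ * (‖v s‖ ^ 2 - 1)) := by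
          unfold gadVField
          rw [inner_smul_right, inner_add_right, inner_neg_right, inner_smul_right,
            real_inner_self_eq_norm_sq]
          ring
        rw [e]
        have : 0 ≤ κ * (-⟪v s, hessCLM E (x s) (v s)⟫) * (‖v s‖ ^ 2 - 1) ^ 2 :=
          mul_nonneg (mul_nonneg hκ.le (by linarith)) (sq_nonneg _)
        simp only [neg_zero, zero_mul]
        nlinarith) t ht
    simp only [hv0, neg_zero, zero_mul] at h1
    have h2 : (‖v t‖ ^ 2 - 1) ^ 2 ≤ 0 := by simpa using h1
    have h3 : ‖v t‖ ^ 2 - 1 = 0 := pow_eq_zero_iff (two_ne_zero) |>.1 (le_antisymm h2 (sq_nonneg _))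
    have h4 : ‖v t‖ ^ 2 = 1 ^ 2 := by linarith
    exact (sq_eq_sq₀ (norm_nonneg _) zero_le_one).1 h4
  -- pointwise information
  have hpt : ∀ t ∈ Ico 0 T, ‖x t‖ ≤ Rad ∧ ⟪v t, hessCLM E (x t) (v t)⟫ ≤ -(c / 2) ∧
      ∀ q : Vec N, ⟪v t, q⟫ = 0 → c / 2 * ‖q‖ ^ 2 ≤ ⟪q, hessCLM E (x t) q⟫ := by
    intro t ht
    obtain ⟨u1, u2, u3, u4⟩ := hU t ht
    simp only at u1 u2 u3 u4
    have hr := hG _ u1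
    have hn := hvnorm t (Ico_subset_Icc_self ht)
    refine ⟨hr, ?_, ?_⟩
    · have := gad_R_sq (hessCLM E (x t)) c hc (hcT _ hr) (v t) hn u3.le
      nlinarith
    · intro q hq
      exact gad_coer (hessCLM E (x t)) (gad_symm E hE (x t)) (lam1 (x t)) (lam2 (x t))
        (heig (x t)).1 (heig (x t)).2.1 (heig (x t)).2.2 c hc (hcT _ hr) (v t) hn u4 u3.le q hq
  -- gradient decay
  have hgd : ∀ t ∈ Icc 0 T,
      ‖gradient E (x t)‖ ^ 2 ≤ ‖gradient E (x 0)‖ ^ 2 * Real.exp (-c * t) := by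
    refine gad_decay (fun t => ‖gradient E (x t)‖ ^ 2)
      (fun t => 2 * ⟪gradient E (x t),
        hessCLM E (x t) (-(reflect (v t) (gradient E (x t))))⟫) c T
      (hgc.norm.pow 2).continuousOn (fun s hs => ?_) (fun s hs => ?_)
    · have h1 : HasFDerivAt (gradient E) (hessCLM E (x s)) (x s) :=
        (hgC.differentiable (by simp) (x s)).hasFDerivAt
      exact (h1.comp_hasDerivAt s (hx s hs)).norm_sq
    · obtain ⟨_, h2, h3⟩ := hpt s hs
      have := gad_refl (hessCLM E (x s)) (gad_symm E hE (x s)) c (v s)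
        (hvnorm s (Ico_subset_Icc_self hs)) h2 h3 (gradient E (x s))
      simp only [map_neg, inner_neg_right]
      linarith
  -- residual
  have hpd : ∀ t ∈ Icc 0 T, ‖gadVField E (x t) (v t)‖ ^ 2 ≤ c ^ 2 / 8 := by
    intro t ht
    have hder : ∀ s ∈ Ico 0 T, ∃ d, HasDerivAt (fun t => ‖gadVField E (x t) (v t)‖ ^ 2) d s ∧
        d ≤ -(κ * c) * (‖gadVField E (x s) (v s)‖ ^ 2 - c ^ 2 / 8) := by
      intro s hs
      obtain ⟨h1, h2, h3⟩ := hpt s hs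
      obtain ⟨u1, u2, u3, u4⟩ := hU s hs
      simp only at u1 u2 u3 u4
      have hn := hvnorm s (Ico_subset_Icc_self hs)
      set P := gadVField E (x s) (v s) with hP
      set H := hessCLM E (x s) with hH
      set A := fderiv ℝ (hessCLM E) (x s) (-(reflect (v s) (gradient E (x s)))) with hA
      have dH : HasDerivAt (fun t => hessCLM E (x t)) A s :=
        ((hHC.differentiable (by simp) (x s)).hasFDerivAt).comp_hasDerivAt s (hx s hs)
      have dHv := dH.clm_apply (hv s hs)
      have dR := (hv s hs).inner ℝ dHv
      have dP := (dHv.neg.add (dR.smul (hv s hs))).norm_sq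
      refine ⟨_, dP, ?_⟩
      have hPv : ⟪P, v s⟫ = 0 := by
        rw [hP, gadVField, inner_add_left, inner_neg_left, inner_smul_left,
          real_inner_self_eq_norm_sq, hn, real_inner_comm]
        simp
      have hAn : ‖A‖ ≤ L * G := by
        refine (ContinuousLinearMap.le_opNorm _ _).trans ?_
        rw [norm_neg, gad_refl_norm _ _ hn]
        exact mul_le_mul (hL _ h1) u1.le (norm_nonneg _) hLp
      have hPA : -⟪P, A (v s)⟫ ≤ c / 2 * (L * G) := by
        have a1 : ‖A (v s)‖ ≤ L * G := by
          have := A.le_opNorm (v s)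
          rw [hn, mul_one] at this
          exact this.trans hAn
        calc -⟪P, A (v s)⟫ ≤ |⟪P, A (v s)⟫| := neg_le_abs _
          _ ≤ ‖P‖ * ‖A (v s)‖ := abs_real_inner_le_norm _ _
          _ ≤ c / 2 * (L * G) := mul_le_mul u3.le a1 (norm_nonneg _) (by positivity)
      have hPP := h3 P (by rw [real_inner_comm]; exact hPv)
      have hR : ⟪v s, H (v s)⟫ * ‖P‖ ^ 2 ≤ 0 :=
        mul_nonpos_of_nonpos_of_nonneg u4.le (sq_nonneg _)
      have hk : κ * (c / 2 * ‖P‖ ^ 2 ) ≤ κ * (⟪P, H P⟫ - ⟪v s, H (v s)⟫ * ‖P‖ ^ 2) := by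
        gcongr
        linarith
      have hfin : c * (L * G) ≤ c * (κ * c ^ 2 / 8) := by
        gcongr
        linarith
      have key : ∀ r' : ℝ, 2 * ⟪P, -(A (v s) + H (κ • P)) + (⟪v s, H (v s)⟫ • (κ • P) + r' • v s)⟫
          = 2 * (-⟪P, A (v s)⟫) - 2 * (κ * (⟪P, H P⟫ - ⟪v s, H (v s)⟫ * ‖P‖ ^ 2)) := by
        intro r'
        simp only [inner_add_right, inner_neg_right, inner_smul_right, map_smul, hPv,
          real_inner_self_eq_norm_sq]
        ring
      refine (key _).le.trans ?_
      linarith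
    choose! d hd hd' using hder
    have h1 := gad_decay (fun t => ‖gadVField E (x t) (v t)‖ ^ 2 - c ^ 2 / 8) d (κ * c) T
      ((hPc.norm.pow 2).sub continuous_const).continuousOn (fun s hs => (hd s hs).sub_const _) hd' t ht
    have h2 : ‖gadVField E (x 0) (v 0)‖ ^ 2 - c ^ 2 / 8 ≤ 0 := by
      have : ‖gadVField E (x 0) (v 0)‖ ^ 2 ≤ (c / 4) ^ 2 := by gcongr
      nlinarith
    have h3 := mul_nonpos_of_nonpos_of_nonneg h2 (Real.exp_pos (-(κ * c) * t)).le
    linarith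
  have hTm : T ∈ Icc 0 T := ⟨hT.le, le_rfl⟩
  have hvT := hvnorm T hTm
  have hgT := hgd T hTm
  have hG0 := (hU 0 ⟨le_rfl, hT⟩).1
  simp only at hG0
  have hgT' : ‖gradient E (x T)‖ < G := by
    refine lt_of_le_of_lt ?_ hG0
    refine (sq_le_sq₀ (norm_nonneg _) (norm_nonneg _)).1 (hgT.trans ?_)
    refine mul_le_of_le_one_right (sq_nonneg _) ?_
    rw [Real.exp_le_one_iff]
    nlinarith
  have hPT : ‖gadVField E (x T) (v T)‖ < c / 2 := by
    refine (sq_lt_sq₀ (norm_nonneg _) (by positivity)).1 ((hpd T hTm).trans_lt ?_)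
    nlinarith
  refine ⟨hvT, hgT, hgT', ?_, hPT, ?_⟩
  · simp only [hvT]; norm_num
  · have hR2 := gad_R_sq (hessCLM E (x T)) c hc (hcT _ (hG _ hgT')) (v T) hvT hPT.le
    have hRle : ⟪v T, hessCLM E (x T) (v T)⟫ ≤ 0 := by
      have hlim : Tendsto (fun t => ⟪v t, hessCLM E (x t) (v t)⟫) (𝓝[<] T)
          (𝓝 ⟪v T, hessCLM E (x T) (v T)⟫) := hRc.continuousAt.tendsto.mono_left nhdsWithin_le_nhds
      refine le_of_tendsto hlim ?_
      filter_upwards [Ioo_mem_nhdsLT hT] with s hs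
      exact (hU s ⟨hs.1.le, hs.2⟩).2.2.2.le
    rcases hRle.eq_or_lt with h | h
    · rw [h] at hR2
      nlinarith
    · exact h

theorem gad_field_contDiff {N : ℕ} (E : Vec N → ℝ) (hE : ContDiff ℝ 3 E) (κ : ℝ) :
    ContDiff ℝ 1 (fun z : Vec N × Vec N =>
      ((-(reflect z.2 (gradient E z.1)), κ • gadVField E z.1 z.2) : Vec N × Vec N)) := by
  have hg : ContDiff ℝ 1 (fun z : Vec N × Vec N => gradient E z.1) :=
    ((gad_grad_contDiff E hE).of_le (by norm_num)).comp contDiff_fst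
  have hH : ContDiff ℝ 1 (fun z : Vec N × Vec N => hessCLM E z.1) :=
    (gad_hess_contDiff E hE).comp contDiff_fst
  have hHv : ContDiff ℝ 1 (fun z : Vec N × Vec N => hessCLM E z.1 z.2) :=
    hH.clm_apply contDiff_snd
  refine ContDiff.prodMk ?_ ?_
  · unfold reflect
    exact (hg.sub ((contDiff_const.mul (contDiff_snd.inner ℝ hg)).smul contDiff_snd)).neg
  · unfold gadVField
    exact (hHv.neg.add ((contDiff_snd.inner ℝ hHv).smul contDiff_snd)).const_smul κ

theorem gad_region_open {N : ℕ} (E : Vec N → ℝ) (hE : ContDiff ℝ 3 E) (G c : ℝ) :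
    IsOpen (gadRegion E G c) := by
  have hg : Continuous (fun z : Vec N × Vec N => gradient E z.1) :=
    (gad_grad_contDiff E hE).continuous.comp continuous_fst
  have hH : Continuous (fun z : Vec N × Vec N => hessCLM E z.1) :=
    (gad_hess_contDiff E hE).continuous.comp continuous_fst
  have hHv : Continuous (fun z : Vec N × Vec N => hessCLM E z.1 z.2) :=
    hH.clm_apply continuous_snd
  have hR : Continuous (fun z : Vec N × Vec N => ⟪z.2, hessCLM E z.1 z.2⟫) :=
    continuous_snd.inner hHv
  have hP : Continuous (fun z : Vec N × Vec N => gadVField E z.1 z.2) :=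
    hHv.neg.add (hR.smul continuous_snd)
  exact (isOpen_lt hg.norm continuous_const).inter ((isOpen_lt continuous_snd.norm
    continuous_const).inter ((isOpen_lt hP.norm continuous_const).inter
      (isOpen_lt hR continuous_const)))

theorem gad_coercive_const {N : ℕ} (E : Vec N → ℝ) (hE : ContDiff ℝ 3 E)
    (lam1 lam2 : Vec N → ℝ)
    (heig : ∀ x : Vec N, TwoSmallestEigen (hessOp E x) (lam1 x) (lam2 x) ∧
      lam1 x < 0 ∧ 0 < lam2 x) (Rad : ℝ) :
    ∃ c : ℝ, 0 < c ∧ ∀ x : Vec N, ‖x‖ ≤ Rad → ∀ z, c * ‖z‖ ≤ ‖hessCLM E x z‖ := by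
  have hH : Continuous (fun z : Vec N × Vec N => hessCLM E z.1) :=
    (gad_hess_contDiff E hE).continuous.comp continuous_fst
  have hHv : Continuous (fun z : Vec N × Vec N => hessCLM E z.1 z.2) :=
    hH.clm_apply continuous_snd
  have hpos : ∀ b ∈ Metric.closedBall (0 : Vec N) Rad ×ˢ Metric.sphere (0 : Vec N) 1,
      0 < ‖hessCLM E b.1 b.2‖ := by
      rintro ⟨x, z⟩ ⟨_, hz⟩
      simp only [mem_sphere_iff_norm, sub_zero] at hz
      rw [norm_pos_iff]
      intro h0
      have hz0 : z ≠ 0 := by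
        rintro rfl
        simp at hz
      have : (hessOp E x).HasEigenvalue 0 := by
        refine Module.End.hasEigenvalue_of_hasEigenvector (x := z) ⟨?_, hz0⟩
        rw [Module.End.mem_eigenspace_iff, zero_smul]
        exact h0
      obtain ⟨h1, h2, h3⟩ := heig x
      rcases h1.2.2.2.2.1 0 this with h | h <;> linarith
  obtain ⟨c, hc, h⟩ := ((isCompact_closedBall (0 : Vec N) Rad).prod
    (isCompact_sphere (0 : Vec N) 1)).exists_forall_le' hHv.norm.continuousOn hpos
  refine ⟨c, hc, fun x hx z => ?_⟩
  by_cases hz : z = 0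
  · simp [hz]
  · have hz' : 0 < ‖z‖ := norm_pos_iff.2 hz
    have := h (x, ‖z‖⁻¹ • z) ⟨by simpa using hx, by
      simp [norm_smul, hz'.ne']⟩
    simp only [map_smul, norm_smul, norm_inv, norm_norm] at this
    rw [inv_mul_eq_div, le_div_iff₀ hz'] at this
    exact this

/-- Initial alignment. -/
theorem gad_init {N : ℕ} (T : Vec N →L[ℝ] Vec N)
    (lam c B δ : ℝ) (hc : 0 < c) (hcT : ∀ z, c * ‖z‖ ≤ ‖T z‖) (hB : ‖T‖ ≤ B)
    (hB0 : 0 < B) (hδ : δ = c / (8 * B))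
    (v w : Vec N) (hv : ‖v‖ = 1) (hw : ‖w‖ = 1) (hlam : lam < 0) (hTw : T w = lam • w)
    (hvw : ‖v - w‖ ≤ δ) :
    ‖-(T v) + ⟪v, T v⟫ • v‖ ≤ c / 4 ∧ ⟪v, T v⟫ < 0 := by
  have hlb : |lam| ≤ B := by
    have := T.le_opNorm w
    rw [hTw, norm_smul, hw, mul_one, mul_one, Real.norm_eq_abs] at this
    exact this.trans hB
  have hlc : lam ≤ -c := by
    have := hcT w
    rw [hTw, norm_smul, hw, mul_one, mul_one, Real.norm_eq_abs, abs_of_neg hlam] at this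
    linarith
  have hBδ : B * δ = c / 8 := by rw [hδ]; field_simp
  have hvv : ⟪v, v⟫ = 1 := by rw [real_inner_self_eq_norm_sq, hv]; norm_num
  have hd : ‖T (v - w)‖ ≤ c / 8 := by
    rw [← hBδ]
    exact (T.le_opNorm _).trans (mul_le_mul hB hvw (norm_nonneg _) hB0.le)
  have hd2 : ‖T v - lam • v‖ ≤ c / 4 := by
    have e : T v - lam • v = T (v - w) - lam • (v - w) := by
      rw [map_sub, hTw, smul_sub]; abel
    have h2 : ‖lam • (v - w)‖ ≤ c / 8 := by
      rw [norm_smul, ← hBδ, Real.norm_eq_abs]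
      exact mul_le_mul hlb hvw (norm_nonneg _) hB0.le
    rw [e]
    refine (norm_sub_le _ _).trans ?_
    linarith
  have hR : ⟪v, T v - lam • v⟫ = ⟪v, T v⟫ - lam := by
    rw [inner_sub_right, inner_smul_right, hvv, mul_one]
  constructor
  · refine le_trans ?_ hd2
    refine (sq_le_sq₀ (norm_nonneg _) (norm_nonneg _)).1 ?_
    rw [gad_resid_sq T v hv, ← real_inner_self_eq_norm_sq (T v - lam • v)]
    simp only [inner_sub_left, inner_sub_right, inner_smul_left, inner_smul_right, hvv,
      real_inner_comm v (T v), real_inner_self_eq_norm_sq]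
    simp only [conj_trivial]
    nlinarith [sq_nonneg (⟪v, T v⟫ - lam)]
  · have h3 := abs_real_inner_le_norm v (T v - lam • v)
    rw [hR, hv, one_mul] at h3
    have := (abs_le.1 (h3.trans hd2)).2
    linarith


/-- (Global convergence benchmark.) If `λ1(x) < 0 < λ2(x)` for all `x`
and `‖∇E(x)‖ → ∞` as `‖x‖ → ∞`, then for every `r > 0` there are `ε_r, δ_r > 0` such that
the `ε`-GAD (`0 < ε ≤ ε_r`) started with `‖x(0)‖ ≤ r` and `‖v(0) - v1(x(0))‖ ≤ δ_r` has a
unique global solution which converges to an index-1 saddle. -/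
theorem stmt7 {N : ℕ} (E : Vec N → ℝ) (hE : ContDiff ℝ 3 E)
    (lam1 lam2 : Vec N → ℝ)
    (heig : ∀ x : Vec N, TwoSmallestEigen (hessOp E x) (lam1 x) (lam2 x) ∧
      lam1 x < 0 ∧ 0 < lam2 x)
    (hcoercive : ∀ C : ℝ, ∃ R : ℝ, ∀ x : Vec N, R ≤ ‖x‖ → C ≤ ‖gradient E x‖) :
    ∀ r : ℝ, 0 < r →
      ∃ εr δr : ℝ, 0 < εr ∧ 0 < δr ∧
        ∀ ε : ℝ, 0 < ε → ε ≤ εr →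
        ∀ x0 : Vec N, ‖x0‖ ≤ r → ∀ v0 : Vec N, ‖v0‖ = 1 →
          (∃ w : Vec N, IsMinEigvec (hessOp E x0) w ∧ ‖v0 - w‖ ≤ δr) →
          ∃ x v : ℝ → Vec N, x 0 = x0 ∧ v 0 = v0 ∧
            IsGADSolOn E ε x v (Ici 0) ∧
            (∀ y u : ℝ → Vec N, y 0 = x0 → u 0 = v0 → IsGADSolOn E ε y u (Ici 0) →
              ∀ t ∈ Ici (0:ℝ), y t = x t ∧ u t = v t) ∧
            ∃ xstar : Vec N, IsIndexOneSaddle E xstar ∧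
              Tendsto x atTop (𝓝 xstar) := by
  intro r hr
  have hgC := gad_grad_contDiff E hE
  have hHC := gad_hess_contDiff E hE
  obtain ⟨G0, hG0⟩ := (isCompact_closedBall (0 : Vec N) r).exists_bound_of_continuousOn
    hgC.continuous.continuousOn
  set G := |G0| + 1 with hGdef
  have hGpos : 0 < G := by positivity
  obtain ⟨Rad, hRad⟩ := hcoercive G
  have hG : ∀ x : Vec N, ‖gradient E x‖ < G → ‖x‖ ≤ Rad := by
    intro x hx
    by_contra h
    exact absurd (hRad x (not_le.1 h).le) (not_le.2 hx)
  obtain ⟨c, hc, hcT⟩ := gad_coercive_const E hE lam1 lam2 heig Rad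
  obtain ⟨B0, hB0⟩ := (isCompact_closedBall (0 : Vec N) Rad).exists_bound_of_continuousOn
    hHC.continuous.continuousOn
  obtain ⟨L0, hL0⟩ := (isCompact_closedBall (0 : Vec N) Rad).exists_bound_of_continuousOn
    (hHC.continuous_fderiv (by simp)).continuousOn
  set B := |B0| + 1 with hBdef
  have hBpos : 0 < B := by positivity
  set L := |L0| with hLdef
  have hLnn : 0 ≤ L := abs_nonneg _
  have hL : ∀ x : Vec N, ‖x‖ ≤ Rad → ‖fderiv ℝ (hessCLM E) x‖ ≤ L := fun x hx =>
    (hL0 x (by simpa using hx)).trans (le_abs_self _)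
  have hLG : 0 ≤ L * G := mul_nonneg hLnn hGpos.le
  refine ⟨min 1 (c ^ 2 / (8 * (L * G) + 1)), c / (8 * B), by positivity, by positivity, ?_⟩
  intro ε hε hεr x0 hx0 v0 hv0 ⟨w, ⟨hw, lam, hlam, hTw⟩, hvw⟩
  have hκ : 0 < (ε ^ 2)⁻¹ := by positivity
  have hκL : 8 * (L * G) ≤ (ε ^ 2)⁻¹ * c ^ 2 := by
    have h1 : ε ≤ 1 := hεr.trans (min_le_left _ _)
    have h2 : ε ≤ c ^ 2 / (8 * (L * G) + 1) := hεr.trans (min_le_right _ _)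
    have h3 : ε ^ 2 ≤ c ^ 2 / (8 * (L * G) + 1) := by nlinarith
    rw [le_div_iff₀ (by positivity)] at h3
    rw [inv_mul_eq_div, le_div_iff₀ (by positivity)]
    nlinarith [sq_nonneg ε]
  unfold IsGADSolOn
  generalize (ε ^ 2)⁻¹ = κ at hκ hκL ⊢
  have hgx0 : ‖gradient E x0‖ < G := by
    have := (hG0 x0 (by simpa using hx0)).trans (le_abs_self _)
    linarith
  have hxR := hG x0 hgx0
  have hlamneg : lam < 0 := (hlam.2 _ (heig x0).1.1).trans_lt (heig x0).2.1
  obtain ⟨hi1, hi2⟩ := gad_init (hessCLM E x0) lam c B (c / (8 * B)) hc (hcT x0 hxR)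
    (((hB0 x0 (by simpa using hxR)).trans (le_abs_self _)).trans (by linarith)) hBpos rfl
    v0 w hv0 hw hlamneg hTw hvw
  have hFC := gad_field_contDiff E hE κ
  set F : Vec N × Vec N → Vec N × Vec N := fun z =>
    (-(reflect z.2 (gradient E z.1)), κ • gadVField E z.1 z.2) with hF
  have hfst : ∀ (z : ℝ → Vec N × Vec N) (t : ℝ), HasDerivAt z (F (z t)) t →
      HasDerivAt (fun t => (z t).1) (-(reflect (z t).2 (gradient E (z t).1))) t :=
    fun z t h => (hasFDerivAt_fst (p := z t)).comp_hasDerivAt t h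
  have hsnd : ∀ (z : ℝ → Vec N × Vec N) (t : ℝ), HasDerivAt z (F (z t)) t →
      HasDerivAt (fun t => (z t).2) (κ • gadVField E (z t).1 (z t).2) t :=
    fun z t h => (hasFDerivAt_snd (p := z t)).comp_hasDerivAt t h
  have hinv : ∀ (z : ℝ → Vec N × Vec N) (T : ℝ), 0 < T → z 0 = (x0, v0) → Continuous z →
      (∀ t ∈ Ico 0 T, HasDerivAt z (F (z t)) t) → (∀ t ∈ Ico 0 T, z t ∈ gadRegion E G c) →
      ‖(z T).2‖ = 1 ∧
        ‖gradient E (z T).1‖ ^ 2 ≤ ‖gradient E x0‖ ^ 2 * Real.exp (-c * T) ∧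
      z T ∈ gadRegion E G c := by
    intro z T hT hz0 hzc hz hzU
    have := gad_inv E hE lam1 lam2 heig Rad c L G κ hc hLnn hκ hcT hL hG hκL
      (fun t => (z t).1) (fun t => (z t).2) T hT hzc.fst hzc.snd
      (fun t ht => hfst z t (hz t ht)) (fun t ht => hsnd z t (hz t ht)) hzU
      (by simpa [hz0] using hv0) (by simpa [hz0, gadVField] using hi1)
    simpa [hz0] using this
  obtain ⟨z, hz0, hzc, hz⟩ := gad_global_of_invariant F hFC (gadRegion E G c)
    (gad_region_open E hE G c) (max Rad 2) (by positivity)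
    (fun z hz => by
      rw [Prod.norm_def]
      exact max_le_max (hG _ hz.1) hz.2.1.le) (x0, v0)
    ⟨hgx0, by simp only [hv0]; norm_num, lt_of_le_of_lt hi1 (by linarith), hi2⟩
    (fun z T hT h0 hc' h1 h2 => (hinv z T hT h0 hc' h1 h2).2.2)
  have hzall : ∀ T, 0 ≤ T → ‖(z T).2‖ = 1 ∧
      ‖gradient E (z T).1‖ ^ 2 ≤ ‖gradient E x0‖ ^ 2 * Real.exp (-c * T) := by
    intro T hT
    rcases hT.eq_or_lt with h | h
    · rw [← h, hz0]
      simp [hv0]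
    · have := hinv z T h hz0 hzc (fun t ht => (hz t ht.1).1) (fun t ht => (hz t ht.1).2)
      exact ⟨this.1, this.2.1⟩
  refine ⟨fun t => (z t).1, fun t => (z t).2, by simp [hz0], by simp [hz0], ?_, ?_, ?_⟩
  · intro t ht
    exact ⟨(hzall t ht).1, hfst z t (hz t ht).1, hsnd z t (hz t ht).1⟩
  · intro y u hy0 hu0 hyu t ht
    have := gad_ode_unique F hFC (fun t => (y t, u t)) z (by simp [hy0, hu0, hz0])
      (fun s hs => (hyu s hs).2.1.prodMk (hyu s hs).2.2) (fun s hs => (hz s hs).1) t ht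
    simp only [← this, and_self]
  · have hbound : ∀ t, 0 ≤ t → ‖gradient E (z t).1‖ ≤ G * Real.exp (-(c / 2) * t) := by
      intro t ht
      refine (sq_le_sq₀ (norm_nonneg _) (by positivity)).1 ((hzall t ht).2.trans ?_)
      rw [mul_pow, ← Real.exp_nat_mul]
      rw [show ((2 : ℕ) : ℝ) * (-(c / 2) * t) = -c * t by push_cast; ring]
      gcongr
    have hgz : Continuous fun t => gradient E (z t).1 := hgC.continuous.comp hzc.fst
    have hcx : Continuous fun t => -(reflect (z t).2 (gradient E (z t).1)) :=
      (hFC.continuous.comp hzc).fst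
    have hint : MeasureTheory.IntegrableOn
        (fun t => -(reflect (z t).2 (gradient E (z t).1))) (Ioi 0) := by
      refine MeasureTheory.Integrable.mono'
        ((exp_neg_integrableOn_Ioi 0 (half_pos hc)).const_mul G)
        hcx.aestronglyMeasurable ?_
      refine (MeasureTheory.ae_restrict_iff' measurableSet_Ioi).2 (Eventually.of_forall ?_)
      intro t ht
      rw [norm_neg, gad_refl_norm _ _ (hzall t (le_of_lt ht)).1]
      exact hbound t (le_of_lt ht)
    have hlim := MeasureTheory.tendsto_limUnder_of_hasDerivAt_of_integrableOn_Ioi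
      (f := fun t => (z t).1) (a := 0)
      (fun t ht => hfst z t (hz t (le_of_lt ht)).1) hint
    refine ⟨_, ⟨?_, lam1 _, lam2 _, heig _⟩, hlim⟩
    have h1 := (hgC.continuous.tendsto _).comp hlim
    refine tendsto_nhds_unique h1 ?_
    rw [tendsto_zero_iff_norm_tendsto_zero]
    have h2 : Tendsto (fun t => G * Real.exp (-(c / 2) * t)) atTop (𝓝 0) := by
      have h3 : Tendsto (fun t : ℝ => -(c / 2) * t) atTop atBot :=
        tendsto_id.const_mul_atTop_of_neg (by linarith)
      simpa using (Real.tendsto_exp_atBot.comp h3).const_mul G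
    refine tendsto_of_tendsto_of_tendsto_of_le_of_le' tendsto_const_nhds h2
      (Eventually.of_forall fun t => norm_nonneg _) ?_
    filter_upwards [eventually_ge_atTop 0] with t ht
    exact hbound t ht
end

section
/- Let B be a real 2×2 matrix both of whose eigenvalues have strictly positive real part, let C > 0, and let g : ℝ² → ℝ² be continuous with ‖g(x)‖ ≤ C‖x‖² in a neighborhood of 0. Consider the ODE ẋ = (−B x + g(x)) / ‖B x‖, defined where B x ≠ 0. Then for every initial condition x(0) ≠ 0 with ‖x(0)‖ sufficiently small, the maximal solution x ∈ C¹([0, T*)) has finite blow-up time T* < ∞ and x(t) → 0 as t → T*. -/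
open Real Filter Set
open scoped Topology

theorem peano_approx {E : Type*} [NormedAddCommGroup E] [NormedSpace ℝ E] [FiniteDimensional ℝ E]
    (F : E → E) (hF : Continuous F) (M : ℝ) (hM : ∀ x, ‖F x‖ ≤ M) (x0 : E) (η : ℝ) (h0 : 0 < η)
    (h1 : η ≤ 1) :
    ∃ α : ℝ → E, ∃ v : ℝ → E, α 0 = x0 ∧ ∀ t ∈ Icc (-1:ℝ) 1, ‖v t - F (α t)‖ ≤ η ∧
      ‖v t‖ ≤ M + 1 ∧ HasDerivWithinAt α (v t) (Icc (-1:ℝ) 1) t := by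
  obtain ⟨G, hG, hGF, -⟩ := hF.exists_contDiff_approx (ε := fun _ => η) 1 continuous_const
    (fun _ => h0)
  have hM0 : 0 ≤ M := (norm_nonneg _).trans (hM x0)
  have hGb : ∀ x, ‖G x‖ ≤ M + 1 := by
    intro x
    have a := hGF x
    rw [dist_eq_norm] at a
    have b := norm_sub_norm_le (G x) (F x)
    linarith [hM x]
  obtain ⟨K, hK⟩ := (hG.contDiffOn (s := Metric.closedBall x0 (M+1))).exists_lipschitzOnWith
    (by simp) (convex_closedBall _ _) (isCompact_closedBall _ _)
  have hPL : IsPicardLindelof (fun _ => G) (tmin := -1) (tmax := 1) ⟨0, by norm_num⟩ x0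
      ⟨M+1, by linarith⟩ 0 ⟨M+1, by linarith⟩ K := by
    apply IsPicardLindelof.of_time_independent
    · intro x _
      exact hGb x
    · exact hK
    · simp
  obtain ⟨α, ha0, ha⟩ := hPL.exists_eq_forall_mem_Icc_hasDerivWithinAt₀
  refine ⟨α, fun t => G (α t), ha0, fun t ht => ⟨?_, hGb _, ha t ht⟩⟩
  rw [← dist_eq_norm]
  exact (hGF _).le

theorem peano_bdd {E : Type*} [NormedAddCommGroup E] [NormedSpace ℝ E] [FiniteDimensional ℝ E]
    (F : E → E) (hF : Continuous F) (M : ℝ) (hM : ∀ x, ‖F x‖ ≤ M) (x0 : E) :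
    ∃ x : ℝ → E, x 0 = x0 ∧ ∀ t ∈ Ioo (-1:ℝ) 1, HasDerivAt x (F (x t)) t := by
  have hex := fun n : ℕ => peano_approx F hF M hM x0 (1 / ((n:ℝ) + 1)) (by positivity)
    (by rw [div_le_one (by positivity)]; linarith [n.cast_nonneg (α := ℝ)])
  choose α v ha0 ha using hex
  have hM0 : 0 ≤ M := (norm_nonneg _).trans (hM x0)
  have hlip : ∀ n, ∀ s ∈ Icc (-1:ℝ) 1, ∀ t ∈ Icc (-1:ℝ) 1, ‖α n t - α n s‖ ≤ (M+1) * ‖t - s‖ := by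
    intro n s hs t ht
    exact (convex_Icc (-1:ℝ) 1).norm_image_sub_le_of_norm_hasDerivWithin_le
      (fun u hu => (ha n u hu).2.2) (fun u hu => (ha n u hu).2.1) hs ht
  let U : Ultrafilter ℕ := Filter.hyperfilter ℕ
  have hU : (U : Filter ℕ) ≤ atTop := by
    rw [← Nat.cofinite_eq_atTop]; exact Filter.hyperfilter_le_cofinite
  have hlim : ∀ t : ℝ, ∃ y, t ∈ Icc (-1:ℝ) 1 → Tendsto (fun n => α n t) U (𝓝 y) := by
    intro t
    by_cases ht : t ∈ Icc (-1:ℝ) 1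
    · have hmem : ∀ n, α n t ∈ Metric.closedBall x0 ((M+1) * ‖t - 0‖) := by
        intro n
        rw [mem_closedBall_iff_norm, ← ha0 n]
        exact hlip n 0 (by norm_num) t ht
      obtain ⟨y, -, hy⟩ := (isCompact_closedBall x0 ((M+1) * ‖t - 0‖)).ultrafilter_le_nhds
        (U.map (fun n => α n t)) (by
          rw [le_principal_iff]
          exact Filter.Eventually.of_forall (f := (U : Filter ℕ)) hmem)
      exact ⟨y, fun _ => hy⟩
    · exact ⟨0, fun h => absurd h ht⟩
  choose x hx using hlim
  refine ⟨x, ?_, ?_⟩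
  · have := hx 0 (by norm_num)
    simp only [ha0] at this
    exact (tendsto_nhds_unique this tendsto_const_nhds)
  intro t ht
  have htI : t ∈ Icc (-1:ℝ) 1 := Ioo_subset_Icc_self ht
  rw [hasDerivAt_iff_isLittleO, Asymptotics.isLittleO_iff]
  intro c hc
  obtain ⟨δ, hδ, hFδ⟩ := Metric.continuousAt_iff.1 (hF.continuousAt (x := x t)) (c/2) (by linarith)
  obtain ⟨ρ, hρ, hρI⟩ := Metric.isOpen_iff.1 isOpen_Ioo t ht
  have hρ' : 0 < min ρ (δ / (2 * (M+1))) := lt_min hρ (by positivity)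
  filter_upwards [Metric.ball_mem_nhds t hρ'] with s hs
  have hsub : Metric.ball t (min ρ (δ / (2 * (M+1)))) ⊆ Icc (-1:ℝ) 1 :=
    (Metric.ball_subset_ball (min_le_left _ _)).trans (hρI.trans Ioo_subset_Icc_self)
  have hev1 : ∀ᶠ n in (U : Filter ℕ), ‖α n t - x t‖ < δ / 2 := by
    have := (hx t htI).eventually (Metric.ball_mem_nhds _ (half_pos hδ))
    filter_upwards [this] with n hn
    simpa [dist_eq_norm] using hn
  have hev2 : ∀ᶠ n : ℕ in (U : Filter ℕ), 1 / ((n:ℝ)+1) < c / 2 :=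
    hU (tendsto_one_div_add_atTop_nhds_zero_nat.eventually (gt_mem_nhds (half_pos hc)))
  have hev : ∀ᶠ n in (U : Filter ℕ), ‖α n s - α n t - (s - t) • F (x t)‖ ≤ c * ‖s - t‖ := by
    filter_upwards [hev1, hev2] with n h1 h2
    have key := (convex_ball t (min ρ (δ / (2 * (M+1))))).norm_image_sub_le_of_norm_hasDerivWithin_le
      (f := fun u => α n u - (u - t) • F (x t)) (f' := fun u => v n u - (1:ℝ) • F (x t)) (C := c)
      (x := t) (y := s)
      (fun u hu => by
        refine HasDerivWithinAt.sub ((ha n u (hsub hu)).2.2.mono hsub) ?_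
        exact (((hasDerivAt_id u).sub_const t).smul_const (F (x t))).hasDerivWithinAt)
      (fun u hu => by
        rw [one_smul]
        have e1 := (ha n u (hsub hu)).1
        have e2 := hlip n t htI u (hsub hu)
        have hu2 : ‖u - t‖ < δ / (2 * (M+1)) := by
          rw [mem_ball_iff_norm] at hu; exact hu.trans_le (min_le_right _ _)
        rw [lt_div_iff₀ (by positivity)] at hu2
        have e3 : ‖α n u - x t‖ < δ := by
          have := norm_sub_le_norm_sub_add_norm_sub (α n u) (α n t) (x t)
          nlinarith
        have e4 := hFδ (x := α n u) (by rwa [dist_eq_norm])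
        rw [dist_eq_norm] at e4
        have := norm_sub_le_norm_sub_add_norm_sub (v n u) (F (α n u)) (F (x t))
        linarith)
      (Metric.mem_ball_self hρ') hs
    simpa [sub_right_comm] using key
  refine le_of_tendsto ?_ hev
  exact (((hx s (hsub hs)).sub (hx t htI)).sub tendsto_const_nhds).norm

theorem peano_local {E : Type*} [NormedAddCommGroup E] [NormedSpace ℝ E] [FiniteDimensional ℝ E]
    (F : E → E) (hF : Continuous F) (x0 : E) :
    ∃ x : ℝ → E, x 0 = x0 ∧ ∀ᶠ t in 𝓝 (0:ℝ), HasDerivAt x (F (x t)) t := by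
  have hK : 0 < ‖F x0‖ + 1 := by positivity
  let G : E → E := fun p => (max 1 (‖F p‖ / (‖F x0‖ + 1)))⁻¹ • F p
  have hpos : ∀ p, 0 < max 1 (‖F p‖ / (‖F x0‖ + 1)) := fun p => lt_max_of_lt_left one_pos
  have hG : Continuous G := by
    refine Continuous.smul (Continuous.inv₀ ?_ (fun p => (hpos p).ne')) hF
    fun_prop
  obtain ⟨x, hx0, hx⟩ := peano_bdd G hG (‖F x0‖ + 1) (fun p => by
    simp only [G, norm_smul, norm_inv, Real.norm_of_nonneg (hpos p).le]
    rw [inv_mul_le_iff₀ (hpos p)]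
    have := le_max_right 1 (‖F p‖ / (‖F x0‖ + 1))
    rw [div_le_iff₀ hK] at this
    exact this) x0
  refine ⟨x, hx0, ?_⟩
  have hc : ContinuousAt x 0 := (hx 0 (by norm_num)).continuousAt
  have : ContinuousAt (fun t => ‖F (x t)‖) 0 := (hF.norm.continuousAt).comp hc
  have h2 : ∀ᶠ t in 𝓝 (0:ℝ), ‖F (x t)‖ < ‖F x0‖ + 1 := by
    apply this.eventually (gt_mem_nhds _)
    simp [hx0]
  filter_upwards [h2, Ioo_mem_nhds (show (-1:ℝ) < 0 by norm_num) one_pos] with t h ht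
  have := hx t ht
  have e : G (x t) = F (x t) := by
    simp only [G]
    rw [max_eq_left ((div_le_one hK).2 h.le)]
    simp
  rwa [e] at this

theorem field_contAt {E : Type*} [NormedAddCommGroup E] [NormedSpace ℝ E]
    (b : E →L[ℝ] E) (g : E → E) (hg : Continuous g) (p : E) (hp : b p ≠ 0) :
    ContinuousAt (fun p => ‖b p‖⁻¹ • (-(b p) + g p)) p := by
  have h1 : ContinuousAt (fun p => ‖b p‖⁻¹) p :=
    (b.continuous.norm.continuousAt).inv₀ (by simpa using hp)
  exact h1.smul (by fun_prop)

theorem field_peano {E : Type*} [NormedAddCommGroup E] [NormedSpace ℝ E] [FiniteDimensional ℝ E]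
    (b : E →L[ℝ] E) (g : E → E) (hg : Continuous g) (p : E) (hp : b p ≠ 0) :
    ∃ ε > 0, ∃ y : ℝ → E, y 0 = p ∧ ∀ t ∈ Ioo (-ε) ε, y t ≠ 0 ∧
      HasDerivAt y (‖b (y t)‖⁻¹ • (-(b (y t)) + g (y t))) t := by
  have hδ : 0 < ‖b p‖ / 2 := by have := norm_pos_iff.2 hp; linarith
  have hpos : ∀ q, 0 < max ‖b q‖ (‖b p‖ / 2) := fun q => lt_max_of_lt_right hδ
  obtain ⟨y, hy0, hy⟩ := peano_local (fun q => (max ‖b q‖ (‖b p‖ / 2))⁻¹ • (-(b q) + g q)) (by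
    refine Continuous.smul (Continuous.inv₀ ?_ (fun p => (hpos p).ne')) (by fun_prop)
    fun_prop) p
  have hc : ContinuousAt y 0 := hy.self_of_nhds.continuousAt
  have : ContinuousAt (fun t => ‖b (y t)‖) 0 := (b.continuous.norm.continuousAt).comp hc
  have h2 : ∀ᶠ t in 𝓝 (0:ℝ), ‖b p‖ / 2 < ‖b (y t)‖ := by
    apply this.eventually (lt_mem_nhds _)
    simp only [hy0]; linarith
  obtain ⟨ε, hε, h⟩ := Metric.eventually_nhds_iff_ball.1 (hy.and h2)
  refine ⟨ε, hε, y, hy0, fun t ht => ?_⟩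
  obtain ⟨h3, h4⟩ := h t (by rw [Real.ball_eq_Ioo]; simpa using ht)
  refine ⟨?_, ?_⟩
  · intro h0
    rw [h0] at h4
    simp at h4
    linarith [norm_nonneg (b p)]
  · rwa [max_eq_left h4.le] at h3

section dyn
variable {E : Type*} [NormedAddCommGroup E] [InnerProductSpace ℝ E]

theorem est1 (A b : E →L[ℝ] E) (g : E → E) (d τ C r1 : ℝ)
    (hd : 0 < d) (hτ : 0 < τ) (hC : 0 < C) (hr1 : 0 < r1)
    (hAb : ∀ x, A (b x) = d • x) (hbA : ∀ x, b x + A x = τ • x)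
    (hgC : ∀ p : E, ‖p‖ < r1 → ‖g p‖ ≤ C * ‖p‖ ^ 2) :
    ∃ r > 0, ∃ k > 0, ∃ N > 0, ∀ p : E, p ≠ 0 → ‖p‖ < r →
      2 * (d * inner ℝ p (‖b p‖⁻¹ • (-(b p) + g p)) +
        inner ℝ (A p) (A (‖b p‖⁻¹ • (-(b p) + g p)))) ≤ - k * √(d * ‖p‖^2 + ‖A p‖^2) ∧
      ‖‖b p‖⁻¹ • (-(b p) + g p)‖ ≤ N := by
  have hK : 0 < d + ‖A‖^2 := by positivity
  have hβ : 0 < ‖b‖ + 1 := by positivity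
  refine ⟨min r1 (d * τ / (2 * ((d + ‖A‖^2) * C))), lt_min hr1 (by positivity),
    d * τ / ((‖b‖ + 1) * √(d + ‖A‖^2)), by positivity,
    1 + C * r1 * ‖A‖ / d, by positivity, ?_⟩
  intro p hp hpr
  have hp1 : ‖p‖ < r1 := hpr.trans_le (min_le_left _ _)
  have hp2 := hpr.trans_le (min_le_right _ _)
  rw [lt_div_iff₀ (by positivity)] at hp2
  have hp0 : 0 < ‖p‖ := norm_pos_iff.2 hp
  have hbp : 0 < ‖b p‖ := by
    rw [norm_pos_iff]
    intro h
    have := hAb p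
    rw [h] at this
    rw [map_zero] at this
    exact (smul_ne_zero hd.ne' hp) this.symm
  have hdp : d * ‖p‖ ≤ ‖A‖ * ‖b p‖ := by
    have := A.le_opNorm (b p)
    rwa [hAb, norm_smul, Real.norm_of_nonneg hd.le] at this
  have hgp := hgC p hp1
  constructor
  · have e1 : d * inner ℝ p (‖b p‖⁻¹ • (-(b p) + g p)) +
        inner ℝ (A p) (A (‖b p‖⁻¹ • (-(b p) + g p))) =
        ‖b p‖⁻¹ * (-(d * τ * ‖p‖^2) + (d * inner ℝ p (g p) + inner ℝ (A p) (A (g p)))) := by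
      have h : d * inner ℝ p (b p) + d * inner ℝ p (A p) = d * τ * ‖p‖^2 := by
        rw [← mul_add, ← inner_add_right, hbA, inner_smul_right, real_inner_self_eq_norm_sq]; ring
      simp only [map_smul, map_add, map_neg, hAb, inner_smul_right, inner_add_right, inner_neg_right]
      rw [real_inner_comm p (A p)]
      linear_combination (- ‖b p‖⁻¹) * h
    have e2 : d * inner ℝ p (g p) + inner ℝ (A p) (A (g p)) ≤ (d + ‖A‖^2) * (C * ‖p‖^3) := by
      have i1 := real_inner_le_norm p (g p)
      have i2 := real_inner_le_norm (A p) (A (g p))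
      have i3 := A.le_opNorm p
      have i4 := A.le_opNorm (g p)
      have i5 : ‖A p‖ * ‖A (g p)‖ ≤ (‖A‖ * ‖p‖) * (‖A‖ * ‖g p‖) := by gcongr
      have i6 : ‖p‖ * ‖g p‖ ≤ ‖p‖ * (C * ‖p‖^2) := by gcongr
      calc _ ≤ d * (‖p‖ * ‖g p‖) + (‖A‖ * ‖p‖) * (‖A‖ * ‖g p‖) := by
            gcongr; exact i2.trans i5
        _ = (d + ‖A‖^2) * (‖p‖ * ‖g p‖) := by ring
        _ ≤ (d + ‖A‖^2) * (‖p‖ * (C * ‖p‖^2)) := by gcongr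
        _ = _ := by ring
    have e3 : (d + ‖A‖^2) * (C * ‖p‖^3) ≤ d * τ * ‖p‖^2 / 2 := by
      have := mul_le_mul_of_nonneg_right hp2.le (sq_nonneg ‖p‖)
      nlinarith
    have e4 : √(d * ‖p‖^2 + ‖A p‖^2) ≤ √(d + ‖A‖^2) * ‖p‖ := by
      apply Real.sqrt_le_iff.2
      refine ⟨by positivity, ?_⟩
      rw [mul_pow, Real.sq_sqrt hK.le]
      have := pow_le_pow_left₀ (norm_nonneg _) (A.le_opNorm p) 2
      nlinarith
    have e5 : ‖b p‖ ≤ (‖b‖ + 1) * ‖p‖ := by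
      have := b.le_opNorm p
      linarith
    have e6 : d * τ / ((‖b‖ + 1) * √(d + ‖A‖^2)) * √(d * ‖p‖^2 + ‖A p‖^2) ≤
        ‖b p‖⁻¹ * (d * τ * ‖p‖^2) := by
      calc _ ≤ d * τ / ((‖b‖ + 1) * √(d + ‖A‖^2)) * (√(d + ‖A‖^2) * ‖p‖) := by gcongr
        _ = ((‖b‖+1) * ‖p‖)⁻¹ * (d * τ * ‖p‖^2) := by
            have := (Real.sqrt_pos.2 hK).ne'
            field_simp
        _ ≤ _ := by gcongr
    rw [e1]
    have e7 : ‖b p‖⁻¹ * (-(d * τ * ‖p‖^2) + (d * inner ℝ p (g p) + inner ℝ (A p) (A (g p)))) ≤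
      ‖b p‖⁻¹ * (-(d * τ * ‖p‖^2) / 2) := by
      gcongr
      linarith
    linarith
  · rw [norm_smul, norm_inv, norm_norm, inv_mul_le_iff₀ hbp]
    have := norm_add_le (-(b p)) (g p)
    rw [norm_neg] at this
    have i1 : C * ‖p‖^2 ≤ C * (r1 * ‖p‖) := by rw [sq]; gcongr
    have i2 : C * (r1 * ‖p‖) ≤ ‖b p‖ * (C * r1 * ‖A‖ / d) := by
      rw [mul_div_assoc', le_div_iff₀ hd]
      have := mul_le_mul_of_nonneg_left hdp (by positivity : 0 ≤ C * r1)
      linarith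
    linarith

theorem dyn1 (A : E →L[ℝ] E) (f : E → E) (d r k : ℝ) (hd : 0 < d) (hr : 0 < r) (hk : 0 < k)
    (hf : ∀ p : E, p ≠ 0 → ‖p‖ < r →
      2 * (d * inner ℝ p (f p) + inner ℝ (A p) (A (f p))) ≤ - k * √(d * ‖p‖^2 + ‖A p‖^2)) :
    ∃ r0 > 0, ∀ x0 : E, ‖x0‖ < r0 → ∀ (T : ℝ) (x : ℝ → E), x 0 = x0 →
      (∀ t ∈ Ico (0:ℝ) T, x t ≠ 0 ∧ HasDerivAt x (f (x t)) t) →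
      ∀ t ∈ Ico (0:ℝ) T, ‖x t‖ < r ∧
        √(d * ‖x t‖^2 + ‖A (x t)‖^2) ≤ √(d * ‖x0‖^2 + ‖A x0‖^2) - k / 2 * t := by
  have hK : 0 < d + ‖A‖^2 := by positivity
  refine ⟨r * √(d / (d + ‖A‖^2)), by positivity, ?_⟩
  intro x0 hx0 T x hx hsol
  have hV : ∀ t ∈ Ico (0:ℝ) T, HasDerivAt (fun t => d * ‖x t‖^2 + ‖A (x t)‖^2)
      (2 * (d * inner ℝ (x t) (f (x t)) + inner ℝ (A (x t)) (A (f (x t))))) t := by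
    intro t ht
    have h1 := (hsol t ht).2
    have h2 : HasDerivAt (fun t => A (x t)) (A (f (x t))) t := A.hasFDerivAt.comp_hasDerivAt t h1
    have := (h1.norm_sq.const_mul d).add h2.norm_sq
    exact this.congr_deriv (by ring)
  have hVpos : ∀ t ∈ Ico (0:ℝ) T, 0 < d * ‖x t‖^2 + ‖A (x t)‖^2 := by
    intro t ht
    have := norm_pos_iff.2 (hsol t ht).1
    positivity
  have hV0 : d * ‖x0‖^2 + ‖A x0‖^2 < d * r^2 := by
    have h1 := pow_le_pow_left₀ (norm_nonneg _) (A.le_opNorm x0) 2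
    have h2 := pow_lt_pow_left₀ hx0 (norm_nonneg _) (n := 2) (by norm_num)
    rw [mul_pow, Real.sq_sqrt (by positivity), mul_div_assoc', lt_div_iff₀ hK] at h2
    nlinarith
  have trap : ∀ t ∈ Ico (0:ℝ) T, ‖x t‖ < r := by
    intro t1 ht1
    by_contra hcon
    push Not at hcon
    have hsubT : Icc 0 t1 ⊆ Ico (0:ℝ) T := fun s hs => ⟨hs.1, hs.2.trans_lt ht1.2⟩
    have hcont : ContinuousOn (fun s => ‖x s‖) (Icc 0 t1) := fun s hs =>
      ((hsol s (hsubT hs)).2.continuousAt.norm).continuousWithinAt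
    have hcomp : IsCompact (Icc 0 t1 ∩ (fun s => ‖x s‖) ⁻¹' Ici r) :=
      isCompact_Icc.of_isClosed_subset (hcont.preimage_isClosed_of_isClosed isClosed_Icc isClosed_Ici)
        inter_subset_left
    obtain ⟨s0, hs0, hmin⟩ := hcomp.exists_isLeast ⟨t1, ⟨ht1.1, le_rfl⟩, hcon⟩
    have hsub0 : Icc 0 s0 ⊆ Ico (0:ℝ) T := fun s hs => hsubT ⟨hs.1, hs.2.trans hs0.1.2⟩
    have hanti : AntitoneOn (fun t => d * ‖x t‖^2 + ‖A (x t)‖^2) (Icc 0 s0) := by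
      apply antitoneOn_of_deriv_nonpos (convex_Icc _ _)
      · exact fun s hs => (hV s (hsub0 hs)).continuousAt.continuousWithinAt
      · intro s hs
        rw [interior_Icc] at hs
        exact (hV s (hsub0 (Ioo_subset_Icc_self hs))).differentiableAt.differentiableWithinAt
      · intro s hs
        rw [interior_Icc] at hs
        have hs' := hsub0 (Ioo_subset_Icc_self hs)
        rw [(hV s hs').deriv]
        have hlt : ‖x s‖ < r := by
          by_contra h
          push Not at h
          have := hmin ⟨⟨hs.1.le, hs.2.le.trans hs0.1.2⟩, h⟩
          linarith [hs.2]
        refine (hf _ (hsol s hs').1 hlt).trans ?_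
        have := Real.sqrt_nonneg (d * ‖x s‖^2 + ‖A (x s)‖^2)
        nlinarith
    have h1 := hanti (left_mem_Icc.2 hs0.1.1) (right_mem_Icc.2 hs0.1.1) hs0.1.1
    simp only [hx] at h1
    have h2 : r ≤ ‖x s0‖ := hs0.2
    have h3 : d * r^2 ≤ d * ‖x s0‖^2 := by gcongr
    linarith [sq_nonneg ‖A (x s0)‖]
  intro t ht
  refine ⟨trap t ht, ?_⟩
  have hsub : Icc 0 t ⊆ Ico (0:ℝ) T := fun s hs => ⟨hs.1, hs.2.trans_lt ht.2⟩
  have hW : ∀ s ∈ Icc 0 t, HasDerivAt (fun t => √(d * ‖x t‖^2 + ‖A (x t)‖^2) + k / 2 * t)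
      ((2 * (d * inner ℝ (x s) (f (x s)) + inner ℝ (A (x s)) (A (f (x s))))) /
        (2 * √(d * ‖x s‖^2 + ‖A (x s)‖^2)) + k / 2 * 1) s := by
    intro s hs
    exact ((hV s (hsub hs)).sqrt (hVpos s (hsub hs)).ne').add ((hasDerivAt_id s).const_mul _)
  have hanti : AntitoneOn (fun t => √(d * ‖x t‖^2 + ‖A (x t)‖^2) + k / 2 * t) (Icc 0 t) := by
    apply antitoneOn_of_deriv_nonpos (convex_Icc _ _)
    · exact fun s hs => (hW s hs).continuousAt.continuousWithinAt
    · intro s hs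
      rw [interior_Icc] at hs
      exact (hW s (Ioo_subset_Icc_self hs)).differentiableAt.differentiableWithinAt
    · intro s hs
      rw [interior_Icc] at hs
      have hs' := Ioo_subset_Icc_self hs
      rw [(hW s hs').deriv]
      have h1 := hf _ (hsol s (hsub hs')).1 (trap s (hsub hs'))
      have h2 := Real.sqrt_pos.2 (hVpos s (hsub hs'))
      have h3 : (2 * (d * inner ℝ (x s) (f (x s)) + inner ℝ (A (x s)) (A (f (x s))))) /
        (2 * √(d * ‖x s‖^2 + ‖A (x s)‖^2)) ≤ - (k / 2) := by
        rw [div_le_iff₀ (by positivity)]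
        linarith
      linarith
  have h1 := hanti (left_mem_Icc.2 ht.1) (right_mem_Icc.2 ht.1) ht.1
  simp only [hx] at h1
  linarith

end dyn

theorem extend_sol {E : Type*} [NormedAddCommGroup E] [NormedSpace ℝ E] [FiniteDimensional ℝ E]
    (b : E →L[ℝ] E) (hb : ∀ p, p ≠ 0 → b p ≠ 0) (g : E → E) (hg : Continuous g) (f : E → E)
    (hf : f = fun p => ‖b p‖⁻¹ • (-(b p) + g p)) (N T : ℝ) (hT : 0 < T) (x : ℝ → E)
    (hsol : ∀ t ∈ Ico (0:ℝ) T, x t ≠ 0 ∧ HasDerivAt x (f (x t)) t)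
    (hN : ∀ t ∈ Ico (0:ℝ) T, ‖f (x t)‖ ≤ N)
    (hne : ¬ ∃ (T' : ℝ) (y : ℝ → E), T < T' ∧
          (∀ t ∈ Ico (0:ℝ) T', y t ≠ 0 ∧ HasDerivAt y (f (y t)) t) ∧
          EqOn y x (Ico 0 T)) :
    Tendsto x (𝓝[<] T) (𝓝 0) := by
  have hN0 : 0 ≤ N := (norm_nonneg _).trans (hN 0 ⟨le_rfl, hT⟩)
  have hlip : LipschitzOnWith ⟨N, hN0⟩ x (Ico 0 T) :=
    (convex_Ico (0:ℝ) T).lipschitzOnWith_of_nnnorm_hasDerivWithin_le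
      (fun t ht => (hsol t ht).2.hasDerivWithinAt) (fun t ht => hN t ht)
  obtain ⟨X, hX, hXx⟩ := hlip.extend_finite_dimension
  have hmem : Ico 0 T ∈ 𝓝[<] T := Ico_mem_nhdsLT hT
  have hlim : Tendsto x (𝓝[<] T) (𝓝 (X T)) := by
    refine Tendsto.congr' ?_ (hX.continuous.continuousAt.mono_left nhdsWithin_le_nhds)
    filter_upwards [hmem] with t ht using (hXx ht).symm
  by_cases hL : X T = 0
  · rwa [hL] at hlim
  exfalso
  apply hne
  obtain ⟨ε, hε, y, hy0, hy⟩ := field_peano b g hg (X T) (hb _ hL)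
  have hfc : ContinuousAt f (X T) := by rw [hf]; exact field_contAt b g hg _ (hb _ hL)
  have hy' : ∀ t ∈ Ioo (-ε) ε, y t ≠ 0 ∧ HasDerivAt y (f (y t)) t := by
    rw [hf]; exact hy
  let z : ℝ → E := fun t => if t < T then x t else y (t - T)
  have hzx : ∀ t, t < T → z t = x t := fun t ht => by simp [z, ht]
  have hzy : ∀ t, T ≤ t → z t = y (t - T) := fun t ht => by simp [z, not_lt.2 ht]
  have hyd : ∀ t ∈ Ico T (T + ε), HasDerivAt (fun t => y (t - T)) (f (y (t - T))) t := by
    intro t ht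
    have := (hy' (t - T) ⟨by linarith [ht.1], by linarith [ht.2]⟩).2
    exact this.comp_sub_const t T
  have hzd : ∀ t ∈ Ico 0 T, HasDerivAt z (f (x t)) t := by
    intro t ht
    refine (hsol t ht).2.congr_of_eventuallyEq ?_
    filter_upwards [gt_mem_nhds ht.2] with s hs using hzx s hs
  refine ⟨T + ε, z, by linarith, ?_, fun t ht => hzx t ht.2⟩
  intro t ht
  rcases lt_trichotomy t T with h | h | h
  · rw [hzx t h]
    exact ⟨(hsol t ⟨ht.1, h⟩).1, hzd t ⟨ht.1, h⟩⟩
  · subst h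
    have hzt : z t = X t := by rw [hzy t le_rfl]; simp [hy0]
    rw [hzt]
    refine ⟨hL, ?_⟩
    have hr : HasDerivWithinAt z (f (X t)) (Ici t) t := by
      have := (hyd t ⟨le_rfl, by linarith⟩).hasDerivWithinAt (s := Ici t)
      rw [sub_self, hy0] at this
      exact this.congr (fun s hs => hzy s hs) (hzy t le_rfl)
    have hl : HasDerivWithinAt z (f (X t)) (Iic t) t := by
      apply hasDerivWithinAt_Iic_of_tendsto_deriv (s := Ico 0 t)
      · exact fun s hs => (hzd s hs).differentiableAt.differentiableWithinAt
      · rw [ContinuousWithinAt, hzt]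
        have : Tendsto x (𝓝[Ico 0 t] t) (𝓝 (X t)) :=
          hlim.mono_left (nhdsWithin_mono _ (fun s hs => hs.2))
        refine this.congr' ?_
        filter_upwards [self_mem_nhdsWithin] with s hs using (hzx s hs.2).symm
      · exact hmem
      · have : Tendsto (fun s => f (x s)) (𝓝[<] t) (𝓝 (f (X t))) := hfc.tendsto.comp hlim
        refine this.congr' ?_
        filter_upwards [hmem] with s hs using (hzd s hs).deriv.symm
    have := hl.union hr
    rwa [Iic_union_Ici, hasDerivWithinAt_univ] at this
  · rw [hzy t h.le]
    refine ⟨(hy' (t - T) ⟨by linarith, by linarith [ht.2]⟩).1, ?_⟩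
    refine (hyd t ⟨h.le, ht.2⟩).congr_of_eventuallyEq ?_
    filter_upwards [lt_mem_nhds h] with s hs using hzy s hs.le

theorem tr_det_pos (B : Matrix (Fin 2) (Fin 2) ℝ)
    (hB : ∀ μ : ℂ, Module.End.HasEigenvalue
      (Matrix.toLin' (B.map (Complex.ofReal))) μ → 0 < μ.re) : 0 < B.trace ∧ 0 < B.det := by
  have key : ∀ μ : ℂ, μ^2 - B.trace * μ + B.det = 0 → 0 < μ.re := by
    intro μ hμ
    apply hB
    rw [Module.End.hasEigenvalue_iff_mem_spectrum, Matrix.spectrum_toLin', spectrum.mem_iff,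
      Matrix.isUnit_iff_isUnit_det, isUnit_iff_ne_zero, not_not]
    rw [← hμ]
    simp [Matrix.det_fin_two, Matrix.trace_fin_two, Matrix.algebraMap_matrix_apply]
    ring
  obtain ⟨s, hs⟩ := IsAlgClosed.exists_pow_nat_eq ((B.trace : ℂ)^2 - 4 * B.det) (n := 2) two_pos
  have h1 := key ((B.trace + s)/2) (by linear_combination (1/4) * hs)
  have h2 := key ((B.trace - s)/2) (by linear_combination (1/4) * hs)
  have e1 := congrArg Complex.re hs
  simp [pow_two] at h1 h2 e1
  refine ⟨by linarith, ?_⟩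
  have := mul_pos h1 (sub_pos.2 h2)
  nlinarith [sq_nonneg s.im]

/-- Let `B` be a real 2×2 matrix whose (complex) eigenvalues all have
strictly positive real part, and let `g` be continuous with `‖g(x)‖ ≤ C‖x‖²` near `0`.
Then solutions of `ẋ = (-Bx + g(x))/‖Bx‖` (understood away from `Bx = 0`, i.e. away from
`x = 0`) starting close enough to `0` (but not at `0`) blow up in finite time, with
`x(t) → 0` at the blow-up time: there is no global solution, and every non-extendable
solution on a finite interval `[0, T*)` tends to `0` as `t → T*`. -/
theorem stmt14 (B : Matrix (Fin 2) (Fin 2) ℝ)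
    (hB : ∀ μ : ℂ, Module.End.HasEigenvalue
      (Matrix.toLin' (B.map (Complex.ofReal))) μ → 0 < μ.re)
    (g : Vec 2 → Vec 2) (hg : Continuous g)
    (C r1 : ℝ) (hC : 0 < C) (hr1 : 0 < r1)
    (hgC : ∀ p : Vec 2, ‖p‖ < r1 → ‖g p‖ ≤ C * ‖p‖ ^ 2)
    (f : Vec 2 → Vec 2)
    (hf : f = fun p => ‖Matrix.toEuclideanLin B p‖⁻¹ • (-(Matrix.toEuclideanLin B p) + g p)) :
    ∃ r0 : ℝ, 0 < r0 ∧ ∀ x0 : Vec 2, x0 ≠ 0 → ‖x0‖ < r0 →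
      -- a (local) solution exists
      (∃ (T : ℝ) (x : ℝ → Vec 2), 0 < T ∧ x 0 = x0 ∧
        ∀ t ∈ Ico (0:ℝ) T, x t ≠ 0 ∧ HasDerivAt x (f (x t)) t) ∧
      -- there is no global solution: the maximal existence time is finite
      (¬ ∃ x : ℝ → Vec 2, x 0 = x0 ∧
        ∀ t ∈ Ici (0:ℝ), x t ≠ 0 ∧ HasDerivAt x (f (x t)) t) ∧
      -- every maximal (non-extendable) solution on a finite interval tends to `0`
      (∀ (Tstar : ℝ) (x : ℝ → Vec 2), 0 < Tstar → x 0 = x0 →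
        (∀ t ∈ Ico (0:ℝ) Tstar, x t ≠ 0 ∧ HasDerivAt x (f (x t)) t) →
        (¬ ∃ (T' : ℝ) (y : ℝ → Vec 2), Tstar < T' ∧
          (∀ t ∈ Ico (0:ℝ) T', y t ≠ 0 ∧ HasDerivAt y (f (y t)) t) ∧
          EqOn y x (Ico 0 Tstar)) →
        Tendsto x (𝓝[<] Tstar) (𝓝 0)) := by
  obtain ⟨htr, hdet⟩ := tr_det_pos B hB
  let b : Vec 2 →L[ℝ] Vec 2 := (Matrix.toEuclideanLin B).toContinuousLinearMap
  let A : Vec 2 →L[ℝ] Vec 2 := (Matrix.toEuclideanLin B.adjugate).toContinuousLinearMap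
  have hAb : ∀ x, A (b x) = B.det • x := by
    intro x
    ext i
    fin_cases i <;>
    simp [A, b, Matrix.toLpLin_apply, Matrix.adjugate_fin_two, Matrix.mulVec, dotProduct,
      Fin.sum_univ_two, Matrix.det_fin_two] <;> ring
  have hbA : ∀ x, b x + A x = B.trace • x := by
    intro x
    ext i
    fin_cases i <;>
    simp [A, b, Matrix.toLpLin_apply, Matrix.adjugate_fin_two, Matrix.mulVec, dotProduct,
      Fin.sum_univ_two, Matrix.trace_fin_two] <;> ring
  have hb : ∀ p, p ≠ 0 → b p ≠ 0 := by
    intro p hp h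
    have := hAb p
    rw [h, map_zero] at this
    exact (smul_ne_zero hdet.ne' hp) this.symm
  have hfb : f = fun p => ‖b p‖⁻¹ • (-(b p) + g p) := hf
  obtain ⟨r, hr, k, hk, N, hN, hest⟩ := est1 A b g B.det B.trace C r1 hdet htr hC hr1 hAb hbA hgC
  have hest1 : ∀ p : Vec 2, p ≠ 0 → ‖p‖ < r →
      2 * (B.det * inner ℝ p (f p) + inner ℝ (A p) (A (f p))) ≤
        - k * √(B.det * ‖p‖^2 + ‖A p‖^2) := by
    rw [hfb]; exact fun p h1 h2 => (hest p h1 h2).1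
  have hest2 : ∀ p : Vec 2, p ≠ 0 → ‖p‖ < r → ‖f p‖ ≤ N := by
    rw [hfb]; exact fun p h1 h2 => (hest p h1 h2).2
  obtain ⟨r0, hr0, hdyn⟩ := dyn1 A f B.det r k hdet hr hk hest1
  refine ⟨r0, hr0, fun x0 hx0 hx0r => ⟨?_, ?_, ?_⟩⟩
  · obtain ⟨ε, hε, y, hy0, hy⟩ := field_peano b g hg x0 (hb _ hx0)
    refine ⟨ε, y, hε, hy0, fun t ht => ?_⟩
    rw [hfb]
    exact hy t ⟨by linarith [ht.1], ht.2⟩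
  · rintro ⟨x, hx, hsol⟩
    set W := √(B.det * ‖x0‖^2 + ‖A x0‖^2)
    have hW : 0 ≤ W := Real.sqrt_nonneg _
    have ht : (2 * (W + 1) / k) ∈ Ico (0:ℝ) (2 * (W + 1) / k + 1) := ⟨by positivity, by linarith⟩
    have h := (hdyn x0 hx0r (2 * (W + 1) / k + 1) x hx (fun t ht => hsol t ht.1) _ ht).2
    have h2 : k / 2 * (2 * (W + 1) / k) = W + 1 := by field_simp
    rw [h2] at h
    have := Real.sqrt_nonneg (B.det * ‖x (2 * (W + 1) / k)‖^2 + ‖A (x (2 * (W + 1) / k))‖^2)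
    linarith
  · intro T x hT hx hsol hne
    refine extend_sol b hb g hg f hfb N T hT x hsol (fun t ht => ?_) hne
    exact hest2 _ (hsol t ht).1 (hdyn x0 hx0r T x hx hsol t ht).1
end

section
/- Let E ∈ C³(ℝ²) with 0 ∈ S (λ1(0) = λ2(0)), ∇E(0) = (cos α, sin α), A = [[(E111 − E122)/2, (E112 − E222)/2], [E112, E122]], and Δ = 2 det A. Suppose Δ > 0 and both eigenvalues of R_{−α} A have strictly positive real part. Then for every x(0) ≠ 0 with ‖x(0)‖ sufficiently small, the maximal solution x ∈ C¹([0, T*)) of the ISD ẋ = −(I − 2 v1(x) ⊗ v1(x)) ∇E(x) has finite blow-up time T* < ∞ and x(t) → 0 as t → T*. -/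
open Real Filter Set
open scoped Topology RealInnerProductSpace

noncomputable section

def SingularAt (E : Vec 2 → ℝ) (p : Vec 2) : Prop :=
  ∃ lam : ℝ, (hessOp E p).HasEigenvalue lam ∧
    ∀ μ : ℝ, (hessOp E p).HasEigenvalue μ → μ = lam

def mkVec (a b : ℝ) : Vec 2 := (WithLp.equiv 2 (Fin 2 → ℝ)).symm ![a, b]

/-- canonical basis vectors of `ℝ²`. -/
def e2 (i : Fin 2) : Vec 2 := EuclideanSpace.single i 1

/-- third partial derivatives `E_ijk = ∇³E(0)[e_i, e_j, e_k]`. -/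
def D3 (E : Vec 2 → ℝ) (i j k : Fin 2) : ℝ :=
  iteratedFDeriv ℝ 3 E 0 ![e2 i, e2 j, e2 k]

/-- the matrix `A = [[(E111 - E122)/2, (E112 - E222)/2], [E112, E122]]`. -/
def Amat (E : Vec 2 → ℝ) : Matrix (Fin 2) (Fin 2) ℝ :=
  !![(D3 E 0 0 0 - D3 E 0 1 1) / 2, (D3 E 0 0 1 - D3 E 1 1 1) / 2;
     D3 E 0 0 1, D3 E 0 1 1]

/-- rotation matrix of angle `ω`. -/
def RotM (ω : ℝ) : Matrix (Fin 2) (Fin 2) ℝ :=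
  !![Real.cos ω, -Real.sin ω; Real.sin ω, Real.cos ω]

/-- `x` is a solution of the ISD, away from the singularity `0`, on the set `s`. -/
def IsISDSolAway (E : Vec 2 → ℝ) (x : ℝ → Vec 2) (s : Set ℝ) : Prop :=
  ∀ t ∈ s, x t ≠ 0 ∧ ∃ w : Vec 2, IsMinEigvec (hessOp E (x t)) w ∧
    HasDerivAt x (isdField E (x t) w) t

end

noncomputable section

def hh (E : Vec 2 → ℝ) (i j : Fin 2) (x : Vec 2) : ℝ :=
  fderiv ℝ (fderiv ℝ E) x (e2 i) (e2 j)

def aF (E : Vec 2 → ℝ) (x : Vec 2) : ℝ := (hh E 0 0 x - hh E 1 1 x) / 2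
def bF (E : Vec 2 → ℝ) (x : Vec 2) : ℝ := hh E 0 1 x
def rhoF (E : Vec 2 → ℝ) (x : Vec 2) : ℝ := Real.sqrt (aF E x ^ 2 + bF E x ^ 2)
def uF0 (E : Vec 2 → ℝ) (x : Vec 2) : ℝ := aF E x * gradient E x 0 + bF E x * gradient E x 1
def uF1 (E : Vec 2 → ℝ) (x : Vec 2) : ℝ := bF E x * gradient E x 0 - aF E x * gradient E x 1
def FF (E : Vec 2 → ℝ) (x : Vec 2) : Vec 2 :=
  !₂[-(uF0 E x) / rhoF E x, -(uF1 E x) / rhoF E x]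

lemma toDual_symm_coord (L : Vec 2 →L[ℝ] ℝ) (j : Fin 2) :
    ((InnerProductSpace.toDual ℝ (Vec 2)).symm L) j = L (e2 j) := by
  have h := InnerProductSpace.toDual_symm_apply (𝕜 := ℝ) (x := e2 j) (y := L)
  rw [← h]
  unfold e2
  rw [real_inner_comm, EuclideanSpace.inner_single_left]
  simp

lemma grad_coord (E : Vec 2 → ℝ) (x : Vec 2) (j : Fin 2) :
    gradient E x j = fderiv ℝ E x (e2 j) := by
  unfold gradient
  exact toDual_symm_coord _ _

lemma contDiff_fderiv2 {E : Vec 2 → ℝ} (hE : ContDiff ℝ 3 E) :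
    ContDiff ℝ 2 (fderiv ℝ E) := hE.fderiv_right (by norm_num)

lemma contDiff_grad {E : Vec 2 → ℝ} (hE : ContDiff ℝ 3 E) (j : Fin 2) :
    ContDiff ℝ 2 (fun x => gradient E x j) := by
  simp_rw [grad_coord]
  exact (contDiff_fderiv2 hE).clm_apply contDiff_const

lemma contDiff_ff {E : Vec 2 → ℝ} (hE : ContDiff ℝ 3 E) :
    ContDiff ℝ 1 (fderiv ℝ (fderiv ℝ E)) :=
  (contDiff_fderiv2 hE).fderiv_right (by norm_num)

lemma contDiff_hh {E : Vec 2 → ℝ} (hE : ContDiff ℝ 3 E) (i j : Fin 2) :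
    ContDiff ℝ 1 (hh E i j) := by
  unfold hh
  exact ((contDiff_ff hE).clm_apply contDiff_const).clm_apply contDiff_const

lemma hess_coord {E : Vec 2 → ℝ} (hE : ContDiff ℝ 3 E) (x v : Vec 2) (j : Fin 2) :
    hessOp E x v j = fderiv ℝ (fderiv ℝ E) x v (e2 j) := by
  have hG : ContDiff ℝ 2 (gradient E) := by
    rw [contDiff_euclidean]
    exact contDiff_grad hE
  have hd := (hG.differentiable (by norm_num) x).hasFDerivAt
  have h1 := (EuclideanSpace.proj (𝕜 := ℝ) j : Vec 2 →L[ℝ] ℝ).hasFDerivAt.comp x hd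
  have h2 : HasFDerivAt (fun x => gradient E x j) _ x := h1
  have h3 : (fun x => gradient E x j) = fun x => fderiv ℝ E x (e2 j) := by
    funext x; exact grad_coord E x j
  have h4 := h2.fderiv
  rw [h3, fderiv_clm_apply ((contDiff_fderiv2 hE).differentiable (by norm_num) x)
    (differentiableAt_const _)] at h4
  have h5 := congrArg (fun L => L v) h4
  simp at h5
  exact h5.symm

lemma hh_symm {E : Vec 2 → ℝ} (hE : ContDiff ℝ 3 E) (i j : Fin 2) (x : Vec 2) :
    hh E i j x = hh E j i x := by
  have := (hE.contDiffAt (x := x)).isSymmSndFDerivAt (by simp; norm_num)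
  exact this _ _

lemma vec_decomp (v : Vec 2) : v = v 0 • e2 0 + v 1 • e2 1 := by
  ext i; fin_cases i <;> simp [e2]

lemma hess_coord' {E : Vec 2 → ℝ} (hE : ContDiff ℝ 3 E) (x v : Vec 2) (j : Fin 2) :
    hessOp E x v j = v 0 * hh E 0 j x + v 1 * hh E 1 j x := by
  rw [hess_coord hE]
  conv_lhs => rw [vec_decomp v]
  simp [hh]

lemma D3_eq {E : Vec 2 → ℝ} (hE : ContDiff ℝ 3 E) (i j k : Fin 2) :
    D3 E i j k = fderiv ℝ (hh E j k) 0 (e2 i) := by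
  unfold D3
  rw [iteratedFDeriv_succ_apply_left]
  have hd : DifferentiableAt ℝ (iteratedFDeriv ℝ 2 E) 0 :=
    hE.differentiable_iteratedFDeriv (by norm_num) 0
  have h2 : hh E j k = fun x => iteratedFDeriv ℝ 2 E x ![e2 j, e2 k] := by
    funext x; rw [iteratedFDeriv_two_apply]; rfl
  rw [h2]
  have h3 : HasFDerivAt (fun x => iteratedFDeriv ℝ 2 E x ![e2 j, e2 k])
      ((ContinuousMultilinearMap.apply ℝ (fun _ : Fin 2 => Vec 2) ℝ ![e2 j, e2 k]).comp
        (fderiv ℝ (iteratedFDeriv ℝ 2 E) 0)) 0 :=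
    (ContinuousMultilinearMap.apply ℝ (fun _ : Fin 2 => Vec 2) ℝ
      ![e2 j, e2 k]).hasFDerivAt.comp 0 hd.hasFDerivAt
  rw [h3.fderiv]
  rfl

lemma D3_symm23 {E : Vec 2 → ℝ} (hE : ContDiff ℝ 3 E) (i j k : Fin 2) :
    D3 E i j k = D3 E i k j := by
  rw [D3_eq hE, D3_eq hE]
  congr 2
  funext x
  exact hh_symm hE _ _ _

lemma D3_symm12 {E : Vec 2 → ℝ} (hE : ContDiff ℝ 3 E) (i j k : Fin 2) :
    D3 E i j k = D3 E j i k := by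
  have key : ∀ i j, D3 E i j k =
      fderiv ℝ (fderiv ℝ (fun x => fderiv ℝ E x (e2 k))) 0 (e2 i) (e2 j) := by
    intro i j
    have hG : ContDiff ℝ 2 (fun x => fderiv ℝ E x (e2 k)) :=
      (contDiff_fderiv2 hE).clm_apply contDiff_const
    have h1 : hh E j k = fun x => fderiv ℝ (fun x => fderiv ℝ E x (e2 k)) x (e2 j) := by
      funext x
      have hd := (contDiff_fderiv2 hE).differentiable (by norm_num) x
      rw [fderiv_clm_apply hd (differentiableAt_const _)]
      simp [hh]
    rw [D3_eq hE, h1]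
    have hd : DifferentiableAt ℝ (fderiv ℝ (fun x => fderiv ℝ E x (e2 k))) 0 :=
      (hG.fderiv_right (m := 1) (by norm_num)).differentiable (by norm_num) 0
    rw [fderiv_clm_apply hd (differentiableAt_const _)]
    simp
  rw [key, key]
  have hG : ContDiff ℝ 2 (fun x => fderiv ℝ E x (e2 k)) :=
      (contDiff_fderiv2 hE).clm_apply contDiff_const
  exact (hG.contDiffAt (x := 0)).isSymmSndFDerivAt (by simp) _ _

lemma hh_fderiv {E : Vec 2 → ℝ} (hE : ContDiff ℝ 3 E) (j k : Fin 2) (x : Vec 2) :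
    fderiv ℝ (hh E j k) 0 x = x 0 * D3 E 0 j k + x 1 * D3 E 1 j k := by
  rw [D3_eq hE, D3_eq hE]
  conv_lhs => rw [vec_decomp x]
  simp

lemma hasF_aF {E : Vec 2 → ℝ} (hE : ContDiff ℝ 3 E) :
    ∃ L : Vec 2 →L[ℝ] ℝ, HasFDerivAt (aF E) L 0 ∧
      ∀ x, L x = Amat E 0 0 * x 0 + Amat E 0 1 * x 1 := by
  have h1 := ((contDiff_hh hE 0 0).differentiable (by norm_num) 0).hasFDerivAt
  have h2 := ((contDiff_hh hE 1 1).differentiable (by norm_num) 0).hasFDerivAt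
  refine ⟨(2:ℝ)⁻¹ • (fderiv ℝ (hh E 0 0) 0 - fderiv ℝ (hh E 1 1) 0), ?_, ?_⟩
  · have := (h1.sub h2).const_smul (2:ℝ)⁻¹
    have e : aF E = (2:ℝ)⁻¹ • (hh E 0 0 - hh E 1 1) := by
      funext x; simp [aF]; ring
    rw [e]; exact this
  · intro x
    simp only [smul_apply, sub_apply, hh_fderiv hE, Amat]
    have : D3 E 1 0 0 = D3 E 0 0 1 := by rw [D3_symm12 hE, D3_symm23 hE]
    simp [this]; ring

lemma hasF_bF {E : Vec 2 → ℝ} (hE : ContDiff ℝ 3 E) :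
    ∃ L : Vec 2 →L[ℝ] ℝ, HasFDerivAt (bF E) L 0 ∧
      ∀ x, L x = Amat E 1 0 * x 0 + Amat E 1 1 * x 1 := by
  have h1 := ((contDiff_hh hE 0 1).differentiable (by norm_num) 0).hasFDerivAt
  refine ⟨_, h1, ?_⟩
  intro x
  simp only [hh_fderiv hE, Amat]
  have : D3 E 1 0 1 = D3 E 0 1 1 := by rw [D3_symm12 hE]
  simp [this]; ring

-- eigen part
lemma rho_sq (E : Vec 2 → ℝ) (x : Vec 2) : rhoF E x ^ 2 = aF E x ^ 2 + bF E x ^ 2 :=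
  Real.sq_sqrt (by positivity)

lemma hess_eig {E : Vec 2 → ℝ} (hE : ContDiff ℝ 3 E) (x v : Vec 2) (μ : ℝ) :
    hessOp E x v = μ • v ↔
      aF E x * v 0 + bF E x * v 1 = (μ - (hh E 0 0 x + hh E 1 1 x) / 2) * v 0 ∧
      bF E x * v 0 - aF E x * v 1 = (μ - (hh E 0 0 x + hh E 1 1 x) / 2) * v 1 := by
  constructor
  · intro h
    have c0 := congrArg (fun z : Vec 2 => z 0) h
    have c1 := congrArg (fun z : Vec 2 => z 1) h
    simp only [hess_coord' hE, PiLp.smul_apply, smul_eq_mul] at c0 c1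
    have := hh_symm hE 1 0 x
    unfold aF bF
    rw [this] at c0
    constructor <;> linarith
  · rintro ⟨h1, h2⟩
    unfold aF bF at h1 h2
    ext i
    have := hh_symm hE 1 0 x
    fin_cases i
    · simp [hess_coord' hE, this]; linarith
    · simp [hess_coord' hE]; linarith

lemma eig_nonneg {E : Vec 2 → ℝ} (hE : ContDiff ℝ 3 E) (x : Vec 2) (μ : ℝ)
    (h : (hessOp E x).HasEigenvalue μ) :
    (μ - (hh E 0 0 x + hh E 1 1 x) / 2) ^ 2 = rhoF E x ^ 2 := by
  obtain ⟨v, hv⟩ := h.exists_hasEigenvector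
  have h1 := hv.apply_eq_smul
  have h2 := hv.2
  obtain ⟨e1, e2'⟩ := (hess_eig hE x v μ).1 h1
  rw [rho_sq]
  set s := μ - (hh E 0 0 x + hh E 1 1 x) / 2
  set a := aF E x
  set b := bF E x
  have k0 : (s ^ 2 - (a ^ 2 + b ^ 2)) * v 0 = 0 := by linear_combination (-s - a) * e1 - b * e2'
  have k1 : (s ^ 2 - (a ^ 2 + b ^ 2)) * v 1 = 0 := by linear_combination (-b) * e1 + (a - s) * e2'
  by_contra hne
  have hne' : s ^ 2 - (a ^ 2 + b ^ 2) ≠ 0 := sub_ne_zero.2 hne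
  apply h2
  ext i
  fin_cases i
  · simpa [hne'] using k0
  · simpa [hne'] using k1

lemma eig_exists {E : Vec 2 → ℝ} (hE : ContDiff ℝ 3 E) (x : Vec 2) (hr : 0 < rhoF E x)
    (s : ℝ) (hs : s ^ 2 = rhoF E x ^ 2) :
    ∃ v : Vec 2, v ≠ 0 ∧
      hessOp E x v = ((hh E 0 0 x + hh E 1 1 x) / 2 + s) • v := by
  have hrs := rho_sq E x
  by_cases hb : bF E x = 0 ∧ s = aF E x
  · refine ⟨!₂[1, 0], ?_, ?_⟩
    · intro h
      have := congrArg (fun z : Vec 2 => z 0) h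
      simp at this
    · rw [hess_eig hE]
      simp [hb.1, hb.2]
  · refine ⟨!₂[bF E x, s - aF E x], ?_, ?_⟩
    · intro h
      have c0 := congrArg (fun z : Vec 2 => z 0) h
      have c1 := congrArg (fun z : Vec 2 => z 1) h
      simp at c0 c1
      exact hb ⟨c0, by linarith⟩
    · rw [hess_eig hE]
      constructor
      · simp; ring
      · simp; nlinarith

lemma hasEig {E : Vec 2 → ℝ} (hE : ContDiff ℝ 3 E) (x : Vec 2) (hr : 0 < rhoF E x)
    (s : ℝ) (hs : s ^ 2 = rhoF E x ^ 2) :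
    (hessOp E x).HasEigenvalue ((hh E 0 0 x + hh E 1 1 x) / 2 + s) := by
  obtain ⟨v, hv, h⟩ := eig_exists hE x hr s hs
  exact Module.End.hasEigenvalue_of_hasEigenvector
    (x := v) ⟨Module.End.mem_eigenspace_iff.2 h, hv⟩

lemma rho_nonneg (E : Vec 2 → ℝ) (x : Vec 2) : 0 ≤ rhoF E x := Real.sqrt_nonneg _

lemma isMin {E : Vec 2 → ℝ} (hE : ContDiff ℝ 3 E) (x : Vec 2) (hr : 0 < rhoF E x) :
    IsMinEigen (hessOp E x) ((hh E 0 0 x + hh E 1 1 x) / 2 + -rhoF E x) := by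
  refine ⟨hasEig hE x hr _ (by ring), ?_⟩
  intro μ hμ
  have := eig_nonneg hE x μ hμ
  have h2 := abs_le_of_sq_le_sq' this.le hr.le
  linarith [h2.1]

lemma exists_w {E : Vec 2 → ℝ} (hE : ContDiff ℝ 3 E) (x : Vec 2) (hr : 0 < rhoF E x) :
    ∃ w, IsMinEigvec (hessOp E x) w := by
  obtain ⟨v, hv, h⟩ := eig_exists hE x hr (-rhoF E x) (by ring)
  refine ⟨‖v‖⁻¹ • v, ?_, _, isMin hE x hr, ?_⟩
  · rw [norm_smul, norm_inv, norm_norm, inv_mul_cancel₀ (norm_ne_zero_iff.2 hv)]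
  · rw [map_smul, h, smul_comm]

lemma isd_eq {E : Vec 2 → ℝ} (hE : ContDiff ℝ 3 E) (x w : Vec 2) (hr : 0 < rhoF E x)
    (hw : IsMinEigvec (hessOp E x) w) : isdField E x w = FF E x := by
  obtain ⟨hn, lam, hl, he⟩ := hw
  have hm := isMin hE x hr
  have hlam := le_antisymm (hl.2 _ hm.1) (hm.2 _ hl.1)
  rw [hlam] at he
  obtain ⟨e1, e2'⟩ := (hess_eig hE x w _).1 he
  have hn2 : w 0 ^ 2 + w 1 ^ 2 = 1 := by
    have := EuclideanSpace.real_norm_sq_eq w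
    rw [hn] at this
    simpa using this.symm
  have hin : inner ℝ w (gradient E x) = w 0 * gradient E x 0 + w 1 * gradient E x 1 := by
    rw [PiLp.inner_apply, Fin.sum_univ_two]
    simp only [RCLike.inner_apply, conj_trivial]; ring
  set g0 := gradient E x 0 with hg0
  set g1 := gradient E x 1 with hg1
  have ha : aF E x = -rhoF E x * (w 0 ^ 2 - w 1 ^ 2) := by
    linear_combination w 0 * e1 - w 1 * e2' - aF E x * hn2
  have hb : bF E x = -rhoF E x * (2 * w 0 * w 1) := by
    linear_combination w 1 * e1 + w 0 * e2' - bF E x * hn2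
  have hr' := hr.ne'
  ext i
  unfold isdField reflect FF uF0 uF1
  rw [hin]
  fin_cases i
  · simp [← hg0, ← hg1]
    rw [eq_div_iff hr', ha, hb]
    linear_combination (rhoF E x * g0) * hn2
  · simp [← hg0, ← hg1]
    rw [eq_div_iff hr', ha, hb]
    linear_combination (rhoF E x * g1) * hn2

lemma sing_zero {E : Vec 2 → ℝ} (hE : ContDiff ℝ 3 E) (x : Vec 2) (h : SingularAt E x) :
    aF E x = 0 ∧ bF E x = 0 := by
  have hr : rhoF E x = 0 := by
    by_contra hne
    have hr : 0 < rhoF E x := lt_of_le_of_ne (rho_nonneg E x) (Ne.symm hne)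
    obtain ⟨lam, _, hl⟩ := h
    have h1 := hl _ (hasEig hE x hr _ rfl)
    have h2 := hl _ (hasEig hE x hr (-rhoF E x) (by ring))
    linarith
  have := rho_sq E x
  rw [hr] at this
  constructor <;> nlinarith [sq_nonneg (aF E x), sq_nonneg (bF E x)]

lemma contDiff_aF {E : Vec 2 → ℝ} (hE : ContDiff ℝ 3 E) : ContDiff ℝ 1 (aF E) :=
  ((contDiff_hh hE 0 0).sub (contDiff_hh hE 1 1)).div_const 2

lemma contDiff_bF {E : Vec 2 → ℝ} (hE : ContDiff ℝ 3 E) : ContDiff ℝ 1 (bF E) :=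
  contDiff_hh hE 0 1

lemma continuous_rho {E : Vec 2 → ℝ} (hE : ContDiff ℝ 3 E) : Continuous (rhoF E) := by
  have h1 := (contDiff_aF hE).continuous
  have h2 := (contDiff_bF hE).continuous
  unfold rhoF
  fun_prop

lemma contDiffAt_FF {E : Vec 2 → ℝ} (hE : ContDiff ℝ 3 E) (x : Vec 2) (hr : 0 < rhoF E x) :
    ContDiffAt ℝ 1 (FF E) x := by
  have ha := (contDiff_aF hE).contDiffAt (x := x)
  have hb := (contDiff_bF hE).contDiffAt (x := x)
  have hg0 := ((contDiff_grad hE 0).of_le (m := 1) (by norm_num)).contDiffAt (x := x)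
  have hg1 := ((contDiff_grad hE 1).of_le (m := 1) (by norm_num)).contDiffAt (x := x)
  have hrho : ContDiffAt ℝ 1 (rhoF E) x := by
    apply ContDiffAt.sqrt
    · exact (ha.pow 2).add (hb.pow 2)
    · rw [← rho_sq]; positivity
  have hu0 : ContDiffAt ℝ 1 (uF0 E) x := (ha.mul hg0).add (hb.mul hg1)
  have hu1 : ContDiffAt ℝ 1 (uF1 E) x := (hb.mul hg0).sub (ha.mul hg1)
  rw [contDiffAt_euclidean]
  intro i
  fin_cases i
  · exact hu0.neg.div hrho hr.ne'
  · exact hu1.neg.div hrho hr.ne'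

end
noncomputable section

lemma trace_pos (B : Matrix (Fin 2) (Fin 2) ℝ)
    (hB : ∀ μ : ℂ, Module.End.HasEigenvalue
      (Matrix.toLin' (B.map (Complex.ofReal))) μ → 0 < μ.re) : 0 < B 0 0 + B 1 1 := by
  have hroot : ∀ μ : ℂ, μ ^ 2 - (B 0 0 + B 1 1) * μ + (B 0 0 * B 1 1 - B 0 1 * B 1 0) = 0 →
      0 < μ.re := by
    intro μ hμ
    apply hB
    rw [Module.End.hasEigenvalue_iff_isRoot_charpoly, Matrix.charpoly_toLin',
      Matrix.charpoly_fin_two]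
    simp [Matrix.trace_fin_two, Matrix.det_fin_two, Polynomial.IsRoot]
    linear_combination hμ
  obtain ⟨s, hs⟩ := IsAlgClosed.exists_pow_nat_eq
    (((B 0 0 + B 1 1 : ℂ)) ^ 2 - 4 * (B 0 0 * B 1 1 - B 0 1 * B 1 0)) (n := 2) (by norm_num)
  have h1 := hroot (((B 0 0 + B 1 1 : ℂ) + s) / 2) (by linear_combination (1/4) * hs)
  have h2 := hroot (((B 0 0 + B 1 1 : ℂ) - s) / 2) (by linear_combination (1/4) * hs)
  have h3 := add_pos h1 h2
  rw [← Complex.add_re] at h3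
  have e : ((B 0 0 + B 1 1 : ℂ) + s) / 2 + ((B 0 0 + B 1 1 : ℂ) - s) / 2 =
    ((B 0 0 + B 1 1 : ℝ) : ℂ) := by push_cast; ring
  rw [e, Complex.ofReal_re] at h3
  exact h3

def Qf (p q r : ℝ) (x y : Vec 2) : ℝ :=
  p * (x 0 * y 0) + q * (x 0 * y 1 + x 1 * y 0) + r * (x 1 * y 1)

lemma abs_coord_le (x : Vec 2) (i : Fin 2) : |x i| ≤ ‖x‖ := PiLp.norm_apply_le x i

lemma nsq (x : Vec 2) : ‖x‖ ^ 2 = x 0 ^ 2 + x 1 ^ 2 := by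
  rw [EuclideanSpace.real_norm_sq_eq, Fin.sum_univ_two]

lemma Qf_bound (p q r : ℝ) (x y : Vec 2) (m : ℝ) (h0 : |y 0| ≤ m) (h1 : |y 1| ≤ m) :
    |Qf p q r x y| ≤ (|p| + 2 * |q| + |r|) * (‖x‖ * m) := by
  have a0 := abs_coord_le x 0
  have a1 := abs_coord_le x 1
  have hx := norm_nonneg x
  have hm : 0 ≤ m := (abs_nonneg _).trans h0
  have key : ∀ i j, |x i * y j| ≤ ‖x‖ * m := by
    intro i j
    rw [abs_mul]
    refine mul_le_mul (abs_coord_le x i) ?_ (abs_nonneg _) hx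
    fin_cases j <;> assumption
  unfold Qf
  calc _ ≤ |p * (x 0 * y 0)| + |q * (x 0 * y 1 + x 1 * y 0)| + |r * (x 1 * y 1)| := abs_add_three _ _ _
    _ ≤ |p| * (‖x‖ * m) + |q| * (‖x‖ * m + ‖x‖ * m) + |r| * (‖x‖ * m) := by
      rw [abs_mul p, abs_mul q, abs_mul r]
      gcongr
      · exact key 0 0
      · exact (abs_add_le _ _).trans (add_le_add (key 0 1) (key 1 0))
      · exact key 1 1
    _ = _ := by ring

lemma lin_approx {f : Vec 2 → ℝ} {L : Vec 2 →L[ℝ] ℝ} (h : HasFDerivAt f L 0) (hf : f 0 = 0)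
    {ε : ℝ} (hε : 0 < ε) : ∀ᶠ x in 𝓝 (0 : Vec 2), |f x - L x| ≤ ε * ‖x‖ := by
  have := h.isLittleO.def hε
  simpa [hf] using this

set_option maxHeartbeats 2000000 in
lemma near {E : Vec 2 → ℝ} (hE : ContDiff ℝ 3 E) (ha0 : aF E 0 = 0) (hb0 : bF E 0 = 0)
    (c s : ℝ) (hg0 : gradient E 0 0 = c) (hg1 : gradient E 0 1 = s)
    (p q r τ : ℝ) (hτ : 0 < τ)
    (hQ : ∀ x : Vec 2, Qf p q r x !₂[
      c * (Amat E 0 0 * x 0 + Amat E 0 1 * x 1) + s * (Amat E 1 0 * x 0 + Amat E 1 1 * x 1),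
      c * (Amat E 1 0 * x 0 + Amat E 1 1 * x 1) - s * (Amat E 0 0 * x 0 + Amat E 0 1 * x 1)]
      = τ * ‖x‖ ^ 2) :
    ∃ R > 0, ∃ k > 0, ∀ x : Vec 2, x ≠ 0 → ‖x‖ < R →
      0 < rhoF E x ∧ 2 * Qf p q r x (FF E x) ≤ -k * ‖x‖ := by
  obtain ⟨La, hLa, hLa'⟩ := hasF_aF hE
  obtain ⟨Lb, hLb, hLb'⟩ := hasF_bF hE
  have hG0 := ((contDiff_grad hE 0).differentiable (by norm_num) 0).hasFDerivAt
  have hG1 := ((contDiff_grad hE 1).differentiable (by norm_num) 0).hasFDerivAt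
  have hu0 : HasFDerivAt (uF0 E) (c • La + s • Lb) 0 := by
    have := (hLa.mul hG0).add (hLb.mul hG1)
    rw [ha0, hb0, hg0, hg1] at this
    simp only [zero_smul, zero_add] at this
    exact this
  have hu1 : HasFDerivAt (uF1 E) (c • Lb - s • La) 0 := by
    have := (hLb.mul hG0).sub (hLa.mul hG1)
    rw [ha0, hb0, hg0, hg1] at this
    simp only [zero_smul, zero_add] at this
    exact this
  have hu00 : uF0 E 0 = 0 := by simp [uF0, ha0, hb0]
  have hu10 : uF1 E 0 = 0 := by simp [uF1, ha0, hb0]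
  set K := |p| + 2 * |q| + |r| with hK
  have hK0 : 0 ≤ K := by positivity
  set ε := τ / (2 * (K + 1)) with hε
  have hε0 : 0 < ε := by positivity
  set M := ‖La‖ + ‖Lb‖ + 2 with hM
  have hM0 : 0 < M := by positivity
  have ev := (lin_approx hu0 hu00 hε0).and ((lin_approx hu1 hu10 hε0).and
    ((lin_approx hLa ha0 one_pos).and (lin_approx hLb hb0 one_pos)))
  obtain ⟨R, hR, hev⟩ := Metric.eventually_nhds_iff.1 ev
  refine ⟨R, hR, τ / M, by positivity, ?_⟩
  intro x hx hxR
  obtain ⟨e0, e1, ea, eb⟩ := hev (y := x) (by simpa using hxR)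
  have hnx : 0 < ‖x‖ := norm_pos_iff.2 hx
  have hBx := hQ x
  simp only [← hLa', ← hLb'] at hBx
  simp only [add_apply, sub_apply, smul_apply, smul_eq_mul] at e0 e1
  have hQb := Qf_bound p q r x !₂[uF0 E x - (c * La x + s * Lb x), uF1 E x - (c * Lb x - s * La x)]
    (ε * ‖x‖) (by simpa using e0) (by simpa using e1)
  rw [← hK] at hQb
  have hKε : K * ε ≤ τ / 2 := by
    rw [hε]
    have : K * (τ / (2 * (K + 1))) = τ / 2 * (K / (K + 1)) := by field_simp
    rw [this]
    have : K / (K + 1) ≤ 1 := by rw [div_le_one (by positivity)]; linarith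
    nlinarith
  have hQu : τ / 2 * ‖x‖ ^ 2 ≤ Qf p q r x !₂[uF0 E x, uF1 E x] := by
    have hlow := (abs_le.1 hQb).1
    have : Qf p q r x !₂[uF0 E x, uF1 E x] = Qf p q r x !₂[c * La x + s * Lb x, c * Lb x - s * La x] +
      Qf p q r x !₂[uF0 E x - (c * La x + s * Lb x), uF1 E x - (c * Lb x - s * La x)] := by
      simp [Qf]; ring
    rw [this, hBx]
    have h2 : K * (‖x‖ * (ε * ‖x‖)) ≤ τ / 2 * ‖x‖ ^ 2 := by
      calc _ = K * ε * ‖x‖ ^ 2 := by ring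
        _ ≤ _ := by gcongr
    linarith
  have hrho : 0 < rhoF E x := by
    refine lt_of_le_of_ne (rho_nonneg E x) ?_
    intro h
    have h2 := rho_sq E x
    rw [← h] at h2
    have h3 : aF E x = 0 := by nlinarith [sq_nonneg (aF E x), sq_nonneg (bF E x)]
    have h4 : bF E x = 0 := by nlinarith [sq_nonneg (aF E x), sq_nonneg (bF E x)]
    have : Qf p q r x !₂[uF0 E x, uF1 E x] = 0 := by simp [Qf, uF0, uF1, h3, h4]
    rw [this] at hQu
    have : 0 < τ / 2 * ‖x‖ ^ 2 := by positivity
    linarith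
  refine ⟨hrho, ?_⟩
  have hrM : rhoF E x ≤ M * ‖x‖ := by
    have h1 : |aF E x| ≤ (‖La‖ + 1) * ‖x‖ := by
      have := La.le_opNorm x
      rw [Real.norm_eq_abs] at this
      have h3 := abs_sub_abs_le_abs_sub (aF E x) (La x)
      linarith
    have h2 : |bF E x| ≤ (‖Lb‖ + 1) * ‖x‖ := by
      have := Lb.le_opNorm x
      rw [Real.norm_eq_abs] at this
      have h3 := abs_sub_abs_le_abs_sub (bF E x) (Lb x)
      linarith
    have h3 : rhoF E x ≤ |aF E x| + |bF E x| := by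
      apply Real.sqrt_le_iff.2
      refine ⟨by positivity, ?_⟩
      nlinarith [sq_abs (aF E x), sq_abs (bF E x), abs_nonneg (aF E x), abs_nonneg (bF E x),
        mul_nonneg (abs_nonneg (aF E x)) (abs_nonneg (bF E x))]
    linarith
  have hF : Qf p q r x (FF E x) = -(Qf p q r x !₂[uF0 E x, uF1 E x]) / rhoF E x := by
    simp [Qf, FF]; field_simp; ring
  rw [hF, ← mul_div_assoc, div_le_iff₀ hrho]
  have : τ / M * ‖x‖ * rhoF E x ≤ τ / M * ‖x‖ * (M * ‖x‖) := by gcongr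
  have h5 : τ / M * ‖x‖ * (M * ‖x‖) = τ * ‖x‖ ^ 2 := by field_simp
  linarith

lemma FF_norm {E : Vec 2 → ℝ} (x : Vec 2) (hr : 0 < rhoF E x) : ‖FF E x‖ = ‖gradient E x‖ := by
  rw [← sq_eq_sq₀ (norm_nonneg _) (norm_nonneg _), nsq, nsq]
  have := rho_sq E x
  simp only [FF]
  simp
  rw [div_pow, div_pow, ← add_div, div_eq_iff (by positivity), this]
  unfold uF0 uF1; ring

lemma hasDeriv_Q (p q r : ℝ) {x : ℝ → Vec 2} {y : Vec 2} {t : ℝ} (h : HasDerivAt x y t) :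
    HasDerivAt (fun t => Qf p q r (x t) (x t)) (2 * Qf p q r (x t) y) t := by
  have h0 : HasDerivAt (fun t => x t 0) (y 0) t := 
    (EuclideanSpace.proj (𝕜 := ℝ) 0 : Vec 2 →L[ℝ] ℝ).hasFDerivAt.comp_hasDerivAt t h
  have h1 : HasDerivAt (fun t => x t 1) (y 1) t := 
    (EuclideanSpace.proj (𝕜 := ℝ) 1 : Vec 2 →L[ℝ] ℝ).hasFDerivAt.comp_hasDerivAt t h
  have := (((h0.mul h0).const_mul p).add (((h0.mul h1).add (h1.mul h0)).const_mul q)).add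
    ((h1.mul h1).const_mul r)
  refine this.congr_deriv ?_
  unfold Qf
  ring

end
noncomputable section

lemma local_sol {E : Vec 2 → ℝ} (hE : ContDiff ℝ 3 E) (x0 : Vec 2) (hx0 : x0 ≠ 0)
    (hr : 0 < rhoF E x0) (t0 : ℝ) :
    ∃ ε > 0, ∃ f : ℝ → Vec 2, f t0 = x0 ∧ ∀ t ∈ Ioo (t0 - ε) (t0 + ε),
      f t ≠ 0 ∧ 0 < rhoF E (f t) ∧ HasDerivAt f (FF E (f t)) t := by
  obtain ⟨f, hf0, ε, hε, hf⟩ :=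
    (contDiffAt_FF hE x0 hr).exists_forall_mem_closedBall_exists_eq_forall_mem_Ioo_hasDerivAt₀ t0
  have hc : ContinuousAt f t0 := (hf t0 ⟨by linarith, by linarith⟩).continuousAt
  have ev1 : ∀ᶠ t in 𝓝 t0, f t ≠ 0 := hc.eventually_ne (by rwa [hf0])
  have ev2 : ∀ᶠ t in 𝓝 t0, 0 < rhoF E (f t) := by
    have : ContinuousAt (fun t => rhoF E (f t)) t0 :=
      (continuous_rho hE).continuousAt.comp hc
    exact this.eventually (lt_mem_nhds (by simpa [hf0] using hr))
  obtain ⟨δ, hδ, h⟩ := Metric.eventually_nhds_iff.1 (ev1.and ev2)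
  refine ⟨min ε δ, lt_min hε hδ, f, hf0, ?_⟩
  intro t ht
  have h1 := min_le_left ε δ
  have h2 := min_le_right ε δ
  have h3 := h (y := t) (by
    rw [Real.dist_eq, abs_lt]; constructor <;> linarith [ht.1, ht.2])
  exact ⟨h3.1, h3.2, hf t ⟨by linarith [ht.1], by linarith [ht.2]⟩⟩

lemma away_of {E : Vec 2 → ℝ} (hE : ContDiff ℝ 3 E) {x : ℝ → Vec 2} {t : ℝ}
    (h : x t ≠ 0 ∧ 0 < rhoF E (x t) ∧ HasDerivAt x (FF E (x t)) t) :
    x t ≠ 0 ∧ ∃ w : Vec 2, IsMinEigvec (hessOp E (x t)) w ∧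
      HasDerivAt x (isdField E (x t) w) t := by
  obtain ⟨w, hw⟩ := exists_w hE (x t) h.2.1
  refine ⟨h.1, w, hw, ?_⟩
  rw [isd_eq hE _ _ h.2.1 hw]
  exact h.2.2

lemma trap {E : Vec 2 → ℝ} (hE : ContDiff ℝ 3 E) (p q r d k R R1 : ℝ)
    (hd : 0 < d) (hk : 0 < k) (hR1 : 0 < R1) (hR : R1 < R)
    (hdQ : ∀ x : Vec 2, d * ‖x‖ ^ 2 ≤ Qf p q r x x)
    (hnear : ∀ x : Vec 2, x ≠ 0 → ‖x‖ < R →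
      0 < rhoF E x ∧ 2 * Qf p q r x (FF E x) ≤ -k * ‖x‖)
    (T : ℝ) (x : ℝ → Vec 2) (h0 : Qf p q r (x 0) (x 0) ≤ d * R1 ^ 2)
    (hx : IsISDSolAway E x (Ico 0 T)) :
    ∀ t ∈ Ico 0 T, x t ≠ 0 ∧ ‖x t‖ ≤ R1 ∧ 0 < rhoF E (x t) ∧ HasDerivAt x (FF E (x t)) t := by
  have hsmall : ∀ y : Vec 2, Qf p q r y y ≤ d * R1 ^ 2 → ‖y‖ ≤ R1 := by
    intro y hy
    have h1 := hdQ y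
    have h2 : ‖y‖ ^ 2 ≤ R1 ^ 2 := le_of_mul_le_mul_left (h1.trans hy) hd
    exact (sq_le_sq₀ (norm_nonneg _) hR1.le).1 h2
  have hder : ∀ t ∈ Ico 0 T, ‖x t‖ ≤ R1 → HasDerivAt x (FF E (x t)) t := by
    intro t ht hn
    obtain ⟨hne, w, hw, hd'⟩ := hx t ht
    rwa [isd_eq hE _ _ (hnear _ hne (hn.trans_lt hR)).1 hw] at hd'
  have hdd : ∀ t ∈ Ico 0 T, HasDerivAt x (deriv x t) t := by
    intro t ht
    obtain ⟨hne, w, hw, hd'⟩ := hx t ht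
    exact hd'.differentiableAt.hasDerivAt
  intro t ht
  have hQt : Qf p q r (x t) (x t) ≤ d * R1 ^ 2 := by
    have hsub : ∀ s ∈ Icc 0 t, s ∈ Ico 0 T := fun s hs => ⟨hs.1, hs.2.trans_lt ht.2⟩
    refine image_le_of_deriv_right_lt_deriv_boundary
      (f := fun t => Qf p q r (x t) (x t)) (f' := fun t => 2 * Qf p q r (x t) (deriv x t))
      (B := fun _ => d * R1 ^ 2) (B' := fun _ => 0) (a := 0) (b := t) ?_ ?_ h0
      (fun s => hasDerivAt_const _ _) ?_ ⟨ht.1, le_refl t⟩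
    · intro s hs
      exact (hasDeriv_Q p q r (hdd s (hsub s hs))).continuousAt.continuousWithinAt
    · intro s hs
      exact (hasDeriv_Q p q r (hdd s (hsub s ⟨hs.1, hs.2.le⟩))).hasDerivWithinAt
    · intro s hs he
      have hs' := hsub s ⟨hs.1, hs.2.le⟩
      have hn := hsmall (x s) he.le
      have hne := (hx s hs').1
      rw [(hder s hs' hn).deriv]
      have h1 := (hnear _ hne (hn.trans_lt hR)).2
      have h2 : 0 < k * ‖x s‖ := mul_pos hk (norm_pos_iff.2 hne)
      linarith
  have hn := hsmall _ hQt
  have hne := (hx t ht).1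
  exact ⟨hne, hn, (hnear _ hne (hn.trans_lt hR)).1, hder t ht hn⟩

lemma time_bound {E : Vec 2 → ℝ} (p q r d k R : ℝ)
    (hd : 0 < d) (hk : 0 < k)
    (hdQ : ∀ x : Vec 2, d * ‖x‖ ^ 2 ≤ Qf p q r x x)
    (hnear : ∀ x : Vec 2, x ≠ 0 → ‖x‖ < R →
      0 < rhoF E x ∧ 2 * Qf p q r x (FF E x) ≤ -k * ‖x‖) :
    ∃ m > 0, ∀ (T : ℝ) (x : ℝ → Vec 2),
    (∀ t ∈ Ico 0 T, x t ≠ 0 ∧ ‖x t‖ < R ∧ HasDerivAt x (FF E (x t)) t) →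
    ∀ t ∈ Ico 0 T, m * t ≤ √(Qf p q r (x 0) (x 0)) := by
  set K := |p| + 2 * |q| + |r| with hK
  have hK0 : 0 ≤ K := by positivity
  have hQK : ∀ y : Vec 2, √(Qf p q r y y) ≤ (K + 1) * ‖y‖ := by
    intro y
    apply Real.sqrt_le_iff.2
    refine ⟨by positivity, ?_⟩
    have h1 := Qf_bound p q r y y ‖y‖ (abs_coord_le y 0) (abs_coord_le y 1)
    rw [← hK] at h1
    have h2 := (abs_le.1 h1).2
    nlinarith [mul_nonneg hK0 (sq_nonneg ‖y‖), mul_nonneg (mul_nonneg hK0 hK0) (sq_nonneg ‖y‖),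
      sq_nonneg ‖y‖]
  refine ⟨k / (2 * (K + 1)), by positivity, ?_⟩
  intro T x hx t ht
  have hsub : ∀ s ∈ Icc 0 t, s ∈ Ico 0 T := fun s hs => ⟨hs.1, hs.2.trans_lt ht.2⟩
  have hpos : ∀ s ∈ Ico 0 T, 0 < Qf p q r (x s) (x s) := by
    intro s hs
    have h1 : 0 < ‖x s‖ := norm_pos_iff.2 (hx s hs).1
    have : 0 < d * ‖x s‖ ^ 2 := by positivity
    exact this.trans_le (hdQ _)
  have hD : ∀ s ∈ Ico 0 T, HasDerivAt (fun t => √(Qf p q r (x t) (x t)))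
      ((2 * Qf p q r (x s) (FF E (x s))) / (2 * √(Qf p q r (x s) (x s)))) s := by
    intro s hs
    exact (hasDeriv_Q p q r (hx s hs).2.2).sqrt (hpos s hs).ne'
  have key := image_le_of_deriv_right_le_deriv_boundary
      (f := fun t => √(Qf p q r (x t) (x t)))
      (f' := fun s => (2 * Qf p q r (x s) (FF E (x s))) / (2 * √(Qf p q r (x s) (x s))))
      (B := fun s => √(Qf p q r (x 0) (x 0)) - k / (2 * (K + 1)) * s)
      (B' := fun _ => - (k / (2 * (K + 1)))) (a := 0) (b := t)
      (fun s hs => (hD s (hsub s hs)).continuousAt.continuousWithinAt)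
      (fun s hs => (hD s (hsub s ⟨hs.1, hs.2.le⟩)).hasDerivWithinAt)
      (by simp) (by fun_prop)
      (fun s hs => by
        have := ((hasDerivAt_id s).const_mul (k / (2 * (K + 1)))).const_sub
          (√(Qf p q r (x 0) (x 0)))
        exact (this.congr_deriv (by simp)).hasDerivWithinAt)
      (fun s hs => by
        have hs' := hsub s ⟨hs.1, hs.2.le⟩
        obtain ⟨hne, hn, _⟩ := hx s hs'
        have h1 := (hnear _ hne hn).2
        have h2 : 0 < √(Qf p q r (x s) (x s)) := Real.sqrt_pos.2 (hpos s hs')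
        have h3 := hQK (x s)
        rw [div_le_iff₀ (by positivity)]
        have h4 : k / (2 * (K + 1)) * (2 * √(Qf p q r (x s) (x s))) ≤
            k / (2 * (K + 1)) * (2 * ((K + 1) * ‖x s‖)) := by gcongr
        have h5 : k / (2 * (K + 1)) * (2 * ((K + 1) * ‖x s‖)) = k * ‖x s‖ := by field_simp
        linarith)
      (x := t) ⟨ht.1, le_refl t⟩
  have h0 := Real.sqrt_nonneg (Qf p q r (x t) (x t))
  linarith

lemma maximal_tendsto {E : Vec 2 → ℝ} (hE : ContDiff ℝ 3 E) (R R1 : ℝ) (hR : R1 < R)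
    (hrho : ∀ x : Vec 2, x ≠ 0 → ‖x‖ < R → 0 < rhoF E x)
    (T : ℝ) (hT : 0 < T) (x : ℝ → Vec 2)
    (hx : ∀ t ∈ Ico 0 T, x t ≠ 0 ∧ ‖x t‖ ≤ R1 ∧ 0 < rhoF E (x t) ∧
      HasDerivAt x (FF E (x t)) t)
    (hmax : ¬ ∃ (T' : ℝ) (y : ℝ → Vec 2), T < T' ∧
          IsISDSolAway E y (Ico 0 T') ∧ EqOn y x (Ico 0 T)) :
    Tendsto x (𝓝[<] T) (𝓝 0) := by
  have hgc : Continuous (gradient E) := by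
    have hG : ContDiff ℝ 2 (gradient E) := by
      rw [contDiff_euclidean]
      exact contDiff_grad hE
    exact hG.continuous
  obtain ⟨G, hG⟩ := (isCompact_closedBall (0 : Vec 2) R1).exists_bound_of_continuousOn
    hgc.continuousOn
  have hlip : LipschitzOnWith (Real.toNNReal G) x (Ico 0 T) := by
    refine (convex_Ico 0 T).lipschitzOnWith_of_nnnorm_hasDerivWithin_le
      (f' := fun t => FF E (x t)) (fun t ht => (hx t ht).2.2.2.hasDerivWithinAt) ?_
    intro t ht
    have h1 := hG (x t) (by simpa using (hx t ht).2.1)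
    rw [← FF_norm _ (hx t ht).2.2.1] at h1
    exact NNReal.coe_le_coe.1 (by simpa using Or.inl h1)
  obtain ⟨g, hg, hgx⟩ := hlip.extend_finite_dimension
  have hIco : Ico 0 T ∈ 𝓝[<] T := Ico_mem_nhdsLT hT
  have hlim : Tendsto x (𝓝[<] T) (𝓝 (g T)) := by
    have h1 : Tendsto g (𝓝[<] T) (𝓝 (g T)) := hg.continuous.continuousAt.mono_left nhdsWithin_le_nhds
    refine h1.congr' ?_
    filter_upwards [hIco] with t ht
    exact (hgx ht).symm
  by_cases hz : g T = 0
  · rwa [hz] at hlim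
  exfalso
  apply hmax
  have hn : ‖g T‖ ≤ R1 := by
    refine le_of_tendsto hlim.norm ?_
    filter_upwards [hIco] with t ht
    exact (hx t ht).2.1
  have hr := hrho _ hz (hn.trans_lt hR)
  obtain ⟨ε, hε, f, hf0, hf⟩ := local_sol hE (g T) hz hr T
  set y : ℝ → Vec 2 := fun t => if t < T then x t else f t with hy
  have hyx : ∀ t, t < T → y t = x t := fun t ht => by simp [hy, ht]
  have hyf : ∀ t, T ≤ t → y t = f t := fun t ht => by simp [hy, not_lt.2 ht]
  have hyd : ∀ t ∈ Ico 0 T, HasDerivAt y (FF E (x t)) t := by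
    intro t ht
    refine (hx t ht).2.2.2.congr_of_eventuallyEq ?_
    filter_upwards [Iio_mem_nhds ht.2] with s hs
    exact hyx s hs
  refine ⟨T + ε, y, by linarith, ?_, fun t ht => hyx t ht.2⟩
  intro t ht
  apply away_of hE
  rcases lt_trichotomy t T with h | h | h
  · rw [hyx t h]
    have := hx t ⟨ht.1, h⟩
    exact ⟨this.1, this.2.2.1, hyd t ⟨ht.1, h⟩⟩
  · subst h
    rw [hyf t le_rfl]
    have hft := hf t ⟨by linarith, by linarith⟩
    refine ⟨hft.1, hft.2.1, ?_⟩
    have hyt : y t = g t := by rw [hyf t le_rfl, hf0]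
    have hylim : Tendsto y (𝓝[<] t) (𝓝 (y t)) := by
      rw [hyt]
      refine hlim.congr' ?_
      filter_upwards [self_mem_nhdsWithin] with s hs
      exact (hyx s hs).symm
    have hleft : HasDerivWithinAt y (FF E (f t)) (Iic t) t := by
      refine hasDerivWithinAt_Iic_of_tendsto_deriv (s := Ico 0 t) ?_ ?_ hIco ?_
      · intro s hs
        exact (hyd s hs).differentiableAt.differentiableWithinAt
      · exact hylim.mono_left (nhdsWithin_mono _ (fun s hs => hs.2))
      · have hc : Tendsto (fun s => FF E (x s)) (𝓝[<] t) (𝓝 (FF E (g t))) :=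
          (contDiffAt_FF hE _ hr).continuousAt.tendsto.comp hlim
        rw [hf0]
        refine hc.congr' ?_
        filter_upwards [hIco] with s hs
        exact (hyd s hs).deriv.symm
    have hright : HasDerivWithinAt y (FF E (f t)) (Ici t) t :=
      hft.2.2.hasDerivWithinAt.congr (fun s hs => hyf s hs) (hyf t le_rfl)
    have := hleft.union hright
    rw [Iic_union_Ici, hasDerivWithinAt_univ] at this
    exact this
  · rw [hyf t h.le]
    have hft := hf t ⟨by linarith, ht.2⟩
    refine ⟨hft.1, hft.2.1, hft.2.2.congr_of_eventuallyEq ?_⟩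
    filter_upwards [Ioi_mem_nhds h] with s hs
    exact hyf s hs.le

end

/-- (Finite-time blow-up of the ISD at an attractive singularity.)
Let `0` be a singularity of `E ∈ C³(ℝ²)`, `∇E(0) = (cos α, sin α)`, `Δ = 2 det A > 0`, and
suppose both eigenvalues of `R₋α A` have strictly positive real part. Then every maximal
ISD solution starting at a sufficiently small `x(0) ≠ 0` blows up in finite time
`T* < ∞`, with `x(t) → 0` as `t → T*`. -/
theorem stmt15 (E : Vec 2 → ℝ) (hE : ContDiff ℝ 3 E) (h0 : SingularAt E 0)
    (α : ℝ) (hg0 : gradient E 0 = mkVec (Real.cos α) (Real.sin α))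
    (Δ : ℝ) (hΔ : Δ = 2 * (Amat E).det) (hΔpos : 0 < Δ)
    (hB : ∀ μ : ℂ, Module.End.HasEigenvalue
      (Matrix.toLin' (((RotM (-α)) * (Amat E)).map (Complex.ofReal))) μ → 0 < μ.re) :
    ∃ r0 : ℝ, 0 < r0 ∧ ∀ x0 : Vec 2, x0 ≠ 0 → ‖x0‖ < r0 →
      -- a (local) solution exists
      (∃ (T : ℝ) (x : ℝ → Vec 2), 0 < T ∧ x 0 = x0 ∧ IsISDSolAway E x (Ico 0 T)) ∧
      -- there is no global solution: the maximal existence time is finite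
      (¬ ∃ x : ℝ → Vec 2, x 0 = x0 ∧ IsISDSolAway E x (Ici 0)) ∧
      -- every maximal (non-extendable) solution on a finite interval tends to `0`
      (∀ (Tstar : ℝ) (x : ℝ → Vec 2), 0 < Tstar → x 0 = x0 →
        IsISDSolAway E x (Ico 0 Tstar) →
        (¬ ∃ (T' : ℝ) (y : ℝ → Vec 2), Tstar < T' ∧
          IsISDSolAway E y (Ico 0 T') ∧ EqOn y x (Ico 0 Tstar)) →
        Tendsto x (𝓝[<] Tstar) (𝓝 0)) := by
  obtain ⟨ha0, hb0⟩ := sing_zero hE 0 h0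
  have hg0' : gradient E 0 0 = Real.cos α := by rw [hg0]; simp [mkVec]
  have hg1' : gradient E 0 1 = Real.sin α := by rw [hg0]; simp [mkVec]
  have htr := trace_pos _ hB
  have hdet : 0 < (Amat E).det := by linarith
  rw [Matrix.det_fin_two] at hdet
  set a := Amat E 0 0 with ha
  set b := Amat E 0 1 with hb
  set c := Amat E 1 0 with hc
  set e := Amat E 1 1 with he
  have hB00 : (RotM (-α) * Amat E) 0 0 = Real.cos α * a + Real.sin α * c := by
    simp [Matrix.mul_apply, RotM, ha, hc]
  have hB11 : (RotM (-α) * Amat E) 1 1 = Real.cos α * e - Real.sin α * b := by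
    simp [Matrix.mul_apply, RotM, he, hb]; ring
  rw [hB00, hB11] at htr
  have hcs := Real.cos_sq_add_sin_sq α
  obtain ⟨u, hu⟩ : ∃ u, u = Real.cos α := ⟨_, rfl⟩
  obtain ⟨v, hv⟩ : ∃ v, v = Real.sin α := ⟨_, rfl⟩
  rw [← hu, ← hv] at htr hcs
  rw [← hu] at hg0'
  rw [← hv] at hg1'
  obtain ⟨d, hd⟩ : ∃ d, d = a * e - b * c := ⟨_, rfl⟩
  rw [← hd] at hdet
  obtain ⟨B0, hB0⟩ : ∃ z, z = u * a + v * c := ⟨_, rfl⟩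
  obtain ⟨B1, hB1⟩ : ∃ z, z = u * b + v * e := ⟨_, rfl⟩
  obtain ⟨B2, hB2⟩ : ∃ z, z = u * c - v * a := ⟨_, rfl⟩
  obtain ⟨B3, hB3⟩ : ∃ z, z = u * e - v * b := ⟨_, rfl⟩
  rw [← hB0, ← hB3] at htr
  have hdB : d = B0 * B3 - B1 * B2 := by
    rw [hB0, hB1, hB2, hB3, hd]
    linear_combination (-(a * e - b * c)) * hcs
  obtain ⟨R, hR, k, hk, hnear⟩ := near hE ha0 hb0 u v hg0' hg1'
    (d + B3 ^ 2 + B2 ^ 2) (-(B3 * B1) - B2 * B0) (d + B1 ^ 2 + B0 ^ 2) (d * (B0 + B3))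
    (mul_pos hdet htr) (by
      intro x
      rw [nsq]
      have e0 : u * (a * x 0 + b * x 1) + v * (c * x 0 + e * x 1) = B0 * x 0 + B1 * x 1 := by
        rw [hB0, hB1]; ring
      have e1 : u * (c * x 0 + e * x 1) - v * (a * x 0 + b * x 1) = B2 * x 0 + B3 * x 1 := by
        rw [hB2, hB3]; ring
      simp only [← ha, ← hb, ← hc, ← he, e0, e1]
      simp only [Qf]
      simp
      rw [hdB]
      ring)
  set p := d + B3 ^ 2 + B2 ^ 2
  set q := -(B3 * B1) - B2 * B0
  set r := d + B1 ^ 2 + B0 ^ 2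
  have hdQ : ∀ x : Vec 2, d * ‖x‖ ^ 2 ≤ Qf p q r x x := by
    intro x
    rw [nsq]
    simp only [Qf, p, q, r]
    nlinarith [sq_nonneg (B3 * x 0 - B1 * x 1), sq_nonneg (B0 * x 1 - B2 * x 0)]
  obtain ⟨m, hm, htime⟩ := time_bound (E := E) p q r d k R hdet hk hdQ hnear
  have hR1 : 0 < R / 2 := by linarith
  have hR2 : R / 2 < R := by linarith
  have hQc : Continuous (fun x : Vec 2 => Qf p q r x x) := by
    unfold Qf; fun_prop
  have hQ0 : ∀ᶠ x in 𝓝 (0 : Vec 2), Qf p q r x x < d * (R / 2) ^ 2 :=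
    hQc.continuousAt.eventually (gt_mem_nhds (by simp [Qf]; positivity))
  obtain ⟨δ, hδ, hδQ⟩ := Metric.eventually_nhds_iff.1 hQ0
  refine ⟨min δ R, lt_min hδ hR, ?_⟩
  intro x0 hx0 hx0r
  have hQx0 : Qf p q r x0 x0 ≤ d * (R / 2) ^ 2 :=
    (hδQ (y := x0) (by simpa using hx0r.trans_le (min_le_left _ _))).le
  have hx0R : ‖x0‖ < R := hx0r.trans_le (min_le_right _ _)
  have htrap := trap hE p q r d k R (R / 2) hdet hk hR1 hR2 hdQ hnear
  refine ⟨?_, ?_, ?_⟩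
  · obtain ⟨ε, hε, f, hf0, hf⟩ := local_sol hE x0 hx0 (hnear x0 hx0 hx0R).1 0
    refine ⟨ε, f, hε, hf0, ?_⟩
    intro t ht
    exact away_of hE (hf t ⟨by linarith [ht.1], by linarith [ht.2]⟩)
  · rintro ⟨x, hx, hsol⟩
    obtain ⟨S, hS⟩ : ∃ S, S = √(Qf p q r (x 0) (x 0)) := ⟨_, rfl⟩
    have hS0 : 0 ≤ S := by rw [hS]; exact Real.sqrt_nonneg _
    have h1 := htrap ((S + 1) / m + 1) x (by rw [hx]; exact hQx0) (fun t ht => hsol t ht.1)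
    have h2 := htime ((S + 1) / m + 1) x
      (fun t ht => ⟨(h1 t ht).1, (h1 t ht).2.1.trans_lt hR2, (h1 t ht).2.2.2⟩)
      ((S + 1) / m) ⟨by positivity, by linarith⟩
    rw [← hS, mul_div_cancel₀ _ hm.ne'] at h2
    linarith
  · intro T x hT hx hsol hmax
    have h1 := htrap T x (by rw [hx]; exact hQx0) hsol
    exact maximal_tendsto hE R (R / 2) hR2 (fun y hy hyR => (hnear y hy hyR).1) T hT x h1 hmax
end

section
/- Let N ≥ 2 and let E⁰ ∈ C⁴(ℝ^N) have the form E⁰(x) = (cos α⁰ x1 + sin α⁰ x2) + (λ⁰/2)(x1² + x2²) + ½(x1³ + x1 x2²) + ½ Σ_{i,j≥3} H⁰_ij x_i x_j + (1/6) Σ_{i,j,k≥3} G⁰_ijk x_i x_j x_k + O(‖x‖⁴), with α⁰ ∈ (0, π/2) ∪ (π/2, π), λ⁰ ∈ ℝ, and the symmetric (N−2)×(N−2) matrix H⁰ satisfying H⁰ > max(λ⁰, 0)·I. Let ΔE ∈ C⁴(ℝ^N) and E^δ = E⁰ + δ ΔE. Then there exist δ0, M > 0 such that for all 0 < δ < δ0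 there exists z^δ ∈ ℝ^N with ‖z^δ‖ ≤ M δ such that the two smallest eigenvalues of ∇²E^δ(z^δ) coincide (λ1 = λ2) and ∇E^δ(z^δ) lies in the span of two corresponding eigenvectors. -/
open Real Filter Set
open scoped Topology RealInnerProductSpace

/-- the "converging" index set `I_c = {3, …, N}` (0-based: indices `≥ 2`). -/
def Ic (N : ℕ) : Finset (Fin (N + 2)) := Finset.univ.filter fun i => 2 ≤ (i : ℕ)

/-- `E⁰` has the normal form \eqref{eq:multiD-E0}:
`E⁰(x) = cos α⁰ x₁ + sin α⁰ x₂ + (λ⁰/2)(x₁² + x₂²) + ½(x₁³ + x₁x₂²)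
        + ½ Σ_{i,j ∈ I_c} H⁰_ij x_i x_j + (1/6) Σ_{i,j,k ∈ I_c} G⁰_ijk x_i x_j x_k + O(‖x‖⁴)`,
the remainder being a `C⁴` function vanishing to fourth order at `0`. -/
def E0Form {N : ℕ} (E0 : Vec (N + 2) → ℝ) (α0 lam0 : ℝ)
    (H : Fin (N + 2) → Fin (N + 2) → ℝ) (G : Fin (N + 2) → Fin (N + 2) → Fin (N + 2) → ℝ) :
    Prop :=
  ∃ ρ : Vec (N + 2) → ℝ, ContDiff ℝ 4 ρ ∧
    (∀ k : ℕ, k ≤ 3 → iteratedFDeriv ℝ k ρ 0 = 0) ∧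
    E0 = fun x =>
      (Real.cos α0 * x 0 + Real.sin α0 * x 1)
      + (lam0 / 2) * ((x 0) ^ 2 + (x 1) ^ 2)
      + (1 / 2) * ((x 0) ^ 3 + (x 0) * (x 1) ^ 2)
      + (1 / 2) * ∑ i ∈ Ic N, ∑ j ∈ Ic N, H i j * x i * x j
      + (1 / 6) * ∑ i ∈ Ic N, ∑ j ∈ Ic N, ∑ k ∈ Ic N, G i j k * x i * x j * x k
      + ρ x

/-- `H > max(λ⁰,0)·I` as a quadratic form on the subspace of indices in `I_c`. -/
def HPos {N : ℕ} (H : Fin (N + 2) → Fin (N + 2) → ℝ) (lam0 : ℝ) : Prop :=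
  (∀ i j, H i j = H j i) ∧
  ∃ c : ℝ, max lam0 0 < c ∧ ∀ y : Fin (N + 2) → ℝ,
    c * ∑ i ∈ Ic N, (y i) ^ 2 ≤ ∑ i ∈ Ic N, ∑ j ∈ Ic N, H i j * y i * y j

/-- the two smallest eigenvalues of the Hessian of `E` at `z` coincide (the smallest
eigenvalue has multiplicity `≥ 2`), and `∇E(z)` lies in the span of two corresponding
eigenvectors. -/
def SingularWithGradInPlane {N : ℕ} (E : Vec N → ℝ) (z : Vec N) : Prop :=
  ∃ lam : ℝ, (hessOp E z).HasEigenvalue lam ∧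
    (∀ μ : ℝ, (hessOp E z).HasEigenvalue μ → lam ≤ μ) ∧
    2 ≤ Module.finrank ℝ (Module.End.eigenspace (hessOp E z) lam) ∧
    gradient E z ∈ Module.End.eigenspace (hessOp E z) lam

section AuxLemmas

lemma aux_ift {X : Type*} [NormedAddCommGroup X] [NormedSpace ℝ X] [FiniteDimensional ℝ X]
    (F : ℝ × X → X) (hF : ContDiff ℝ 1 F) (x0 : X) (h0 : F (0, x0) = 0)
    (hinj : ∀ d : X, HasDerivAt (fun t : ℝ => F (0, x0 + t • d)) 0 0 → d = 0) :
    ∃ (x : ℝ → X) (M : ℝ), 0 < M ∧ ∀ᶠ δ in 𝓝 (0 : ℝ), F (δ, x δ) = 0 ∧ ‖x δ - x0‖ ≤ M * ‖δ‖ := by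
  have : CompleteSpace X := FiniteDimensional.complete ℝ X
  let Ψ : ℝ × X → ℝ × X := fun p => (p.1, F p)
  have hΨ : ContDiff ℝ 1 Ψ := contDiff_fst.prodMk hF
  have hs : HasStrictFDerivAt Ψ (fderiv ℝ Ψ (0, x0)) (0, x0) :=
    hΨ.contDiffAt.hasStrictFDerivAt (by norm_num)
  have hd : HasFDerivAt Ψ ((ContinuousLinearMap.fst ℝ ℝ X).prod (fderiv ℝ F (0, x0))) (0, x0) :=
    hasFDerivAt_fst.prodMk ((hF.differentiable (by norm_num)) _).hasFDerivAt
  have hinj' : Function.Injective (fderiv ℝ Ψ (0, x0)).toLinearMap := by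
    rw [injective_iff_map_eq_zero]
    rintro ⟨a, d⟩ h
    rw [hd.fderiv] at h
    have h1 : a = 0 := by simpa using congrArg Prod.fst h
    subst h1
    have h2 : fderiv ℝ F (0, x0) (0, d) = 0 := by simpa using congrArg Prod.snd h
    have : d = 0 := by
      apply hinj
      have hp : HasDerivAt (fun t : ℝ => ((0 : ℝ), x0 + t • d)) (0, d) 0 := by
        refine (hasDerivAt_const _ _).prodMk ?_
        simpa using ((hasDerivAt_id (0 : ℝ)).smul_const d).const_add x0
      have hf := ((hF.differentiable (by norm_num)) (0, x0)).hasFDerivAt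
      have := HasFDerivAt.comp_hasDerivAt_of_eq (0 : ℝ) hf hp (by simp)
      rw [h2] at this
      exact this
    simp [this]
  let e : (ℝ × X) ≃L[ℝ] (ℝ × X) := (LinearEquiv.ofInjectiveEndo _ hinj').toContinuousLinearEquiv
  have he : (e : (ℝ × X) →L[ℝ] (ℝ × X)) = fderiv ℝ Ψ (0, x0) := by
    ext v <;> rfl
  rw [← he] at hs
  have hΨ0 : Ψ (0, x0) = (0, 0) := by simp [Ψ, h0]
  let L := hs.localInverse Ψ e (0, x0)
  have hr := hs.eventually_right_inverse
  have hO := hs.to_localInverse.hasFDerivAt.isBigO_sub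
  rw [hΨ0] at hr hO
  have hL0 : L (0, 0) = (0, x0) := by
    have := hs.localInverse_apply_image
    rwa [hΨ0] at this
  obtain ⟨M, hM, hO⟩ := hO.exists_pos
  have hO := hO.bound
  have hc : Tendsto (fun δ : ℝ => (δ, (0 : X))) (𝓝 0) (𝓝 (0, 0)) := by
    have : Continuous (fun δ : ℝ => (δ, (0 : X))) := by fun_prop
    exact this.tendsto 0
  refine ⟨fun δ => (L (δ, 0)).2, M, hM, ?_⟩
  filter_upwards [hc.eventually hr, hc.eventually hO] with δ h1 h2
  change Ψ (L (δ, 0)) = (δ, 0) at h1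
  have h3 : (L (δ, 0)).1 = δ := congrArg Prod.fst h1
  have h4 : F (L (δ, 0)) = 0 := congrArg Prod.snd h1
  constructor
  · have h7 : ((δ, (L (δ, 0)).2) : ℝ × X) = L (δ, 0) := Prod.ext h3.symm rfl
    change F (δ, (L (δ, 0)).2) = 0
    rw [h7, h4]
  · change ‖L (δ, 0) - L (0, 0)‖ ≤ _ at h2
    rw [hL0] at h2
    have h5 : ‖(L (δ, 0) - (0, x0)).2‖ ≤ ‖L (δ, 0) - (0, x0)‖ := norm_snd_le _
    have h6 : ‖((δ, (0 : X)) - (0, 0) : ℝ × X)‖ = ‖δ‖ := by simp [Prod.norm_def]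
    rw [h6] at h2
    exact h5.trans h2

variable {V : Type*} [NormedAddCommGroup V] [InnerProductSpace ℝ V]

lemma aux_lin (A : V →L[ℝ] V) (T : V →L[ℝ] V →L[ℝ] V) (e e' : V) (lam c : ℝ)
    (hA : ∀ u v, ⟪A u, v⟫ = ⟪u, A v⟫) (he : ⟪e, e⟫ = 1) (he' : ⟪e', e'⟫ = 1) (hee : ⟪e, e'⟫ = 0)
    (hAe : A e = lam • e) (hAe' : A e' = lam • e') (hc : max lam 0 < c)
    (hpos : ∀ v, ⟪v, e⟫ = 0 → ⟪v, e'⟫ = 0 → c * ⟪v, v⟫ ≤ ⟪v, A v⟫)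
    (hTe : ∀ u v, ⟪v, e⟫ = 0 → ⟪v, e'⟫ = 0 → ⟪T u e, v⟫ = 0)
    (hTe' : ∀ u v, ⟪v, e⟫ = 0 → ⟪v, e'⟫ = 0 → ⟪T u e', v⟫ = 0)
    (hTs : ∀ u, ⟪T u e', e⟫ = ⟪T u e, e'⟫)
    (hT : ∀ (a b s : ℝ), T (a • e + b • e') e = s • e → T (a • e + b • e') e' = s • e' → a = 0 ∧ b = 0)
    (dz dw : V) (s : ℝ)
    (h1 : T dz e + A (A dz) - (lam • A dz + s • e) = 0)
    (h2 : T dz e' + A dw - (lam • dw + s • e') + ⟪dw, e⟫ • e = 0)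
    (h3 : ⟪dw, e'⟫ = 0) : dz = 0 ∧ dw = 0 ∧ s = 0 := by
  have hlc : lam < c := lt_of_le_of_lt (le_max_left _ _) hc
  have hc0 : 0 < c := lt_of_le_of_lt (le_max_right _ _) hc
  have hee' : ⟪e', e⟫ = 0 := by rw [real_inner_comm]; exact hee
  have key : ∀ v, ⟪v, e⟫ = 0 → ⟪v, e'⟫ = 0 → ∀ m : ℝ, m < c → ⟪v, A v⟫ = m * ⟪v, v⟫ → v = 0 := by
    intro v hv hv' m hm h
    have := hpos v hv hv'
    rw [h] at this
    have h4 : 0 ≤ ⟪v, v⟫ := real_inner_self_nonneg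
    have : ⟪v, v⟫ = 0 := by nlinarith
    exact inner_self_eq_zero.mp this
  set a := ⟪dz, e⟫ with ha
  set b := ⟪dz, e'⟫ with hb
  obtain ⟨d, hd⟩ : ∃ d, d = dz - (a • e + b • e') := ⟨_, rfl⟩
  have hde : ⟪d, e⟫ = 0 := by
    rw [hd]; simp only [inner_sub_left, inner_add_left, real_inner_smul_left, he, hee']; simp [ha]
  have hde' : ⟪d, e'⟫ = 0 := by
    rw [hd]; simp only [inner_sub_left, inner_add_left, real_inner_smul_left, he', hee]; simp [hb]
  have hy : ⟪A d, e⟫ = 0 := by rw [hA, hAe, real_inner_smul_right, hde, mul_zero]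
  have hy' : ⟪A d, e'⟫ = 0 := by rw [hA, hAe', real_inner_smul_right, hde', mul_zero]
  have hdz : dz = d + (a • e + b • e') := by rw [hd]; abel
  have hAdz : A dz = A d + lam • (a • e + b • e') := by
    rw [hdz]; simp only [map_add, map_smul, hAe, hAe', smul_add, smul_comm lam]
  have hAA : A (A dz) - lam • A dz = A (A d) - lam • A d := by
    rw [hAdz]; simp only [map_add, map_smul, hAe, hAe', smul_add, smul_comm lam]; abel
  have h1' : T dz e + (A (A d) - lam • A d) - s • e = 0 := by
    rw [← hAA, ← h1]; abel
  have hAd : A d = 0 := by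
    apply key _ hy hy' lam hlc
    have := congrArg (fun x => ⟪x, A d⟫) h1'
    simp only [inner_sub_left, inner_add_left, real_inner_smul_left, hTe dz _ hy hy', inner_zero_left] at this
    rw [real_inner_comm (A d) e, hy] at this
    rw [real_inner_comm]
    linarith
  have hd0 : d = 0 := by
    apply key _ hde hde' 0 hc0
    simp [hAd]
  have hT1 : T dz e = s • e := by
    rw [hAd] at h1'; simp at h1'; exact sub_eq_zero.mp h1'
  set p := ⟪dw, e⟫ with hp
  obtain ⟨f, hf⟩ : ∃ f, f = dw - p • e := ⟨_, rfl⟩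
  have hfe : ⟪f, e⟫ = 0 := by
    rw [hf]; simp only [inner_sub_left, real_inner_smul_left, he]; simp [hp]
  have hfe' : ⟪f, e'⟫ = 0 := by
    rw [hf]; simp only [inner_sub_left, real_inner_smul_left, hee, h3]; simp
  have hdw : dw = f + p • e := by rw [hf]; abel
  have h2' : T dz e' + (A f - lam • f) - s • e' + p • e = 0 := by
    rw [← h2, hdw]; simp only [map_add, map_smul, hAe, smul_add, smul_comm lam]; abel
  have hf0 : f = 0 := by
    apply key _ hfe hfe' lam hlc
    have := congrArg (fun x => ⟪x, f⟫) h2'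
    simp only [inner_sub_left, inner_add_left, real_inner_smul_left, hTe' dz _ hfe hfe', inner_zero_left] at this
    rw [real_inner_comm f e, hfe, real_inner_comm f e', hfe'] at this
    rw [real_inner_comm]
    linarith
  rw [hf0] at h2'
  have hp0 : p = 0 := by
    have := congrArg (fun x => ⟪x, e⟫) h2'
    simp only [inner_sub_left, inner_add_left, real_inner_smul_left, hTs, hT1, map_zero, smul_zero, inner_zero_left, hee, hee', he] at this
    linarith
  have hT2 : T dz e' = s • e' := by
    rw [hp0] at h2'; simp at h2'; exact sub_eq_zero.mp h2'
  have hdz2 : dz = a • e + b • e' := by rw [hdz, hd0]; simp [ha, hb]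
  have hab := hT a b s (by rw [← hdz2]; exact hT1) (by rw [← hdz2]; exact hT2)
  have hz : dz = 0 := by rw [hdz2, hab.1, hab.2]; simp
  refine ⟨hz, by rw [hdw, hf0, hp0]; simp, ?_⟩
  have := congrArg (fun x => ⟪x, e⟫) hT1
  simp only [hz, real_inner_smul_left, he, map_zero, zero_apply, inner_zero_left] at this
  linarith

lemma aux_min (A B : V →L[ℝ] V) (e e' g w : V) (lam c l ε : ℝ)
    (hA : ∀ u v, ⟪A u, v⟫ = ⟪u, A v⟫)
    (hB : ∀ u v, ⟪B u, v⟫ = ⟪u, B v⟫) (he : ⟪e, e⟫ = 1) (he' : ⟪e', e'⟫ = 1) (hee : ⟪e, e'⟫ = 0)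
    (hAe : A e = lam • e) (hAe' : A e' = lam • e') (hc : lam < c)
    (hpos : ∀ v, ⟪v, e⟫ = 0 → ⟪v, e'⟫ = 0 → c * ⟪v, v⟫ ≤ ⟪v, A v⟫)
    (hε : 2 * ε + (c - lam) * (2 * ε ^ 2) < c - lam)
    (hg : ‖g - e‖ ≤ ε) (hw : ‖w - e'‖ ≤ ε) (hl : |l - lam| ≤ ε) (hBA : ‖B - A‖ ≤ ε)
    (hBg : B g = l • g) (hBw : B w = l • w) (μ : ℝ) (v : V) (hv : v ≠ 0) (hBv : B v = μ • v) :
    l ≤ μ := by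
  by_contra! hlt
  have horth : ∀ x, B x = l • x → ⟪v, x⟫ = 0 := by
    intro x hx
    have := hB v x
    rw [hBv, hx, real_inner_smul_left, real_inner_smul_right] at this
    have : (l - μ) * ⟪v, x⟫ = 0 := by linarith
    rcases mul_eq_zero.mp this with h | h
    · linarith
    · exact h
  have hvg := horth g hBg
  have hvw := horth w hBw
  have hee' : ⟪e', e⟫ = 0 := by rw [real_inner_comm]; exact hee
  have hn : 0 < ‖v‖ := norm_pos_iff.mpr hv
  have hnv : ⟪v, v⟫ = ‖v‖ ^ 2 := real_inner_self_eq_norm_sq v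
  set a := ⟪v, e⟫ with ha
  set b := ⟪v, e'⟫ with hb
  have ha1 : |a| ≤ ‖v‖ * ε := by
    have : a = - ⟪v, g - e⟫ := by rw [inner_sub_right, hvg]; simp [ha]
    rw [this, abs_neg]
    exact (abs_real_inner_le_norm _ _).trans (by gcongr)
  have hb1 : |b| ≤ ‖v‖ * ε := by
    have : b = - ⟪v, w - e'⟫ := by rw [inner_sub_right, hvw]; simp [hb]
    rw [this, abs_neg]
    exact (abs_real_inner_le_norm _ _).trans (by gcongr)
  have ha2 : a ^ 2 ≤ ‖v‖ ^ 2 * ε ^ 2 := by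
    rw [← sq_abs, ← mul_pow]; gcongr
  have hb2 : b ^ 2 ≤ ‖v‖ ^ 2 * ε ^ 2 := by
    rw [← sq_abs, ← mul_pow]; gcongr
  obtain ⟨d, hd⟩ : ∃ d, d = v - (a • e + b • e') := ⟨_, rfl⟩
  have hde : ⟪d, e⟫ = 0 := by
    rw [hd]; simp only [inner_sub_left, inner_add_left, real_inner_smul_left, he, hee']; simp [ha]
  have hde' : ⟪d, e'⟫ = 0 := by
    rw [hd]; simp only [inner_sub_left, inner_add_left, real_inner_smul_left, he', hee]; simp [hb]
  have hed : ⟪e, d⟫ = 0 := by rw [real_inner_comm]; exact hde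
  have hed' : ⟪e', d⟫ = 0 := by rw [real_inner_comm]; exact hde'
  have hvd : v = d + (a • e + b • e') := by rw [hd]; abel
  have hy : ⟪e, A d⟫ = 0 := by rw [← hA, hAe, real_inner_smul_left, hed, mul_zero]
  have hy' : ⟪e', A d⟫ = 0 := by rw [← hA, hAe', real_inner_smul_left, hed', mul_zero]
  have hvv : ⟪v, v⟫ = ⟪d, d⟫ + a ^ 2 + b ^ 2 := by
    clear_value a b
    rw [hvd]
    simp only [inner_add_left, inner_add_right, real_inner_smul_left, real_inner_smul_right, he, he', hee, hee', hde, hde', hed, hed']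
    ring
  have hvA : ⟪v, A v⟫ = ⟪d, A d⟫ + lam * (a ^ 2 + b ^ 2) := by
    clear_value a b
    rw [hvd]
    simp only [map_add, map_smul, hAe, hAe', inner_add_left, inner_add_right, real_inner_smul_left, real_inner_smul_right, he, he', hee, hee', hde, hde', hy, hy']
    ring
  have hpd := hpos d hde hde'
  have hvB : ⟪v, B v⟫ = μ * ‖v‖ ^ 2 := by rw [hBv, real_inner_smul_right, hnv]
  have hdiff : |⟪v, (B - A) v⟫| ≤ ε * ‖v‖ ^ 2 := by
    calc _ ≤ ‖v‖ * ‖(B - A) v‖ := abs_real_inner_le_norm _ _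
      _ ≤ ‖v‖ * (ε * ‖v‖) := by
        gcongr
        exact ((B - A).le_opNorm v).trans (by gcongr)
      _ = _ := by ring
  have hdiff2 : ⟪v, (B - A) v⟫ = ⟪v, B v⟫ - ⟪v, A v⟫ := by
    simp [inner_sub_right]
  rw [hdiff2] at hdiff
  have h1 := (abs_le.mp hdiff).1
  have h2 := (abs_le.mp hl).2
  have hn2 : 0 < ‖v‖ ^ 2 := by positivity
  have h3 : μ * ‖v‖ ^ 2 < (lam + ε) * ‖v‖ ^ 2 := by
    apply mul_lt_mul_of_pos_right _ hn2; linarith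
  have h4 : (c - lam) * (a ^ 2 + b ^ 2) ≤ (c - lam) * (2 * ε ^ 2 * ‖v‖ ^ 2) := by
    apply mul_le_mul_of_nonneg_left _ (by linarith); linarith
  have h5 : (2 * ε + (c - lam) * (2 * ε ^ 2)) * ‖v‖ ^ 2 < (c - lam) * ‖v‖ ^ 2 :=
    mul_lt_mul_of_pos_right hε hn2
  have h6 : ⟪d, d⟫ = ‖v‖ ^ 2 - a ^ 2 - b ^ 2 := by linarith
  rw [h6] at hpd
  nlinarith

lemma aux_close {X W : Type*} [NormedAddCommGroup X] [NormedAddCommGroup W] {f : ℝ × X → W} {x : ℝ → X} {x0 : X}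
    (hxt : Tendsto (fun δ : ℝ => (δ, x δ)) (𝓝 0) (𝓝 (0, x0))) (y : W) {ε : ℝ} (hε0 : 0 < ε)
    (hf : Continuous f) (hy : f (0, x0) = y) : ∀ᶠ δ in 𝓝 (0 : ℝ), ‖f (δ, x δ) - y‖ ≤ ε := by
  have h1 := (hf.tendsto (0, x0)).comp hxt
  rw [hy] at h1
  filter_upwards [h1.eventually (Metric.closedBall_mem_nhds y hε0)] with δ h
  simpa [dist_eq_norm] using h

lemma aux_core [FiniteDimensional ℝ V] (g0 g1 : V → V) (hg0 : ContDiff ℝ 2 g0) (hg1 : ContDiff ℝ 2 g1)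
    (hs0 : ∀ z u v, ⟪fderiv ℝ g0 z u, v⟫ = ⟪u, fderiv ℝ g0 z v⟫)
    (hs1 : ∀ z u v, ⟪fderiv ℝ g1 z u, v⟫ = ⟪u, fderiv ℝ g1 z v⟫)
    (e e' : V) (lam c : ℝ)
    (he : ⟪e, e⟫ = 1) (he' : ⟪e', e'⟫ = 1) (hee : ⟪e, e'⟫ = 0) (hg00 : g0 0 = e)
    (hAe : fderiv ℝ g0 0 e = lam • e) (hAe' : fderiv ℝ g0 0 e' = lam • e') (hc : max lam 0 < c)
    (hpos : ∀ v, ⟪v, e⟫ = 0 → ⟪v, e'⟫ = 0 → c * ⟪v, v⟫ ≤ ⟪v, fderiv ℝ g0 0 v⟫)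
    (hTe : ∀ u v, ⟪v, e⟫ = 0 → ⟪v, e'⟫ = 0 → ⟪fderiv ℝ (fderiv ℝ g0) 0 u e, v⟫ = 0)
    (hTe' : ∀ u v, ⟪v, e⟫ = 0 → ⟪v, e'⟫ = 0 → ⟪fderiv ℝ (fderiv ℝ g0) 0 u e', v⟫ = 0)
    (hTs : ∀ u, ⟪fderiv ℝ (fderiv ℝ g0) 0 u e', e⟫ = ⟪fderiv ℝ (fderiv ℝ g0) 0 u e, e'⟫)
    (hT : ∀ (a b s : ℝ), fderiv ℝ (fderiv ℝ g0) 0 (a • e + b • e') e = s • e →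
      fderiv ℝ (fderiv ℝ g0) 0 (a • e + b • e') e' = s • e' → a = 0 ∧ b = 0) :
    ∃ δ0 M : ℝ, 0 < δ0 ∧ 0 < M ∧ ∀ δ : ℝ, 0 < δ → δ < δ0 → ∃ z : V, ‖z‖ ≤ M * δ ∧
      ∃ (l : ℝ) (w : V),
        (fderiv ℝ g0 z + δ • fderiv ℝ g1 z) (g0 z + δ • g1 z) = l • (g0 z + δ • g1 z) ∧
        (fderiv ℝ g0 z + δ • fderiv ℝ g1 z) w = l • w ∧
        LinearIndependent ℝ ![g0 z + δ • g1 z, w] ∧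
        ∀ (μ : ℝ) (v : V), v ≠ 0 → (fderiv ℝ g0 z + δ • fderiv ℝ g1 z) v = μ • v → l ≤ μ := by
  have hA0 : ContDiff ℝ 1 (fderiv ℝ g0) := hg0.fderiv_right (by norm_num)
  have hA1 : ContDiff ℝ 1 (fderiv ℝ g1) := hg1.fderiv_right (by norm_num)
  have hg0' : ContDiff ℝ 1 g0 := hg0.of_le (by norm_num)
  have hg1' : ContDiff ℝ 1 g1 := hg1.of_le (by norm_num)
  let g : ℝ → V → V := fun δ z => g0 z + δ • g1 z
  let B : ℝ → V → V →L[ℝ] V := fun δ z => fderiv ℝ g0 z + δ • fderiv ℝ g1 z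
  have hgc : ContDiff ℝ 1 (fun p : ℝ × (V × V × ℝ) => g p.1 p.2.1) := by
    simp only [g]; fun_prop
  have hBc : ContDiff ℝ 1 (fun p : ℝ × (V × V × ℝ) => B p.1 p.2.1) := by
    simp only [B]
    exact (hA0.comp (by fun_prop)).add (contDiff_fst.smul (hA1.comp (by fun_prop)))
  let F : ℝ × (V × V × ℝ) → V × V × ℝ := fun p =>
    (B p.1 p.2.1 (g p.1 p.2.1) - p.2.2.2 • g p.1 p.2.1,
     B p.1 p.2.1 p.2.2.1 - p.2.2.2 • p.2.2.1 + ⟪p.2.2.1, e⟫ • e,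
     ⟪p.2.2.1, e'⟫ - 1)
  have hF : ContDiff ℝ 1 F := by
    refine ContDiff.prodMk ?_ (ContDiff.prodMk ?_ ?_)
    · exact (hBc.clm_apply hgc).sub (ContDiff.smul (by fun_prop) hgc)
    · refine ((hBc.clm_apply (by fun_prop)).sub (by fun_prop)).add (ContDiff.smul ?_ contDiff_const)
      exact ContDiff.inner ℝ (by fun_prop) contDiff_const
    · exact (ContDiff.inner ℝ (by fun_prop) contDiff_const).sub contDiff_const
  have hee' : ⟪e', e⟫ = 0 := by rw [real_inner_comm]; exact hee
  have hF0 : F (0, (0, e', lam)) = 0 := by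
    simp only [F, B, g, hg00, hAe, hAe', he', hee', zero_smul, add_zero, sub_self, Prod.mk_zero_zero]
  obtain ⟨x, M, hM, hx⟩ := aux_ift F hF (0, e', lam) hF0 (by
    rintro ⟨dz, dw, s⟩ hd
    have hgd : HasDerivAt (fun t : ℝ => g0 (t • dz)) (fderiv ℝ g0 0 dz) 0 := by
      have hp : HasDerivAt (fun t : ℝ => t • dz) dz 0 := by
        simpa using (hasDerivAt_id (0 : ℝ)).smul_const dz
      exact HasFDerivAt.comp_hasDerivAt_of_eq (0 : ℝ)
        ((hg0.differentiable (by norm_num)) 0).hasFDerivAt hp (by simp)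
    have hAd : HasDerivAt (fun t : ℝ => fderiv ℝ g0 (t • dz)) (fderiv ℝ (fderiv ℝ g0) 0 dz) 0 := by
      have hp : HasDerivAt (fun t : ℝ => t • dz) dz 0 := by
        simpa using (hasDerivAt_id (0 : ℝ)).smul_const dz
      exact HasFDerivAt.comp_hasDerivAt_of_eq (0 : ℝ)
        ((hA0.differentiable (by norm_num)) 0).hasFDerivAt hp (by simp)
    have hwd : HasDerivAt (fun t : ℝ => e' + t • dw) dw 0 := by
      simpa using ((hasDerivAt_id (0 : ℝ)).smul_const dw).const_add e'
    have hld : HasDerivAt (fun t : ℝ => lam + t * s) s 0 := by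
      simpa using ((hasDerivAt_id (0 : ℝ)).mul_const s).const_add lam
    have k1 := (hAd.clm_apply hgd).sub (hld.smul hgd)
    have k2' : HasDerivAt (fun t : ℝ => ⟪e' + t • dw, e⟫) ⟪dw, e⟫ 0 := by
      simpa using hwd.inner ℝ (hasDerivAt_const (0 : ℝ) e)
    have k2 := ((hAd.clm_apply hwd).sub (hld.smul hwd)).add (k2'.smul_const e)
    have k3 : HasDerivAt (fun t : ℝ => ⟪e' + t • dw, e'⟫ - 1) ⟪dw, e'⟫ 0 := by
      simpa using (hwd.inner ℝ (hasDerivAt_const (0 : ℝ) e')).sub_const 1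
    have hd2 := hd.congr_of_eventuallyEq (Eventually.of_forall (fun t => by
      change _ = F (0, (0, e', lam) + t • (dz, dw, s))
      simp [F, B, g]) : (fun t : ℝ => (fderiv ℝ g0 (t • dz) (g0 (t • dz)) - (lam + t * s) • g0 (t • dz),
        fderiv ℝ g0 (t • dz) (e' + t • dw) - (lam + t * s) • (e' + t • dw) + ⟪e' + t • dw, e⟫ • e,
        ⟪e' + t • dw, e'⟫ - 1)) =ᶠ[𝓝 0] _)
    have k := (k1.prodMk (k2.prodMk k3)).unique hd2
    have e1 := congrArg Prod.fst k
    have e2 := congrArg (fun p => p.2.1) k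
    have e3 := congrArg (fun p => p.2.2) k
    simp only [zero_smul, zero_mul, add_zero, hg00, Prod.fst_zero, Prod.snd_zero] at e1 e2 e3
    have := aux_lin (fderiv ℝ g0 0) (fderiv ℝ (fderiv ℝ g0) 0) e e' lam c (hs0 0) he he' hee hAe hAe' hc
      hpos hTe hTe' hTs hT dz dw s e1 e2 e3
    obtain ⟨r1, r2, r3⟩ := this
    simp [r1, r2, r3])
  have hlc : lam < c := lt_of_le_of_lt (le_max_left _ _) hc
  -- choose epsilon
  obtain ⟨ε, hε0, hε1, hε⟩ : ∃ ε : ℝ, 0 < ε ∧ ε < 1 ∧ 2 * ε + (c - lam) * (2 * ε ^ 2) < c - lam := by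
    have hcont : Tendsto (fun ε : ℝ => 2 * ε + (c - lam) * (2 * ε ^ 2)) (𝓝[>] 0) (𝓝 0) := by
      have : Continuous (fun ε : ℝ => 2 * ε + (c - lam) * (2 * ε ^ 2)) := by fun_prop
      have := this.tendsto 0
      simp only [mul_zero, ne_eq, OfNat.ofNat_ne_zero, not_false_eq_true, zero_pow, add_zero] at this
      exact this.mono_left nhdsWithin_le_nhds
    have h1 := hcont.eventually (gt_mem_nhds (sub_pos.mpr hlc))
    have h2 : ∀ᶠ ε : ℝ in 𝓝[>] 0, ε ∈ Ioo (0 : ℝ) 1 := Ioo_mem_nhdsGT one_pos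
    obtain ⟨ε, h1, h2⟩ := (h1.and h2).exists
    exact ⟨ε, h2.1, h2.2, h1⟩
  have hxt : Tendsto (fun δ : ℝ => (δ, x δ)) (𝓝 0) (𝓝 (0, (0, e', lam))) := by
    refine Filter.Tendsto.prodMk_nhds tendsto_id ?_
    rw [tendsto_iff_norm_sub_tendsto_zero]
    refine squeeze_zero' (g := fun δ : ℝ => M * ‖δ‖) (Eventually.of_forall fun _ => norm_nonneg _)
      (hx.mono fun δ h => h.2) ?_
    have : Continuous (fun δ : ℝ => M * ‖δ‖) := by fun_prop
    simpa using this.tendsto 0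
  have c1 := aux_close hxt e hε0 hgc.continuous (by simp [g, hg00])
  have c2 := aux_close hxt (fderiv ℝ g0 0) hε0 hBc.continuous (by simp [B])
  have c3 := aux_close (f := fun p : ℝ × (V × V × ℝ) => p.2.2.1) hxt e' hε0 (by fun_prop) rfl
  have c4 := aux_close (f := fun p : ℝ × (V × V × ℝ) => p.2.2.2) hxt lam hε0 (by fun_prop) rfl
  have hall := (hx.and (c1.and (c2.and (c3.and c4))))
  obtain ⟨δ0, hδ0, hall⟩ := Metric.eventually_nhds_iff.mp hall
  refine ⟨δ0, M, hδ0, hM, fun δ hδ hδ' => ?_⟩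
  obtain ⟨⟨h1, h2⟩, h3, h4, h5, h6⟩ := hall (y := δ) (by simpa [abs_of_pos hδ] using hδ')
  rcases hxδ : x δ with ⟨z, w, l⟩
  rw [hxδ] at h1 h2 h3 h4 h5 h6
  have e1 : B δ z (g δ z) - l • g δ z = 0 := congrArg Prod.fst h1
  have e2 : B δ z w - l • w + ⟪w, e⟫ • e = 0 := congrArg (fun p => p.2.1) h1
  have e3 : ⟪w, e'⟫ - 1 = 0 := congrArg (fun p => p.2.2) h1
  change ‖g δ z - e‖ ≤ ε at h3
  change ‖B δ z - _‖ ≤ ε at h4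
  change ‖w - e'‖ ≤ ε at h5
  change |l - lam| ≤ ε at h6
  have hBs : ∀ u v, ⟪B δ z u, v⟫ = ⟪u, B δ z v⟫ := by
    intro u v
    simp only [B, add_apply, smul_apply, inner_add_left, inner_add_right, real_inner_smul_left,
      real_inner_smul_right, hs0, hs1]
  have hgB : B δ z (g δ z) = l • g δ z := sub_eq_zero.mp e1
  have hge : ⟪g δ z, e⟫ ≠ 0 := by
    have h7 : ⟪g δ z, e⟫ = 1 + ⟪g δ z - e, e⟫ := by rw [inner_sub_left, he]; ring
    have hne : ‖e‖ = 1 := by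
      have := real_inner_self_eq_norm_sq e
      rw [he] at this
      nlinarith [norm_nonneg e]
    have h8 : |⟪g δ z - e, e⟫| ≤ ‖g δ z - e‖ * ‖e‖ := abs_real_inner_le_norm _ _
    rw [hne, mul_one] at h8
    have := (abs_le.mp (h8.trans h3)).1
    rw [h7]; intro h; linarith
  have hwe : ⟪w, e⟫ = 0 := by
    have := congrArg (fun v => ⟪g δ z, v⟫) e2
    simp only [inner_add_right, inner_sub_right, ← hBs, hgB, real_inner_smul_left, real_inner_smul_right,
      inner_zero_right, sub_self, zero_add] at this
    exact (mul_eq_zero.mp this).resolve_right hge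
  have hwB : B δ z w = l • w := by
    rw [hwe, zero_smul, add_zero] at e2
    exact sub_eq_zero.mp e2
  refine ⟨z, ?_, l, w, hgB, hwB, ?_, ?_⟩
  · have h9 : ‖((z, w, l) - (0, e', lam) : V × V × ℝ).1‖ ≤ ‖((z, w, l) - (0, e', lam) : V × V × ℝ)‖ :=
      norm_fst_le _
    simp only [Prod.fst_sub, sub_zero] at h9
    rw [Real.norm_of_nonneg hδ.le] at h2
    exact h9.trans h2
  · rw [LinearIndependent.pair_iff]
    intro a b hab
    change a • g δ z + b • w = 0 at hab
    have ha : a = 0 := by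
      have := congrArg (fun v => ⟪v, e⟫) hab
      simp only [inner_add_left, real_inner_smul_left, hwe, inner_zero_left, mul_zero, add_zero] at this
      exact (mul_eq_zero.mp this).resolve_right hge
    have hb : b = 0 := by
      have := congrArg (fun v => ⟪v, e'⟫) hab
      rw [sub_eq_zero] at e3
      simp only [ha, inner_add_left, real_inner_smul_left, inner_zero_left, e3, zero_mul, zero_add, mul_one] at this
      exact this
    exact ⟨ha, hb⟩
  · intro μ v hv hBv
    exact aux_min (fderiv ℝ g0 0) (B δ z) e e' (g δ z) w lam c l ε (hs0 0) hBs he he' hee hAe hAe' hlc hpos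
      hε h3 h5 h6 h4 hgB hwB μ v hv hBv

structure IsJet (f : V → ℝ) (L : V → ℝ) (Q : V → V → ℝ) (T : V → V → V → ℝ) : Prop where
  cd : ContDiff ℝ 4 f
  d1 : ∀ v, fderiv ℝ f 0 v = L v
  d2 : ∀ u v, fderiv ℝ (fderiv ℝ f) 0 u v = Q u v
  d3 : ∀ u v w, fderiv ℝ (fderiv ℝ (fderiv ℝ f)) 0 u v w = T u v w

lemma IsJet.add {f f' L L' Q Q' T T'} (h : IsJet (V := V) f L Q T) (h' : IsJet f' L' Q' T') :
    IsJet (fun x => f x + f' x) (fun v => L v + L' v) (fun u v => Q u v + Q' u v)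
      (fun u v w => T u v w + T' u v w) := by
  have a1 : fderiv ℝ (fun x => f x + f' x) = fun x => fderiv ℝ f x + fderiv ℝ f' x := by
    funext x
    exact fderiv_fun_add (h.cd.differentiable (by norm_num) x) (h'.cd.differentiable (by norm_num) x)
  have c1 : ContDiff ℝ 3 (fderiv ℝ f) := h.cd.fderiv_right (by norm_num)
  have c1' : ContDiff ℝ 3 (fderiv ℝ f') := h'.cd.fderiv_right (by norm_num)
  have a2 : fderiv ℝ (fderiv ℝ (fun x => f x + f' x)) =
      fun x => fderiv ℝ (fderiv ℝ f) x + fderiv ℝ (fderiv ℝ f') x := by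
    rw [a1]; funext x
    exact fderiv_fun_add (c1.differentiable (by norm_num) x) (c1'.differentiable (by norm_num) x)
  have c2 : ContDiff ℝ 2 (fderiv ℝ (fderiv ℝ f)) := c1.fderiv_right (by norm_num)
  have c2' : ContDiff ℝ 2 (fderiv ℝ (fderiv ℝ f')) := c1'.fderiv_right (by norm_num)
  refine ⟨h.cd.add h'.cd, ?_, ?_, ?_⟩
  · intro v; rw [a1]; simp [h.d1, h'.d1]
  · intro u v; rw [a2]; simp [h.d2, h'.d2]
  · intro u v w
    rw [a2, fderiv_fun_add (c2.differentiable (by norm_num) _) (c2'.differentiable (by norm_num) _)]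
    simp [h.d3, h'.d3]

lemma IsJet.mul {f L Q T} (c : ℝ) (h : IsJet (V := V) f L Q T) :
    IsJet (fun x => c * f x) (fun v => c * L v) (fun u v => c * Q u v)
      (fun u v w => c * T u v w) := by
  have a1 : fderiv ℝ (fun x => c * f x) = fun x => c • fderiv ℝ f x := by
    funext x
    exact fderiv_const_mul (h.cd.differentiable (by norm_num) x) c
  have c1 : ContDiff ℝ 3 (fderiv ℝ f) := h.cd.fderiv_right (by norm_num)
  have a2 : fderiv ℝ (fderiv ℝ (fun x => c * f x)) = fun x => c • fderiv ℝ (fderiv ℝ f) x := by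
    rw [a1]; funext x
    exact fderiv_fun_const_smul (c1.differentiable (by norm_num) x) c
  have c2 : ContDiff ℝ 2 (fderiv ℝ (fderiv ℝ f)) := c1.fderiv_right (by norm_num)
  refine ⟨contDiff_const.mul h.cd, ?_, ?_, ?_⟩
  · intro v; rw [a1]; simp [h.d1]
  · intro u v; rw [a2]; simp [h.d2]
  · intro u v w
    rw [a2, fderiv_fun_const_smul (c2.differentiable (by norm_num) _) c]
    simp [h.d3]

lemma IsJet.zero : IsJet (V := V) (fun _ => 0) (fun _ => 0) (fun _ _ => 0) (fun _ _ _ => 0) := by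
  have a1 : fderiv ℝ (fun _ : V => (0 : ℝ)) = fun _ => 0 := by funext x; simp
  have a2 : fderiv ℝ (fun _ : V => (0 : V →L[ℝ] ℝ)) = fun _ => 0 := by funext x; simp
  refine ⟨contDiff_const, ?_, ?_, ?_⟩
  · simp
  · rw [a1, a2]; simp
  · rw [a1, a2]; simp

lemma IsJet.sum {ι : Type*} (s : Finset ι) {f : ι → V → ℝ} {L : ι → V → ℝ} {Q : ι → V → V → ℝ} {T : ι → V → V → V → ℝ}
    (h : ∀ i, IsJet (f i) (L i) (Q i) (T i)) :
    IsJet (fun x => ∑ i ∈ s, f i x) (fun v => ∑ i ∈ s, L i v) (fun u v => ∑ i ∈ s, Q i u v)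
      (fun u v w => ∑ i ∈ s, T i u v w) := by
  classical
  induction s using Finset.induction_on with
  | empty => simpa using IsJet.zero
  | insert a s ha ih => simpa only [Finset.sum_insert ha] using (h a).add ih

lemma IsJet.lin (a : V →L[ℝ] ℝ) : IsJet (fun x => a x) (fun v => a v) (fun _ _ => 0) (fun _ _ _ => 0) := by
  have a1 : fderiv ℝ (fun x => a x) = fun _ => a := by funext x; exact a.fderiv
  have a2 : fderiv ℝ (fun _ : V => a) = fun _ => 0 := by funext x; simp
  refine ⟨a.contDiff, ?_, ?_, ?_⟩
  · rw [a1]; simp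
  · rw [a1, a2]; simp
  · rw [a1, a2]; simp

lemma IsJet.quad (a b : V →L[ℝ] ℝ) : IsJet (fun x => a x * b x) (fun _ => 0)
    (fun u v => a u * b v + b u * a v) (fun _ _ _ => 0) := by
  have a1 : fderiv ℝ (fun x => a x * b x) = fun x => (a.smulRight b + b.smulRight a) x := by
    funext x
    refine ((a.hasFDerivAt.mul b.hasFDerivAt).fderiv).trans ?_
    ext v; simp
  have a2 : fderiv ℝ (fun x => (a.smulRight b + b.smulRight a) x) =
    fun _ => (a.smulRight b + b.smulRight a) := by funext x; exact ContinuousLinearMap.fderiv _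
  refine ⟨a.contDiff.mul b.contDiff, ?_, ?_, ?_⟩
  · rw [a1]; simp
  · rw [a1, a2]; simp
  · rw [a1, a2]; simp

set_option maxSynthPendingDepth 3 in
lemma IsJet.cub (a b c : V →L[ℝ] ℝ) : IsJet (fun x => a x * b x * c x) (fun _ => 0) (fun _ _ => 0)
    (fun u v w => a u * (b v * c w + c v * b w) + b u * (a v * c w + c v * a w)
      + c u * (a v * b w + b v * a w)) := by
  have a1 : fderiv ℝ (fun x => a x * b x * c x) = fun x => (a x * b x) • c + (a x * c x) • b
      + (b x * c x) • a := by
    funext x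
    refine (((a.hasFDerivAt.mul b.hasFDerivAt).mul c.hasFDerivAt).fderiv).trans ?_
    ext v; simp; ring
  let K : V →L[ℝ] V →L[ℝ] V →L[ℝ] ℝ := a.smulRight (b.smulRight c + c.smulRight b) +
    b.smulRight (a.smulRight c + c.smulRight a) + c.smulRight (a.smulRight b + b.smulRight a)
  have a2 : fderiv ℝ (fun x => (a x * b x) • c + (a x * c x) • b + (b x * c x) • a) = fun x => K x := by
    funext x
    have := ((((a.hasFDerivAt (x := x)).mul b.hasFDerivAt).smul_const c).add
      (((a.hasFDerivAt (x := x)).mul c.hasFDerivAt).smul_const b)).add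
      (((b.hasFDerivAt (x := x)).mul c.hasFDerivAt).smul_const a)
    refine (HasFDerivAt.fderiv this).trans ?_
    ext u v; simp [K]; ring
  have a3 : fderiv ℝ (fun x => K x) = fun _ => K := by funext x; exact ContinuousLinearMap.fderiv _
  refine ⟨(a.contDiff.mul b.contDiff).mul c.contDiff, ?_, ?_, ?_⟩
  · rw [a1]; simp
  · rw [a1, a2]; simp
  · intro u v w; rw [a1, a2, a3]; simp [K]; ring

set_option maxSynthPendingDepth 3 in
lemma IsJet.rem (f : V → ℝ) (hf : ContDiff ℝ 4 f) (h : ∀ k : ℕ, k ≤ 3 → iteratedFDeriv ℝ k f 0 = 0) :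
    IsJet f (fun _ => 0) (fun _ _ => 0) (fun _ _ _ => 0) := by
  have h1 : fderiv ℝ f 0 = 0 := by
    rw [← norm_eq_zero, ← norm_iteratedFDeriv_zero (𝕜 := ℝ), norm_iteratedFDeriv_fderiv, h 1 (by norm_num), norm_zero]
  have h2 : fderiv ℝ (fderiv ℝ f) 0 = 0 := by
    rw [← norm_eq_zero, ← norm_iteratedFDeriv_zero (𝕜 := ℝ), norm_iteratedFDeriv_fderiv, norm_iteratedFDeriv_fderiv,
      h 2 (by norm_num), norm_zero]
  have h3 : fderiv ℝ (fderiv ℝ (fderiv ℝ f)) 0 = 0 := by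
    rw [← norm_eq_zero, ← norm_iteratedFDeriv_zero (𝕜 := ℝ), norm_iteratedFDeriv_fderiv, norm_iteratedFDeriv_fderiv,
      norm_iteratedFDeriv_fderiv, h 3 (by norm_num), norm_zero]
  exact ⟨hf, by simp [h1], by simp [h2], by simp [h3]⟩

lemma aux_inner_grad [CompleteSpace V] (f : V → ℝ) (x v : V) : ⟪gradient f x, v⟫ = fderiv ℝ f x v := by
  simp [gradient]

lemma aux_grad_cd [FiniteDimensional ℝ V] [CompleteSpace V] (f : V → ℝ) (hf : ContDiff ℝ 4 f) :
    ContDiff ℝ 3 (gradient f) := by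
  let b := stdOrthonormalBasis ℝ V
  have h1 : ContDiff ℝ 3 (fderiv ℝ f) := hf.fderiv_right (by norm_num)
  have : gradient f = fun x => ∑ i, (fderiv ℝ f x (b i)) • b i := by
    funext x
    rw [← b.sum_repr' (gradient f x)]
    refine Finset.sum_congr rfl fun i _ => ?_
    rw [real_inner_comm, aux_inner_grad]
  rw [this]
  exact ContDiff.sum fun i _ => (h1.clm_apply contDiff_const).smul contDiff_const

lemma aux_inner_hess [FiniteDimensional ℝ V] [CompleteSpace V] (f : V → ℝ) (hf : ContDiff ℝ 4 f) (x u v : V) :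
    ⟪fderiv ℝ (gradient f) x u, v⟫ = fderiv ℝ (fderiv ℝ f) x u v := by
  have h1 : ContDiff ℝ 3 (fderiv ℝ f) := hf.fderiv_right (by norm_num)
  have a := ((aux_grad_cd f hf).differentiable (by norm_num) x).hasFDerivAt
  have a' := (innerSL ℝ v).hasFDerivAt.comp x a
  have b := (h1.differentiable (by norm_num) x).hasFDerivAt
  have b' := (ContinuousLinearMap.apply ℝ ℝ v).hasFDerivAt.comp x b
  have hE : ((innerSL ℝ v) ∘ gradient f) = (ContinuousLinearMap.apply ℝ ℝ v) ∘ fderiv ℝ f := by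
    funext y
    simp
  rw [hE] at a'
  have := congrArg (fun L => L u) (a'.unique b')
  simpa [real_inner_comm] using this

lemma aux_inner_third [FiniteDimensional ℝ V] [CompleteSpace V] (f : V → ℝ) (hf : ContDiff ℝ 4 f) (x u v w : V) :
    ⟪fderiv ℝ (fderiv ℝ (gradient f)) x u v, w⟫ = fderiv ℝ (fderiv ℝ (fderiv ℝ f)) x u v w := by
  have h1 : ContDiff ℝ 3 (fderiv ℝ f) := hf.fderiv_right (by norm_num)
  have h2 : ContDiff ℝ 2 (fderiv ℝ (fderiv ℝ f)) := h1.fderiv_right (by norm_num)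
  have g2 : ContDiff ℝ 2 (fderiv ℝ (gradient f)) := (aux_grad_cd f hf).fderiv_right (by norm_num)
  have a := (g2.differentiable (by norm_num) x).hasFDerivAt
  have a' := ((innerSL ℝ w).comp (ContinuousLinearMap.apply ℝ V v)).hasFDerivAt.comp x a
  have b := (h2.differentiable (by norm_num) x).hasFDerivAt
  have b' := ((ContinuousLinearMap.apply ℝ ℝ w).comp (ContinuousLinearMap.apply ℝ (V →L[ℝ] ℝ) v)).hasFDerivAt.comp x b
  have hE : (((innerSL ℝ w).comp (ContinuousLinearMap.apply ℝ V v)) ∘ fderiv ℝ (gradient f)) =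
      ((ContinuousLinearMap.apply ℝ ℝ w).comp (ContinuousLinearMap.apply ℝ (V →L[ℝ] ℝ) v)) ∘ fderiv ℝ (fderiv ℝ f) := by
    funext y
    have := aux_inner_hess f hf y v w
    rw [real_inner_comm] at this
    simpa using this
  rw [hE] at a'
  have := congrArg (fun L => L u) (a'.unique b')
  simpa [real_inner_comm] using this

lemma aux_hess_symm [FiniteDimensional ℝ V] [CompleteSpace V] (f : V → ℝ) (hf : ContDiff ℝ 4 f) (x u v : V) :
    ⟪fderiv ℝ (gradient f) x u, v⟫ = ⟪u, fderiv ℝ (gradient f) x v⟫ := by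
  rw [← real_inner_comm u, aux_inner_hess f hf, aux_inner_hess f hf]
  exact (hf.contDiffAt.isSymmSndFDerivAt (by simp; norm_num)) u v

end AuxLemmas


lemma aux_jet {N : ℕ} (E0 : Vec (N + 2) → ℝ) (α0 lam0 : ℝ)
    (H : Fin (N + 2) → Fin (N + 2) → ℝ) (G : Fin (N + 2) → Fin (N + 2) → Fin (N + 2) → ℝ)
    (hform : E0Form E0 α0 lam0 H G) :
    IsJet E0 (fun v => Real.cos α0 * v 0 + Real.sin α0 * v 1)
      (fun u v => lam0 * (u 0 * v 0 + u 1 * v 1)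
        + (1 / 2) * ∑ i ∈ Ic N, ∑ j ∈ Ic N, H i j * (u i * v j + u j * v i))
      (fun u v w => 3 * (u 0 * v 0 * w 0) + (u 0 * v 1 * w 1 + u 1 * v 0 * w 1 + u 1 * v 1 * w 0)
        + (1 / 6) * ∑ i ∈ Ic N, ∑ j ∈ Ic N, ∑ k ∈ Ic N, G i j k *
          (u i * (v j * w k + v k * w j) + u j * (v i * w k + v k * w i) + u k * (v i * w j + v j * w i))) := by
  obtain ⟨ρ, hρ, hρ0, hE⟩ := hform
  let p : Fin (N + 2) → Vec (N + 2) →L[ℝ] ℝ := fun i => EuclideanSpace.proj i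
  have hp : ∀ i x, p i x = x i := fun _ _ => rfl
  have j := (((((((IsJet.lin (p 0)).mul (Real.cos α0)).add ((IsJet.lin (p 1)).mul (Real.sin α0))).add
    (((IsJet.quad (p 0) (p 0)).add (IsJet.quad (p 1) (p 1))).mul (lam0 / 2))).add
    (((IsJet.cub (p 0) (p 0) (p 0)).add (IsJet.cub (p 0) (p 1) (p 1))).mul (1 / 2))).add
    ((IsJet.sum (Ic N) fun i => IsJet.sum (Ic N) fun j => (IsJet.quad (p i) (p j)).mul (H i j)).mul (1 / 2))).add
    ((IsJet.sum (Ic N) fun i => IsJet.sum (Ic N) fun j => IsJet.sum (Ic N) fun k =>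
      (IsJet.cub (p i) (p j) (p k)).mul (G i j k)).mul (1 / 6))).add (IsJet.rem ρ hρ hρ0)
  convert j using 1
  · rw [hE]; funext x
    simp only [hp, mul_assoc, pow_succ, pow_zero, one_mul]
  · funext v
    simp [hp]
  · funext u v
    simp only [hp, Finset.sum_const_zero, mul_zero]
    ring
  · funext u v w
    simp only [hp, Finset.sum_const_zero, mul_zero]
    ring

lemma aux_inner_coords {N : ℕ} (u v : Vec (N + 2)) :
    ⟪u, v⟫ = u 0 * v 0 + u 1 * v 1 + ∑ i ∈ Ic N, u i * v i := by
  have h : (Finset.univ : Finset (Fin (N + 2))) = insert 0 (insert 1 (Ic N)) := by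
    ext i
    simp only [Ic, Finset.mem_univ, Finset.mem_insert, Finset.mem_filter, true_and, true_iff, Fin.ext_iff,
      Fin.val_zero, Fin.val_one]
    omega
  have h1 : (1 : Fin (N + 2)) ∉ Ic N := by simp [Ic]
  have h0 : (0 : Fin (N + 2)) ∉ insert 1 (Ic N) := by simp [Ic]
  rw [PiLp.inner_apply, h, Finset.sum_insert h0, Finset.sum_insert h1, ← add_assoc]
  simp [mul_comm]

/-- (Perturbation of the singularity, Lemma `th:transform-lemma` /
part 1 of Theorem `thm:quasi-periodic-GAD`.) For `E^δ = E⁰ + δ ΔE` with `E⁰` of the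
normal form, there are `δ0, M > 0` such that for `0 < δ < δ0` there exists `z^δ` with
`‖z^δ‖ ≤ Mδ` at which the two smallest Hessian eigenvalues coincide and the gradient
lies in the span of two corresponding eigenvectors. -/
theorem stmt18 {N : ℕ} (E0 ΔE : Vec (N + 2) → ℝ)
    (hE0 : ContDiff ℝ 4 E0) (hΔE : ContDiff ℝ 4 ΔE)
    (α0 lam0 : ℝ) (hα0 : α0 ∈ Set.Ioo 0 (π / 2) ∪ Set.Ioo (π / 2) π)
    (H : Fin (N + 2) → Fin (N + 2) → ℝ) (G : Fin (N + 2) → Fin (N + 2) → Fin (N + 2) → ℝ)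
    (hform : E0Form E0 α0 lam0 H G) (hH : HPos H lam0) :
    ∃ δ0 M : ℝ, 0 < δ0 ∧ 0 < M ∧
      ∀ δ : ℝ, 0 < δ → δ < δ0 →
        ∃ z : Vec (N + 2), ‖z‖ ≤ M * δ ∧
          SingularWithGradInPlane (fun x => E0 x + δ * ΔE x) z := by
  obtain ⟨hHs, c, hc, hHc⟩ := hH
  have hj := aux_jet E0 α0 lam0 H G hform
  let e : Vec (N + 2) := WithLp.toLp 2 fun i =>
    if i = 0 then Real.cos α0 else if i = 1 then Real.sin α0 else 0
  let e' : Vec (N + 2) := WithLp.toLp 2 fun i =>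
    if i = 0 then - Real.sin α0 else if i = 1 then Real.cos α0 else 0
  have e0 : e 0 = Real.cos α0 := by simp [e]
  have e1 : e 1 = Real.sin α0 := by simp [e]
  have e0' : e' 0 = - Real.sin α0 := by simp [e']
  have e1' : e' 1 = Real.cos α0 := by simp [e']
  have hIc : ∀ i ∈ Ic N, i ≠ 0 ∧ i ≠ 1 := by
    intro i hi
    simp only [Ic, Finset.mem_filter] at hi
    constructor
    · rintro rfl; simp at hi
    · rintro rfl; simp at hi
  have ei : ∀ i ∈ Ic N, e i = 0 := fun i hi => by simp [e, hIc i hi]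
  have ei' : ∀ i ∈ Ic N, e' i = 0 := fun i hi => by simp [e', hIc i hi]
  clear_value e e'
  have hsc := Real.sin_sq_add_cos_sq α0
  have ine : ∀ v : Vec (N + 2), ⟪v, e⟫ = v 0 * Real.cos α0 + v 1 * Real.sin α0 := by
    intro v
    rw [aux_inner_coords, Finset.sum_eq_zero (fun i hi => by rw [ei i hi, mul_zero]), e0, e1, add_zero]
  have ine' : ∀ v : Vec (N + 2), ⟪v, e'⟫ = v 0 * (- Real.sin α0) + v 1 * Real.cos α0 := by
    intro v
    rw [aux_inner_coords, Finset.sum_eq_zero (fun i hi => by rw [ei' i hi, mul_zero]), e0', e1', add_zero]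
  have perp : ∀ v : Vec (N + 2), ⟪v, e⟫ = 0 → ⟪v, e'⟫ = 0 → v 0 = 0 ∧ v 1 = 0 := by
    intro v h h'
    rw [ine] at h
    rw [ine'] at h'
    constructor
    · linear_combination Real.cos α0 * h - Real.sin α0 * h' - v 0 * hsc
    · linear_combination Real.sin α0 * h + Real.cos α0 * h' - v 1 * hsc
  -- second derivative on plane vectors
  have Q0 : ∀ p v : Vec (N + 2), (∀ i ∈ Ic N, p i = 0) →
      ⟪fderiv ℝ (gradient E0) 0 p, v⟫ = lam0 * (p 0 * v 0 + p 1 * v 1) := by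
    intro p v hp
    rw [aux_inner_hess E0 hE0, hj.d2]
    rw [Finset.sum_eq_zero (fun i hi => Finset.sum_eq_zero (fun j hjj => by rw [hp i hi, hp j hjj]; ring))]
    ring
  have T0 : ∀ u p v : Vec (N + 2), (∀ i ∈ Ic N, p i = 0) →
      ⟪fderiv ℝ (fderiv ℝ (gradient E0)) 0 u p, v⟫ =
        3 * (u 0 * p 0 * v 0) + (u 0 * p 1 * v 1 + u 1 * p 0 * v 1 + u 1 * p 1 * v 0) := by
    intro u p v hp
    rw [aux_inner_third E0 hE0, hj.d3]
    rw [Finset.sum_eq_zero (fun i hi => Finset.sum_eq_zero (fun j hjj => Finset.sum_eq_zero (fun k hk => by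
      rw [hp i hi, hp j hjj, hp k hk]; ring)))]
    ring
  have hfd : FiniteDimensional ℝ (Vec (N + 2)) := inferInstance
  obtain ⟨δ0, M, hδ0, hM, hall⟩ := aux_core (gradient E0) (gradient ΔE)
    ((aux_grad_cd E0 hE0).of_le (by norm_num)) ((aux_grad_cd ΔE hΔE).of_le (by norm_num))
    (aux_hess_symm E0 hE0) (aux_hess_symm ΔE hΔE) e e' lam0 c
    (by rw [ine, e0, e1]; linarith) (by rw [ine', e0', e1']; linarith) (by rw [ine', e0, e1]; ring)
    (by
      refine ext_inner_right ℝ fun v => ?_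
      rw [aux_inner_grad, hj.d1, real_inner_comm, ine]; ring)
    (by
      refine ext_inner_right ℝ fun v => ?_
      rw [Q0 e v ei, real_inner_smul_left, real_inner_comm, ine, e0, e1]; ring)
    (by
      refine ext_inner_right ℝ fun v => ?_
      rw [Q0 e' v ei', real_inner_smul_left, real_inner_comm, ine', e0', e1']; ring)
    hc
    (by
      intro v hv hv'
      obtain ⟨h0, h1⟩ := perp v hv hv'
      rw [← aux_hess_symm E0 hE0, aux_inner_hess E0 hE0, hj.d2, aux_inner_coords, h0, h1]
      have := hHc v
      have h2 : ∑ i ∈ Ic N, ∑ j ∈ Ic N, H i j * (v i * v j + v j * v i) =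
          2 * ∑ i ∈ Ic N, ∑ j ∈ Ic N, H i j * v i * v j := by
        simp only [Finset.mul_sum]
        refine Finset.sum_congr rfl fun i _ => Finset.sum_congr rfl fun j _ => ?_
        ring
      have h3 : ∑ i ∈ Ic N, v i * v i = ∑ i ∈ Ic N, (v i) ^ 2 :=
        Finset.sum_congr rfl fun i _ => (sq (v i)).symm
      rw [h2, h3]
      linarith)
    (by
      intro u v hv hv'
      obtain ⟨h0, h1⟩ := perp v hv hv'
      rw [T0 u e v ei, h0, h1]; ring)
    (by
      intro u v hv hv'
      obtain ⟨h0, h1⟩ := perp v hv hv'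
      rw [T0 u e' v ei', h0, h1]; ring)
    (by
      intro u
      rw [T0 u e' e ei', T0 u e e' ei]; ring)
    (by
      intro a b s h1 h2
      obtain ⟨u, hu⟩ : ∃ u, u = a • e + b • e' := ⟨_, rfl⟩
      have hu0 : u 0 = a * Real.cos α0 - b * Real.sin α0 := by
        rw [hu]; simp only [PiLp.add_apply, PiLp.smul_apply, smul_eq_mul, e0, e0']; ring
      have hu1 : u 1 = a * Real.sin α0 + b * Real.cos α0 := by
        rw [hu]; simp only [PiLp.add_apply, PiLp.smul_apply, smul_eq_mul, e1, e1']
      rw [← hu] at h1 h2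
      have k1 := congrArg (fun v => ⟪v, e⟫) h1
      have k2 := congrArg (fun v => ⟪v, e'⟫) h2
      have k3 := congrArg (fun v => ⟪v, e'⟫) h1
      simp only [T0 u e _ ei, T0 u e' _ ei', PiLp.smul_apply, smul_eq_mul, ine, ine', e0, e1, e0', e1'] at k1 k2 k3
      set C := Real.cos α0
      set S := Real.sin α0
      -- matrix is s times identity
      have m1 : u 0 = 0 := by
        linear_combination (C^2-S^2)/2*(k1-k2) - 2*C*S*k3 - u 0*((S^2+C^2)+1)*hsc
      have m2 : u 1 = 0 := by
        linear_combination C*S*(k1-k2) + (C^2-S^2)*k3 - u 1*((S^2+C^2)+1)*hsc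
      rw [hu0] at m1
      rw [hu1] at m2
      constructor
      · linear_combination C * m1 + S * m2 - a * hsc
      · linear_combination C * m2 - S * m1 - b * hsc)
  refine ⟨δ0, M, hδ0, hM, fun δ hδ hδ' => ?_⟩
  obtain ⟨z, hz, l, w, hg, hw, hli, hmin⟩ := hall δ hδ hδ'
  have hgr : gradient (fun x => E0 x + δ * ΔE x) = fun x => gradient E0 x + δ • gradient ΔE x := by
    funext x
    refine ext_inner_right ℝ fun v => ?_
    have a0 := hE0.differentiable (by norm_num) x
    have a1 := hΔE.differentiable (by norm_num) x
    rw [inner_add_left, real_inner_smul_left, aux_inner_grad, aux_inner_grad, aux_inner_grad,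
      fderiv_fun_add a0 (a1.const_mul δ), fderiv_const_mul a1]
    simp
  have hhe : ∀ v, hessOp (fun x => E0 x + δ * ΔE x) z v =
      (fderiv ℝ (gradient E0) z + δ • fderiv ℝ (gradient ΔE) z) v := by
    intro v
    have a0 := (aux_grad_cd E0 hE0).differentiable (by norm_num) z
    have a1 := (aux_grad_cd ΔE hΔE).differentiable (by norm_num) z
    change fderiv ℝ (gradient (fun x => E0 x + δ * ΔE x)) z v = _
    have hh : fderiv ℝ (fun x => gradient E0 x + δ • gradient ΔE x) z =
        fderiv ℝ (gradient E0) z + δ • fderiv ℝ (gradient ΔE) z :=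
      (a0.hasFDerivAt.add (a1.hasFDerivAt.const_smul δ)).fderiv
    rw [hgr, hh]
  have mg : gradient (fun x => E0 x + δ * ΔE x) z ∈
      Module.End.eigenspace (hessOp (fun x => E0 x + δ * ΔE x) z) l := by
    rw [Module.End.mem_eigenspace_iff, hhe, hgr]; exact hg
  have mw : w ∈ Module.End.eigenspace (hessOp (fun x => E0 x + δ * ΔE x) z) l := by
    rw [Module.End.mem_eigenspace_iff, hhe]; exact hw
  have hw0 : w ≠ 0 := hli.ne_zero 1
  refine ⟨z, hz, l, Module.End.hasEigenvalue_of_hasEigenvector ⟨mw, hw0⟩, ?_, ?_, mg⟩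
  · intro μ hμ
    obtain ⟨v, hv⟩ := hμ.exists_hasEigenvector
    refine hmin μ v hv.2 ?_
    rw [← hhe]
    exact hv.apply_eq_smul
  · rw [hgr] at mg
    have hli2 : LinearIndependent ℝ (![⟨_, mg⟩, ⟨w, mw⟩] :
        Fin 2 → Module.End.eigenspace (hessOp (fun x => E0 x + δ * ΔE x) z) l) := by
      rw [LinearIndependent.pair_iff] at hli ⊢
      intro s t h
      exact hli s t (by simpa using congrArg Subtype.val h)
    simpa using hli2.fintype_card_le_finrank
end
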